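/- arXiv:0911.1682 — 2 statements merged into one kernel-verified Lean document; each statement's English description precedes it below -/
import Mathlib

section
/- Suppose condition (cl) holds, f ∈ 𝓕 satisfies 𝔼 f(X_1) = 0, and for a given x ≥ 0 the set {1 ≤ k ≤ n : n δ'_k ≤ k x} is nonempty; let k*' denote its minimum. Then ℙ( S(f) ≥ 2 √(n σ_{k*'}²(f) x) + 1.34 k*' x ) ≤ e^{−x}. -/
open MeasureTheory ProbabilityTheory Real
open scoped ENNReal

set_option linter.unusedSectionVars false

/-- The `m`-fold convolution power of a measure on `ℝ`. -/
noncomputable def convPow (μ : Measure ℝ) : ℕ → Measure ℝ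
  | 0 => Measure.dirac 0
  | m + 1 => (convPow μ m).conv μ

instance convPow_isProbabilityMeasure (μ : Measure ℝ) [IsProbabilityMeasure μ] (m : ℕ) :
    IsProbabilityMeasure (convPow μ m) := by
  induction m with
  | zero => simp only [convPow]; infer_instance
  | succ m ih => simp only [convPow]; infer_instance

lemma convPow_ae_abs_le {μ : Measure ℝ} [IsProbabilityMeasure μ] {b : ℝ}
    (hb : ∀ᵐ y ∂μ, |y| ≤ b) (m : ℕ) : ∀ᵐ y ∂convPow μ m, |y| ≤ m * b := by
  induction m with
  | zero => simp [convPow, ae_dirac_eq]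
  | succ m ih =>
    simp only [convPow, Measure.conv]
    rw [ae_map_iff (by fun_prop) (measurableSet_le (by fun_prop) (by fun_prop))]
    have h1 : ∀ᵐ p ∂(convPow μ m).prod μ, |p.1| ≤ m * b :=
      Measure.quasiMeasurePreserving_fst.ae ih
    have h2 : ∀ᵐ p ∂(convPow μ m).prod μ, |p.2| ≤ b :=
      Measure.quasiMeasurePreserving_snd.ae hb
    filter_upwards [h1, h2] with p h1 h2
    push_cast
    linarith [abs_add_le p.1 p.2]

lemma integrable_of_ae_abs_le {μ : Measure ℝ} [IsProbabilityMeasure μ] {b : ℝ}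
    (hb : ∀ᵐ y ∂μ, |y| ≤ b) {g : ℝ → ℝ} (hg : Continuous g) : Integrable g μ := by
  obtain ⟨C, hC⟩ := (isCompact_Icc (a := -b) (b := b)).exists_bound_of_continuousOn
    hg.continuousOn
  refine Integrable.of_bound hg.aestronglyMeasurable C ?_
  filter_upwards [hb] with y hy
  exact hC y (abs_le.mp hy)

lemma integral_convPow_succ {μ : Measure ℝ} [IsProbabilityMeasure μ] {b : ℝ}
    (hb : ∀ᵐ y ∂μ, |y| ≤ b) (m : ℕ) {g : ℝ → ℝ} (hg : Continuous g) :
    ∫ y, g y ∂convPow μ (m + 1) = ∫ y, ∫ z, g (y + z) ∂μ ∂convPow μ m := by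
  have hi : Integrable g (convPow μ (m + 1)) :=
    integrable_of_ae_abs_le (convPow_ae_abs_le hb (m + 1)) hg
  simp only [convPow] at hi ⊢
  exact integral_conv hi

lemma integral_id_convPow {μ : Measure ℝ} [IsProbabilityMeasure μ] {b : ℝ}
    (hb : ∀ᵐ y ∂μ, |y| ≤ b) (h0 : ∫ y, y ∂μ = 0) (m : ℕ) : ∫ y, y ∂convPow μ m = 0 := by
  induction m with
  | zero => simp [convPow]
  | succ m ih =>
    have h1 : Integrable (fun y : ℝ => y) μ := integrable_of_ae_abs_le hb continuous_id
    rw [integral_convPow_succ hb m (g := fun y => y) continuous_id, ← ih]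
    refine integral_congr_ae (ae_of_all _ fun y => ?_)
    change ∫ z, y + z ∂μ = y
    rw [integral_add (integrable_const y) h1, h0]
    simp

lemma integral_sq_convPow {μ : Measure ℝ} [IsProbabilityMeasure μ] {b : ℝ}
    (hb : ∀ᵐ y ∂μ, |y| ≤ b) (h0 : ∫ y, y ∂μ = 0) (m : ℕ) :
    ∫ y, y ^ 2 ∂convPow μ m = m * ∫ y, y ^ 2 ∂μ := by
  induction m with
  | zero => simp [convPow]
  | succ m ih =>
    have h1 : Integrable (fun y : ℝ => y) μ := integrable_of_ae_abs_le hb continuous_id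
    have h2 : Integrable (fun y : ℝ => y ^ 2) μ := integrable_of_ae_abs_le hb (by fun_prop)
    have h3 : Integrable (fun y : ℝ => y ^ 2) (convPow μ m) :=
      integrable_of_ae_abs_le (convPow_ae_abs_le hb m) (by fun_prop)
    rw [integral_convPow_succ hb m (g := fun y => y ^ 2) (by fun_prop)]
    have : ∀ y : ℝ, ∫ z, (y + z) ^ 2 ∂μ = y ^ 2 + ∫ z, z ^ 2 ∂μ := by
      intro y
      have : ∀ z : ℝ, (y + z) ^ 2 = (y ^ 2 + 2 * y * z) + z ^ 2 := by intro z; ring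
      simp_rw [this]
      have h4 : Integrable (fun z : ℝ => y ^ 2 + 2 * y * z) μ :=
        (integrable_const _).add (h1.const_mul _)
      rw [integral_add h4 h2, integral_add (integrable_const _) (h1.const_mul _),
        integral_const_mul, h0]
      simp
    simp_rw [this]
    rw [integral_add h3 (integrable_const _), ih]
    simp
    ring

lemma mgf_convPow {μ : Measure ℝ} [IsProbabilityMeasure μ] {b : ℝ}
    (hb : ∀ᵐ y ∂μ, |y| ≤ b) (t : ℝ) (m : ℕ) :
    ∫ y, exp (t * y) ∂convPow μ m = (∫ y, exp (t * y) ∂μ) ^ m := by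
  induction m with
  | zero => simp [convPow]
  | succ m ih =>
    rw [integral_convPow_succ hb m (g := fun y => exp (t * y)) (by fun_prop)]
    simp_rw [mul_add, exp_add, integral_const_mul, integral_mul_const]
    rw [ih, pow_succ]

/-- One step of a chain: a summand that is dominated by an independent copy plus a constant. -/
lemma lintegral_add_le_conv {Ω : Type*} [MeasurableSpace Ω] {P : Measure Ω}
    [IsProbabilityMeasure P] {Z C C' : Ω → ℝ} {ρ μ : Measure ℝ} [SFinite ρ] [SFinite μ]
    {D ε : ℝ} (hZ : AEMeasurable Z P) (hC' : AEMeasurable C' P)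
    (hdom : ∀ g : ℝ → ℝ≥0∞, Monotone g → ∫⁻ ω, g (Z ω) ∂P ≤ ∫⁻ y, g (y + D) ∂ρ)
    (hlaw : P.map C' = μ) (hind : IndepFun C' Z P) (hle : ∀ᵐ ω ∂P, C ω ≤ C' ω + ε)
    (g : ℝ → ℝ≥0∞) (hg : Monotone g) :
    ∫⁻ ω, g (Z ω + C ω) ∂P ≤ ∫⁻ y, g (y + (D + ε)) ∂(ρ.conv μ) := by
  have hgm : Measurable g := hg.measurable
  calc ∫⁻ ω, g (Z ω + C ω) ∂P ≤ ∫⁻ ω, g (Z ω + C' ω + ε) ∂P := by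
        refine lintegral_mono_ae ?_
        filter_upwards [hle] with ω h
        exact hg (by linarith)
    _ = ∫⁻ p, g (p.2 + p.1 + ε) ∂(P.map fun ω => (C' ω, Z ω)) := by
        rw [lintegral_map' (by fun_prop) (hC'.prodMk hZ)]
    _ = ∫⁻ p, g (p.2 + p.1 + ε) ∂((P.map C').prod (P.map Z)) := by
        rw [(indepFun_iff_map_prod_eq_prod_map_map hC' hZ).mp hind]
    _ = ∫⁻ c, ∫⁻ ω, g (Z ω + c + ε) ∂P ∂μ := by
        rw [hlaw, lintegral_prod _ (by fun_prop)]
        refine lintegral_congr fun c => ?_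
        rw [lintegral_map' (by fun_prop) hZ]
    _ ≤ ∫⁻ c, ∫⁻ y, g (y + D + c + ε) ∂ρ ∂μ := by
        refine lintegral_mono fun c => ?_
        exact hdom (fun z => g (z + c + ε)) fun a b hab => hg (by linarith)
    _ = ∫⁻ y, g (y + (D + ε)) ∂(ρ.conv μ) := by
        rw [Measure.lintegral_conv (by fun_prop), lintegral_lintegral_swap (by fun_prop)]
        refine lintegral_congr fun y => lintegral_congr fun c => ?_
        congr 1; ring

/-- Sum of `f` over the block of `l` consecutive variables that starts after time `s`. -/
def blockSum {Ω 𝒳 : Type*} (X : ℕ → Ω → 𝒳) (f : 𝒳 → ℝ) (s l : ℕ) (ω : Ω) : ℝ :=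
  ∑ i ∈ Finset.range l, f (X (1 + s + i) ω)

lemma measurable_blockSum {Ω : Type*} [MeasurableSpace Ω] {𝒳 : Type*} [MeasurableSpace 𝒳]
    {X : ℕ → Ω → 𝒳} {f : 𝒳 → ℝ} (hXmeas : ∀ t, Measurable (X t)) (hf : Measurable f) (s l : ℕ) :
    Measurable (blockSum X f s l) := by
  unfold blockSum
  exact Finset.measurable_sum _ fun i _ => hf.comp (hXmeas _)

section blocks

variable {Ω : Type*} [MeasurableSpace Ω] {P : Measure Ω} [IsProbabilityMeasure P]
  {𝒳 : Type*} [MetricSpace 𝒳] [PolishSpace 𝒳] [MeasurableSpace 𝒳] [BorelSpace 𝒳]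
  {X : ℕ → Ω → 𝒳} {f : 𝒳 → ℝ}

lemma map_blockSum (hXmeas : ∀ t, Measurable (X t)) (hf : Measurable f)
    (hstat : ∀ m k : ℕ,
      Measure.map (fun ω => fun i : Fin m => X (1 + k + i) ω) P
        = Measure.map (fun ω => fun i : Fin m => X (1 + i) ω) P) (s l : ℕ) :
    P.map (blockSum X f s l) = P.map (blockSum X f 0 l) := by
  have key : ∀ s, P.map (blockSum X f s l)
      = (Measure.map (fun ω => fun i : Fin l => X (1 + s + i) ω) P).map
        (fun v => ∑ i, f (v i)) := by
    intro s
    have hG : Measurable (fun v : Fin l → 𝒳 => ∑ i, f (v i)) :=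
      Finset.measurable_sum _ fun i _ => hf.comp (measurable_pi_apply i)
    rw [Measure.map_map hG (measurable_pi_lambda _ fun i => hXmeas _)]
    congr 1
    ext ω
    simp [blockSum, Finset.sum_range]
  rw [key s, key 0, hstat l s]

/-- A block far from the past admits an independent copy close to it. -/
lemma exists_block_copy (hXmeas : ∀ t, Measurable (X t)) (hf_lip : LipschitzWith 1 f)
    (hstat : ∀ m k : ℕ,
      Measure.map (fun ω => fun i : Fin m => X (1 + k + i) ω) P
        = Measure.map (fun ω => fun i : Fin m => X (1 + i) ω) P)
    {n : ℕ} {δ' : ℕ → ℝ}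
    (hcl : ∀ r j : ℕ, 1 ≤ r → 1 ≤ j → 2 * r + j ≤ n + 1 →
      ∃ Xstar : Fin r → Ω → 𝒳,
        Measure.map (fun ω => fun i : Fin r => Xstar i ω) P
          = Measure.map (fun ω => fun i : Fin r => X (r + j + i) ω) P ∧
        Indep (MeasurableSpace.comap (fun ω => fun i : Fin r => Xstar i ω) inferInstance)
          (⨆ t ∈ Set.Icc 1 j, MeasurableSpace.comap (X t) inferInstance) P ∧
        (∀ᵐ ω ∂P, ∑ i : Fin r, dist (X (r + j + i) ω) (Xstar i ω) ≤ (r : ℝ) * δ' r))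
    {k l s : ℕ} (hk : 1 ≤ k) (hl : 1 ≤ l) (hlk : l ≤ k) (hs : 2 * k ≤ s) (hsn : s + l ≤ n)
    {Z : Ω → ℝ}
    (hZ : Measurable[⨆ t ∈ Set.Icc 1 (s + l + 1 - 2 * k),
      MeasurableSpace.comap (X t) inferInstance] Z) :
    ∃ C' : Ω → ℝ, AEMeasurable C' P ∧ P.map C' = P.map (blockSum X f 0 l) ∧
      IndepFun C' Z P ∧ ∀ᵐ ω ∂P, blockSum X f s l ω ≤ C' ω + k * δ' k := by
  have hf : Measurable f := hf_lip.continuous.measurable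
  obtain ⟨j, hj⟩ : ∃ j, j = s + l + 1 - 2 * k := ⟨_, rfl⟩
  rw [← hj] at hZ
  obtain ⟨Xs, hlaw, hind, hclose⟩ := hcl k j hk (by omega) (by omega)
  have hsl : s + l + 1 = 2 * k + j := by omega
  let G : (Fin k → 𝒳) → ℝ := fun v => ∑ i : Fin l, f (v ⟨k - l + i, by omega⟩)
  have hG : Measurable G :=
    Finset.measurable_sum _ fun i _ => hf.comp (measurable_pi_apply _)
  have hXv : Measurable (fun ω => fun i : Fin k => X (k + j + i) ω) :=
    measurable_pi_lambda _ fun i => hXmeas _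
  have hXs : AEMeasurable (fun ω => fun i : Fin k => Xs i ω) P := by
    apply AEMeasurable.of_map_ne_zero
    rw [hlaw]
    have := Measure.isProbabilityMeasure_map (μ := P) hXv.aemeasurable
    exact IsProbabilityMeasure.ne_zero _
  have hblk : ∀ ω, G (fun i : Fin k => X (k + j + i) ω) = blockSum X f s l ω := by
    intro ω
    simp only [G, blockSum, Finset.sum_range]
    refine Finset.sum_congr rfl fun i _ => ?_
    have : k + j + (k - l + i) = 1 + s + i := by omega
    simp [this]
  refine ⟨fun ω => G (fun i => Xs i ω), hG.comp_aemeasurable hXs, ?_, ?_, ?_⟩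
  · change P.map (G ∘ fun ω => fun i : Fin k => Xs i ω) = _
    rw [← map_blockSum hXmeas hf hstat s l,
      ← AEMeasurable.map_map_of_aemeasurable hG.aemeasurable hXs, hlaw,
      Measure.map_map hG hXv]
    congr 1
    ext ω
    exact hblk ω
  · rw [IndepFun_iff_Indep]
    refine indep_of_indep_of_le_left (indep_of_indep_of_le_right hind hZ.comap_le) ?_
    have : (fun ω => G (fun i => Xs i ω)) = G ∘ (fun ω => fun i : Fin k => Xs i ω) := rfl
    rw [this, ← MeasurableSpace.comap_comp]
    exact MeasurableSpace.comap_mono hG.comap_le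
  · filter_upwards [hclose] with ω hω
    rw [← hblk]
    have h1 : G (fun i : Fin k => X (k + j + i) ω) - G (fun i => Xs i ω)
        ≤ ∑ i : Fin l, dist (X (k + j + (k - l + i)) ω) (Xs ⟨k - l + i, by omega⟩ ω) := by
      simp only [G]
      rw [← Finset.sum_sub_distrib]
      refine Finset.sum_le_sum fun i _ => ?_
      have := hf_lip.dist_le_mul (X (k + j + (k - l + i)) ω) (Xs ⟨k - l + i, by omega⟩ ω)
      simp only [NNReal.coe_one, one_mul, Real.dist_eq] at this
      exact (le_abs_self _).trans this
    have h2 : ∑ i : Fin l, dist (X (k + j + (k - l + i)) ω) (Xs ⟨k - l + i, by omega⟩ ω)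
        ≤ ∑ i : Fin k, dist (X (k + j + i) ω) (Xs i ω) := by
      let e : Fin l ↪ Fin k := ⟨fun i => ⟨k - l + i, by omega⟩, fun a b h => by
        simp only [Fin.mk.injEq] at h; ext; omega⟩
      refine (Finset.sum_map Finset.univ e
        (fun i : Fin k => dist (X (k + j + i) ω) (Xs i ω))).symm.trans_le ?_
      exact Finset.sum_le_sum_of_subset_of_nonneg (Finset.subset_univ _)
        fun _ _ _ => dist_nonneg
    linarith

lemma measurable_sup_blockSum (hf : Measurable f) {s l j : ℕ} (h : s + l ≤ j) :
    Measurable[⨆ t ∈ Set.Icc 1 j, MeasurableSpace.comap (X t) inferInstance]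
      (blockSum X f s l) := by
  unfold blockSum
  refine Finset.measurable_sum _ fun i hi => hf.comp ?_
  rw [Finset.mem_range] at hi
  have : MeasurableSpace.comap (X (1 + s + i)) inferInstance
      ≤ ⨆ t ∈ Set.Icc 1 j, MeasurableSpace.comap (X t) (inferInstance : MeasurableSpace 𝒳) :=
    le_iSup₂_of_le (1 + s + i) (by constructor <;> omega) le_rfl
  exact Measurable.mono (comap_measurable _) this le_rfl

/-- Sums over separated blocks are dominated by sums of independent copies plus a drift. -/
lemma lintegral_chain_le (hXmeas : ∀ t, Measurable (X t)) (hf_lip : LipschitzWith 1 f)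
    (hstat : ∀ m k : ℕ,
      Measure.map (fun ω => fun i : Fin m => X (1 + k + i) ω) P
        = Measure.map (fun ω => fun i : Fin m => X (1 + i) ω) P)
    {n : ℕ} {δ' : ℕ → ℝ}
    (hcl : ∀ r j : ℕ, 1 ≤ r → 1 ≤ j → 2 * r + j ≤ n + 1 →
      ∃ Xstar : Fin r → Ω → 𝒳,
        Measure.map (fun ω => fun i : Fin r => Xstar i ω) P
          = Measure.map (fun ω => fun i : Fin r => X (r + j + i) ω) P ∧
        Indep (MeasurableSpace.comap (fun ω => fun i : Fin r => Xstar i ω) inferInstance)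
          (⨆ t ∈ Set.Icc 1 j, MeasurableSpace.comap (X t) inferInstance) P ∧
        (∀ᵐ ω ∂P, ∑ i : Fin r, dist (X (r + j + i) ω) (Xstar i ω) ≤ (r : ℝ) * δ' r))
    {k l : ℕ} (hk : 1 ≤ k) (hl : 1 ≤ l) (hlk : l ≤ k) {ε : ℝ} (hε : k * δ' k ≤ ε)
    (s : ℕ → ℕ) (m : ℕ) (hs : ∀ i j, i < j → j < m → s i + 2 * k ≤ s j)
    (hsn : ∀ i < m, s i + l ≤ n) (g : ℝ → ℝ≥0∞) (hg : Monotone g) :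
    ∫⁻ ω, g (∑ i ∈ Finset.range m, blockSum X f (s i) l ω) ∂P
      ≤ ∫⁻ y, g (y + ((m - 1 : ℕ) : ℝ) * ε) ∂convPow (P.map (blockSum X f 0 l)) m := by
  have hf : Measurable f := hf_lip.continuous.measurable
  have : IsProbabilityMeasure (P.map (blockSum X f 0 l)) :=
    Measure.isProbabilityMeasure_map (measurable_blockSum hXmeas hf 0 l).aemeasurable
  induction m generalizing g with
  | zero => simp [convPow]
  | succ m ih =>
    rcases Nat.eq_zero_or_pos m with rfl | hm
    · simp only [zero_add, Finset.range_one, Finset.sum_singleton, convPow,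
        Measure.dirac_zero_conv]
      rw [← map_blockSum hXmeas hf hstat (s 0) l,
        lintegral_map (by simpa using hg.measurable) (measurable_blockSum hXmeas hf _ l)]
      simp
    · simp_rw [Finset.sum_range_succ]
      have hgap : ∀ i < m, s i + l ≤ s m + l + 1 - 2 * k := fun i hi => by
        have := hs i m hi (by omega); omega
      obtain ⟨C', h1, h2, h3, h4⟩ := exists_block_copy (s := s m) hXmeas hf_lip hstat hcl hk hl
        hlk (by have := hs 0 m hm (by omega); omega) (hsn m (by omega))
        (Z := fun ω => ∑ i ∈ Finset.range m, blockSum X f (s i) l ω)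
        (Finset.measurable_sum _ fun i hi =>
          measurable_sup_blockSum hf (hgap i (Finset.mem_range.mp hi)))
      have hZ : Measurable fun ω => ∑ i ∈ Finset.range m, blockSum X f (s i) l ω :=
        Finset.measurable_sum _ fun i _ => measurable_blockSum hXmeas hf _ l
      refine (lintegral_add_le_conv (ε := ε) hZ.aemeasurable h1
        (fun g hg => ih (fun i j hij hj => hs i j hij (by omega))
          (fun i hi => hsn i (by omega)) g hg) h2 h3 ?_ g hg).trans_eq ?_
      · filter_upwards [h4] with ω h; linarith
      · simp only [convPow]
        refine lintegral_congr fun y => ?_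
        have : ((m + 1 - 1 : ℕ) : ℝ) = ((m - 1 : ℕ) : ℝ) + 1 := by
          rw [← Nat.cast_succ]; congr 1; omega
        rw [this]; congr 1; ring

end blocks

/-- `Z` is stochastically dominated by the law `ρ` shifted by `D`. -/
def IsDominated {Ω : Type*} [MeasurableSpace Ω] (P : Measure Ω) (Z : Ω → ℝ) (ρ : Measure ℝ)
    (D : ℝ) : Prop :=
  ∀ g : ℝ → ℝ≥0∞, Monotone g → ∫⁻ ω, g (Z ω) ∂P ≤ ∫⁻ y, g (y + D) ∂ρ

/-- Sums over separated blocks of length at most `k` are dominated by sums of independent copies,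
up to a drift `ε` per block after the first one. -/
def HasBlockDomination {Ω 𝒳 : Type*} [MeasurableSpace Ω] (P : Measure Ω) (X : ℕ → Ω → 𝒳)
    (f : 𝒳 → ℝ) (n k : ℕ) (ε : ℝ) : Prop :=
  ∀ l, 1 ≤ l → l ≤ k → ∀ (s : ℕ → ℕ) (m : ℕ),
    (∀ i j, i < j → j < m → s i + 2 * k ≤ s j) → (∀ i < m, s i + l ≤ n) →
    IsDominated P (fun ω => ∑ i ∈ Finset.range m, blockSum X f (s i) l ω)
      (convPow (P.map (blockSum X f 0 l)) m) (((m - 1 : ℕ) : ℝ) * ε)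

lemma lintegral_convex_sum_le {Ω ι : Type*} [MeasurableSpace Ω] [Fintype ι] {P : Measure Ω}
    {α w d : ι → ℝ} {Z : ι → Ω → ℝ} {ρ : ι → Measure ℝ} {D : ℝ} {φ : ℝ → ℝ}
    (hα : ∀ i, 0 < α i) (hα1 : ∑ i, α i = 1) (hw : ∀ i, 0 ≤ w i) (hZ : ∀ i, Measurable (Z i))
    (hdom : ∀ i, IsDominated P (Z i) (ρ i) (d i)) (hD : ∑ i, w i * d i ≤ D)
    (hconv : ConvexOn ℝ Set.univ φ) (hmono : Monotone φ) (hφ : ∀ y, 0 ≤ φ y) :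
    ∫⁻ ω, ENNReal.ofReal (φ (∑ i, w i * Z i ω - D)) ∂P
      ≤ ∑ i, ENNReal.ofReal (α i) * ∫⁻ y, ENNReal.ofReal (φ (w i / α i * y)) ∂ρ i := by
  have hm : Measurable φ := hmono.measurable
  have hpt : ∀ ω, ENNReal.ofReal (φ (∑ i, w i * Z i ω - D))
      ≤ ∑ i, ENNReal.ofReal (α i) * ENNReal.ofReal (φ (w i / α i * (Z i ω - d i))) := by
    intro ω
    have h1 : ∑ i, w i * Z i ω - D ≤ ∑ i, α i • (w i / α i * (Z i ω - d i)) := by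
      have : ∀ i, α i • (w i / α i * (Z i ω - d i)) = w i * Z i ω - w i * d i := by
        intro i
        have := (hα i).ne'
        simp only [smul_eq_mul]
        field_simp
      simp_rw [this, Finset.sum_sub_distrib]
      linarith
    have h2 := (hmono h1).trans (hconv.map_sum_le (t := Finset.univ) (w := α)
      (p := fun i => w i / α i * (Z i ω - d i)) (fun i _ => (hα i).le) hα1
      (fun i _ => Set.mem_univ _))
    refine (ENNReal.ofReal_le_ofReal h2).trans_eq ?_
    simp only [smul_eq_mul]
    rw [ENNReal.ofReal_sum_of_nonneg fun i _ => mul_nonneg (hα i).le (hφ _)]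
    exact Finset.sum_congr rfl fun i _ => ENNReal.ofReal_mul (hα i).le
  refine (lintegral_mono hpt).trans ?_
  rw [lintegral_finsetSum _ fun i _ => by have := hZ i; fun_prop]
  refine Finset.sum_le_sum fun i _ => ?_
  rw [lintegral_const_mul _ (by have := hZ i; fun_prop)]
  refine mul_le_mul_right ?_ _
  refine (hdom i (fun z => ENNReal.ofReal (φ (w i / α i * (z - d i)))) fun a b hab =>
    ENNReal.ofReal_le_ofReal (hmono ?_)).trans_eq ?_
  · have := div_nonneg (hw i) (hα i).le
    gcongr
  · simp

lemma measureReal_mul_le_of_lintegral_le {Ω : Type*} [MeasurableSpace Ω] {P : Measure Ω}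
    [IsProbabilityMeasure P] {S : Ω → ℝ} {φ : ℝ → ℝ} (hS : Measurable S)
    (hmono : Monotone φ) (hφ : ∀ y, 0 ≤ φ y) {D B : ℝ} (hB : 0 ≤ B)
    (h : ∫⁻ ω, ENNReal.ofReal (φ (S ω - D)) ∂P ≤ ENNReal.ofReal B) (a : ℝ) :
    P.real {ω | a ≤ S ω} * φ (a - D) ≤ B := by
  have hset : MeasurableSet {ω | a ≤ S ω} := measurableSet_le measurable_const hS
  have h1 : ENNReal.ofReal (φ (a - D)) * P {ω | a ≤ S ω} ≤ ENNReal.ofReal B := by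
    refine le_trans ?_ h
    rw [← setLIntegral_const]
    refine le_trans (setLIntegral_mono' hset fun ω hω => ?_) (setLIntegral_le_lintegral _ _)
    exact ENNReal.ofReal_le_ofReal (hmono (by simpa using hω))
  have h2 := ENNReal.toReal_mono ENNReal.ofReal_ne_top h1
  rw [ENNReal.toReal_mul, ENNReal.toReal_ofReal (hφ _), ENNReal.toReal_ofReal hB] at h2
  rw [mul_comm]
  exact h2

lemma sum_range_eq_even_add_odd (h : ℕ → ℝ) (q : ℕ) :
    ∑ b ∈ Finset.range q, h b = ∑ i ∈ Finset.range ((q + 1) / 2), h (2 * i)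
      + ∑ i ∈ Finset.range (q / 2), h (2 * i + 1) := by
  induction q with
  | zero => simp
  | succ q ih =>
    rw [Finset.sum_range_succ, ih]
    rcases Nat.even_or_odd' q with ⟨c, rfl | rfl⟩
    · have h1 : (2 * c + 1) / 2 = c := by omega
      have h2 : (2 * c + 1 + 1) / 2 = c + 1 := by omega
      have h3 : 2 * c / 2 = c := by omega
      rw [h1, h2, h3, Finset.sum_range_succ]
      ring
    · have h1 : (2 * c + 1) / 2 = c := by omega
      have h2 : (2 * c + 1 + 1) / 2 = c + 1 := by omega
      have h3 : (2 * c + 1 + 1 + 1) / 2 = c + 1 := by omega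
      rw [h1, h2, h3, Finset.sum_range_succ (fun i => h (2 * i + 1))]
      ring

/-- Start of the `b`-th long block when the short block of length `r` is inserted after `s` long
blocks of length `k`. -/
def blockStart (k r s b : ℕ) : ℕ := if b < s then b * k else b * k + r

section decomposition

variable {Ω 𝒳 : Type*} {X : ℕ → Ω → 𝒳} {f : 𝒳 → ℝ}

lemma blockSum_add (s a b : ℕ) (ω : Ω) :
    blockSum X f s (a + b) ω = blockSum X f s a ω + blockSum X f (s + a) b ω := by
  simp only [blockSum, Finset.sum_range_add]
  congr 1
  exact Finset.sum_congr rfl fun i _ => by rw [show 1 + s + (a + i) = 1 + (s + a) + i by ring]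

lemma sum_blockSum_add_blockSum (k r s q : ℕ) (hs : s ≤ q) (ω : Ω) :
    ∑ b ∈ Finset.range q, blockSum X f (blockStart k r s b) k ω + blockSum X f (s * k) r ω
      = blockSum X f 0 (q * k + r) ω := by
  have h1 : ∀ c ≤ s, ∑ b ∈ Finset.range c, blockSum X f (blockStart k r s b) k ω
      = blockSum X f 0 (c * k) ω := by
    intro c
    induction c with
    | zero => simp [blockSum]
    | succ c ih =>
      intro hc
      rw [Finset.sum_range_succ, ih (by omega), blockStart, if_pos (by omega), Nat.succ_mul,
        blockSum_add, zero_add]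
  induction q, hs using Nat.le_induction with
  | base => rw [h1 s le_rfl, blockSum_add, zero_add]
  | succ q hq ih =>
    rw [Finset.sum_range_succ, add_right_comm, ih, blockStart, if_neg (by omega),
      show (q + 1) * k + r = (q * k + r) + k by ring, blockSum_add 0 (q * k + r), zero_add]

lemma blockStart_add_le {k r s b b' : ℕ} (h : b + 2 ≤ b') :
    blockStart k r s b + 2 * k ≤ blockStart k r s b' := by
  have h1 : b * k + 2 * k ≤ b' * k := by rw [← add_mul]; exact Nat.mul_le_mul_right _ h
  unfold blockStart
  split_ifs <;> omega

lemma blockStart_add_le_total {k r s b q : ℕ} (h : b < q) :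
    blockStart k r s b + k ≤ q * k + r := by
  have h1 : b * k + k ≤ q * k := by rw [← Nat.succ_mul]; exact Nat.mul_le_mul_right _ h
  unfold blockStart
  split_ifs <;> omega

end decomposition

lemma sum_range_blockSum_even_odd {Ω 𝒳 : Type*} {X : ℕ → Ω → 𝒳} {f : 𝒳 → ℝ}
    (k r q : ℕ) (ω : Ω) :
    ((q : ℝ) + 1) * blockSum X f 0 (q * k + r) ω
      = ∑ s : Fin (q + 1),
          (∑ i ∈ Finset.range ((q + 1) / 2), blockSum X f (blockStart k r s (2 * i)) k ω
          + ∑ i ∈ Finset.range (q / 2), blockSum X f (blockStart k r s (2 * i + 1)) k ω)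
        + (∑ i ∈ Finset.range (q / 2 + 1), blockSum X f (2 * i * k) r ω
          + ∑ i ∈ Finset.range ((q + 1) / 2), blockSum X f ((2 * i + 1) * k) r ω) := by
  have h1 : ∀ s : Fin (q + 1), blockSum X f 0 (q * k + r) ω
      = (∑ i ∈ Finset.range ((q + 1) / 2), blockSum X f (blockStart k r s (2 * i)) k ω
          + ∑ i ∈ Finset.range (q / 2), blockSum X f (blockStart k r s (2 * i + 1)) k ω)
        + blockSum X f (s * k) r ω := by
    intro s
    rw [← sum_blockSum_add_blockSum k r s q (by omega) ω,
      sum_range_eq_even_add_odd (fun b => blockSum X f (blockStart k r s b) k ω)]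
  have h2 : ∑ s : Fin (q + 1), blockSum X f (s * k) r ω
      = ∑ i ∈ Finset.range (q / 2 + 1), blockSum X f (2 * i * k) r ω
          + ∑ i ∈ Finset.range ((q + 1) / 2), blockSum X f ((2 * i + 1) * k) r ω := by
    rw [Fin.sum_univ_eq_sum_range (fun s => blockSum X f (s * k) r ω) (q + 1),
      sum_range_eq_even_add_odd (fun s => blockSum X f (s * k) r ω),
      show (q + 1 + 1) / 2 = q / 2 + 1 by omega]
  rw [← h2, ← Finset.sum_add_distrib]
  rw [← Finset.sum_congr rfl fun s _ => h1 s]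
  simp

lemma deviation_master {Ω : Type*} [MeasurableSpace Ω] {P : Measure Ω}
    [IsProbabilityMeasure P] {𝒳 : Type*} [MeasurableSpace 𝒳] {X : ℕ → Ω → 𝒳} {f : 𝒳 → ℝ}
    (hXmeas : ∀ t, Measurable (X t)) (hf : Measurable f) {k q r : ℕ} {ε : ℝ}
    (hk : 1 ≤ k) (hr : 1 ≤ r) (hrk : r ≤ k) (hε : 0 ≤ ε)
    (hdom : HasBlockDomination P X f (q * k + r) k ε) {η : ℝ} (hη0 : 0 < η) (hη1 : η < 1)
    {φ : ℝ → ℝ} (hconv : ConvexOn ℝ Set.univ φ) (hmono : Monotone φ) (hφ : ∀ y, 0 ≤ φ y)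
    {BT BB : ℕ → ℝ} (hBT0 : ∀ m, 0 ≤ BT m) (hBB0 : ∀ m, 0 ≤ BB m)
    (hBT : ∀ m, ∫⁻ y, ENNReal.ofReal (φ (2 / (1 - η) * y))
      ∂convPow (P.map (blockSum X f 0 k)) m ≤ ENNReal.ofReal (BT m))
    (hBB : ∀ m, ∫⁻ y, ENNReal.ofReal (φ (2 / ((q + 1) * η) * y))
      ∂convPow (P.map (blockSum X f 0 r)) m ≤ ENNReal.ofReal (BB m)) (a : ℝ) :
    P.real {ω | a ≤ blockSum X f 0 (q * k + r) ω} * φ (a - ((q - 1 : ℕ) : ℝ) * ε)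
      ≤ (1 - η) / 2 * (BT ((q + 1) / 2) + BT (q / 2))
        + η / 2 * (BB (q / 2 + 1) + BB ((q + 1) / 2)) := by
  have hN : (0 : ℝ) < q + 1 := by positivity
  have h1η : 0 < 1 - η := by linarith
  let par : Bool → ℕ := fun b => cond b 1 0
  let cT : Bool → ℕ := fun b => cond b (q / 2) ((q + 1) / 2)
  let cB : Bool → ℕ := fun b => cond b ((q + 1) / 2) (q / 2 + 1)
  let Z : (Fin (q + 1) × Bool) ⊕ Bool → Ω → ℝ := Sum.elim
    (fun p ω => ∑ i ∈ Finset.range (cT p.2),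
      blockSum X f (blockStart k r p.1 (2 * i + par p.2)) k ω)
    (fun b ω => ∑ i ∈ Finset.range (cB b), blockSum X f ((2 * i + par b) * k) r ω)
  let ρ : (Fin (q + 1) × Bool) ⊕ Bool → Measure ℝ := Sum.elim
    (fun p => convPow (P.map (blockSum X f 0 k)) (cT p.2))
    (fun b => convPow (P.map (blockSum X f 0 r)) (cB b))
  let d : (Fin (q + 1) × Bool) ⊕ Bool → ℝ := Sum.elim
    (fun p => ((cT p.2 - 1 : ℕ) : ℝ) * ε) (fun b => ((cB b - 1 : ℕ) : ℝ) * ε)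
  let α : (Fin (q + 1) × Bool) ⊕ Bool → ℝ := Sum.elim
    (fun _ => (1 - η) / (2 * (q + 1))) (fun _ => η / 2)
  have hmeas : ∀ s l, Measurable (blockSum X f s l) := measurable_blockSum hXmeas hf
  have hS : ∀ ω, blockSum X f 0 (q * k + r) ω = ∑ j, (1 / ((q : ℝ) + 1)) * Z j ω := by
    intro ω
    rw [← Finset.mul_sum, eq_comm, one_div, inv_mul_eq_iff_eq_mul₀ hN.ne',
      sum_range_blockSum_even_odd k r q ω, Fintype.sum_sum_type, Fintype.sum_prod_type]
    simp [Z, cT, cB, par, add_comm]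
  have hsub := fun ω => congrArg (fun z => ENNReal.ofReal (φ (z - ((q - 1 : ℕ) : ℝ) * ε))) (hS ω)
  have hmain : ∫⁻ ω, ENNReal.ofReal
        (φ (∑ j, (1 / ((q : ℝ) + 1)) * Z j ω - ((q - 1 : ℕ) : ℝ) * ε)) ∂P
      ≤ ∑ j, ENNReal.ofReal (α j)
        * ∫⁻ y, ENNReal.ofReal (φ ((1 / ((q : ℝ) + 1)) / α j * y)) ∂ρ j := by
    refine lintegral_convex_sum_le (d := d) ?_ ?_ (fun _ => by positivity) ?_ ?_ ?_
      hconv hmono hφ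
    · rintro (p | b) <;> simp only [α, Sum.elim_inl, Sum.elim_inr] <;> positivity
    · simp only [α, Fintype.sum_sum_type, Sum.elim_inl, Sum.elim_inr, Finset.sum_const,
        Finset.card_univ, Fintype.card_prod, Fintype.card_fin, Fintype.card_bool, nsmul_eq_mul]
      push_cast
      field_simp
      ring
    · rintro (p | b) <;> simp only [Z, Sum.elim_inl, Sum.elim_inr] <;>
        exact Finset.measurable_sum _ fun i _ => hmeas _ _
    · rintro (⟨s, b⟩ | b)
      · refine hdom k hk le_rfl (fun i => blockStart k r s (2 * i + par b)) (cT b)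
          (fun i j hij _ => blockStart_add_le (by omega)) fun i hi => blockStart_add_le_total ?_
        cases b <;> simp only [cT, par, cond_true, cond_false] at hi ⊢ <;> omega
      · refine hdom r hr hrk (fun i => (2 * i + par b) * k) (cB b) (fun i j hij _ => ?_)
          fun i hi => ?_
        · rw [← add_mul]
          exact Nat.mul_le_mul_right _ (by omega)
        · have : 2 * i + par b ≤ q := by
            cases b <;> simp only [cB, par, cond_true, cond_false] at hi ⊢ <;> omega
          have := Nat.mul_le_mul_right k this
          change (2 * i + par b) * k + r ≤ _
          omega
    · simp only [d, Fintype.sum_sum_type, Fintype.sum_prod_type, Sum.elim_inl, Sum.elim_inr,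
        Fintype.sum_bool, Finset.sum_const, Finset.card_univ, Fintype.card_fin, nsmul_eq_mul,
        cT, cB, cond_true, cond_false]
      rcases Nat.lt_or_ge q 2 with hq | hq
      · interval_cases q <;> simp
      · obtain ⟨p, rfl⟩ : ∃ p, q = p + 2 := ⟨q - 2, by omega⟩
        have e1 : (((p + 2) / 2 - 1 : ℕ) : ℝ) + (((p + 2 + 1) / 2 - 1 : ℕ) : ℝ) = p := by
          rw [← Nat.cast_add]; congr 1; omega
        have e2 : (((p + 2 + 1) / 2 - 1 : ℕ) : ℝ) + (((p + 2) / 2 + 1 - 1 : ℕ) : ℝ)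
            = p + 1 := by
          rw [← Nat.cast_add, ← Nat.cast_succ]; congr 1; omega
        have e3 : ((p + 2 - 1 : ℕ) : ℝ) = p + 1 := by
          rw [← Nat.cast_succ]; congr 1
        have hp : (0 : ℝ) ≤ p := by positivity
        rw [e3]
        generalize (p + 2) / 2 - 1 = A₁ at *
        generalize (p + 2 + 1) / 2 - 1 = A₂ at *
        generalize (p + 2) / 2 + 1 - 1 = A₃ at *
        push_cast
        have hp3 : (0 : ℝ) < p + 2 + 1 := by positivity
        have hle : (1 / ((p : ℝ) + 2 + 1)) * (p + 1) ≤ 1 := by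
          rw [one_div, inv_mul_le_iff₀ hp3]; linarith
        calc _ = (((p : ℝ) + 2 + 1) * (1 / ((p : ℝ) + 2 + 1)) * ((A₁ : ℝ) + A₂)
                + (1 / ((p : ℝ) + 2 + 1)) * ((A₂ : ℝ) + A₃)) * ε := by ring
          _ = (p + (1 / ((p : ℝ) + 2 + 1)) * (p + 1)) * ε := by
              rw [e1, e2, mul_one_div_cancel hp3.ne', one_mul]
          _ ≤ ((p : ℝ) + 1) * ε := by gcongr
  rw [← lintegral_congr hsub] at hmain
  refine measureReal_mul_le_of_lintegral_le (hmeas _ _) hmono hφ ?_ (hmain.trans ?_) a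
  · have := hBT0 ((q + 1) / 2); have := hBT0 (q / 2); have := hBB0 (q / 2 + 1)
    have := hBB0 ((q + 1) / 2)
    positivity
  · have hT : ∀ b, ∫⁻ y, ENNReal.ofReal (φ ((1 / ((q : ℝ) + 1)) / ((1 - η) / (2 * (q + 1))) * y))
        ∂convPow (P.map (blockSum X f 0 k)) (cT b) ≤ ENNReal.ofReal (BT (cT b)) := fun b => by
      convert hBT (cT b) using 5
      field_simp
    have hB : ∀ b, ∫⁻ y, ENNReal.ofReal (φ ((1 / ((q : ℝ) + 1)) / (η / 2) * y))
        ∂convPow (P.map (blockSum X f 0 r)) (cB b) ≤ ENNReal.ofReal (BB (cB b)) := fun b => by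
      convert hBB (cB b) using 5
      field_simp
    calc _ ≤ ∑ j, ENNReal.ofReal (α j) * ENNReal.ofReal
            (Sum.elim (fun p : Fin (q + 1) × Bool => BT (cT p.2)) (fun b => BB (cB b)) j) := by
          refine Finset.sum_le_sum fun j _ => ?_
          rcases j with ⟨s, b⟩ | b
          · exact mul_le_mul_right (hT b) _
          · exact mul_le_mul_right (hB b) _
      _ = ENNReal.ofReal (∑ j, α j *
            Sum.elim (fun p : Fin (q + 1) × Bool => BT (cT p.2)) (fun b => BB (cB b)) j) := by
          rw [ENNReal.ofReal_sum_of_nonneg]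
          · refine Finset.sum_congr rfl fun j _ => (ENNReal.ofReal_mul ?_).symm
            rcases j with p | b <;> simp only [α, Sum.elim_inl, Sum.elim_inr] <;> positivity
          · rintro (p | b) _ <;> simp only [α, Sum.elim_inl, Sum.elim_inr]
            · exact mul_nonneg (by positivity) (hBT0 _)
            · exact mul_nonneg (by positivity) (hBB0 _)
      _ = _ := by
          congr 1
          simp only [α, Fintype.sum_sum_type, Fintype.sum_prod_type, Sum.elim_inl, Sum.elim_inr,
            Fintype.sum_bool, Finset.sum_const, Finset.card_univ, Fintype.card_fin,
            nsmul_eq_mul, cT, cB, cond_true, cond_false]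
          push_cast
          field_simp
          ring

lemma exp_sub_one_sub_le {z c : ℝ} (hc : 0 < c) (hz : |z| ≤ c) :
    exp z - 1 - z ≤ z ^ 2 / c ^ 2 * (exp c - 1 - c) := by
  have hs : ∀ w : ℝ, HasSum (fun j : ℕ => w ^ (j + 2) / (j + 2).factorial) (exp w - 1 - w) := by
    intro w
    have h := (hasSum_nat_add_iff' 2).mpr (NormedSpace.expSeries_div_hasSum_exp w)
    rw [← Real.exp_eq_exp_ℝ] at h
    simpa [Finset.sum_range_succ, sub_sub] using h
  refine hasSum_le (fun j => ?_) (hs z) ((hs c).mul_left (z ^ 2 / c ^ 2))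
  rw [← mul_div_assoc]
  gcongr
  calc z ^ (j + 2) = z ^ 2 * z ^ j := by ring
    _ ≤ z ^ 2 * c ^ j := by
      refine mul_le_mul_of_nonneg_left ?_ (sq_nonneg z)
      exact (le_abs_self _).trans (by rw [abs_pow]; gcongr)
    _ = z ^ 2 / c ^ 2 * c ^ (j + 2) := by field_simp; ring

lemma integral_exp_le_bennett {μ : Measure ℝ} [IsProbabilityMeasure μ] {b t : ℝ} (hb0 : 0 < b)
    (ht : 0 < t) (hb : ∀ᵐ y ∂μ, |y| ≤ b) (h0 : ∫ y, y ∂μ = 0) :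
    ∫ y, exp (t * y) ∂μ ≤ exp ((∫ y, y ^ 2 ∂μ) / b ^ 2 * (exp (t * b) - 1 - t * b)) := by
  have h1 : Integrable (fun y : ℝ => y) μ := integrable_of_ae_abs_le hb continuous_id
  have h2 : Integrable (fun y : ℝ => y ^ 2) μ := integrable_of_ae_abs_le hb (by fun_prop)
  have h3 : Integrable (fun y : ℝ => exp (t * y)) μ := integrable_of_ae_abs_le hb (by fun_prop)
  set K := exp (t * b) - 1 - t * b
  calc ∫ y, exp (t * y) ∂μ ≤ ∫ y, ((1 + t * y) + K / b ^ 2 * y ^ 2) ∂μ := by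
        refine integral_mono_ae h3 (((integrable_const _).add (h1.const_mul _)).add
          (h2.const_mul _)) ?_
        filter_upwards [hb] with y hy
        have := exp_sub_one_sub_le (z := t * y) (c := t * b) (by positivity)
          (by rw [abs_mul, abs_of_pos ht]; gcongr)
        have e : (t * y) ^ 2 / (t * b) ^ 2 * K = K / b ^ 2 * y ^ 2 := by field_simp
        change _ ≤ (t * y) ^ 2 / (t * b) ^ 2 * K at this
        rw [e] at this
        linarith
    _ = 1 + K / b ^ 2 * ∫ y, y ^ 2 ∂μ := by
        have h4 : Integrable (fun y : ℝ => 1 + t * y) μ := (integrable_const _).add (h1.const_mul _)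
        rw [integral_add h4 (h2.const_mul _), integral_add (integrable_const _) (h1.const_mul _),
          integral_const_mul, integral_const_mul, h0]
        simp
    _ ≤ _ := by
        have := add_one_le_exp ((∫ y, y ^ 2 ∂μ) / b ^ 2 * K)
        refine le_trans (le_of_eq ?_) this
        ring

lemma integral_exp_le_hoeffding {μ : Measure ℝ} [IsProbabilityMeasure μ] {b t : ℝ} (hb0 : 0 ≤ b)
    (hb : ∀ᵐ y ∂μ, |y| ≤ b) (h0 : ∫ y, y ∂μ = 0) :
    ∫ y, exp (t * y) ∂μ ≤ exp (b ^ 2 * t ^ 2 / 2) := by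
  have h := hasSubgaussianMGF_of_mem_Icc_of_integral_eq_zero (μ := μ) (X := id) (a := -b) (b := b)
    aemeasurable_id (by filter_upwards [hb] with y hy using abs_le.mp hy) (by simpa using h0)
  refine (h.mgf_le t).trans (le_of_eq ?_)
  congr 1
  push_cast
  rw [Real.norm_eq_abs, sub_neg_eq_add, abs_of_nonneg (by linarith)]
  ring

lemma integral_exp_convPow_le {μ : Measure ℝ} [IsProbabilityMeasure μ] {b t c : ℝ}
    (hb : ∀ᵐ y ∂μ, |y| ≤ b) (h : ∫ y, exp (t * y) ∂μ ≤ exp c) (m : ℕ) :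
    ∫ y, exp (t * y) ∂convPow μ m ≤ exp (m * c) := by
  rw [mgf_convPow hb, exp_nat_mul]
  exact pow_le_pow_left₀ (integral_nonneg fun y => (exp_pos _).le) h m

/-- The squared positive part of `y + h`. -/
noncomputable def posSq (h y : ℝ) : ℝ := (max (y + h) 0) ^ 2

/-- The second order remainder of the exponential at `max (t * y + 1 / 2) 0`. -/
noncomputable def expRem (t y : ℝ) : ℝ :=
  exp (max (t * y + 1 / 2) 0) - 1 - max (t * y + 1 / 2) 0

lemma convexOn_max_affine (t h : ℝ) : ConvexOn ℝ Set.univ (fun y : ℝ => max (t * y + h) 0) := by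
  refine ConvexOn.sup ⟨convex_univ, fun x _ y _ a b ha hb hab => le_of_eq ?_⟩
    (convexOn_const 0 convex_univ)
  simp only [smul_eq_mul]
  linear_combination (-h) * hab

lemma posSq_nonneg (h y : ℝ) : 0 ≤ posSq h y := sq_nonneg _

lemma posSq_le (h y : ℝ) : posSq h y ≤ (y + h) ^ 2 := by
  unfold posSq
  rcases le_total (y + h) 0 with hy | hy
  · rw [max_eq_right hy]; simpa using sq_nonneg (y + h)
  · rw [max_eq_left hy]

lemma monotone_posSq (h : ℝ) : Monotone (posSq h) := fun a b hab => by
  unfold posSq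
  gcongr

lemma convexOn_posSq (h : ℝ) : ConvexOn ℝ Set.univ (posSq h) := by
  have := (convexOn_max_affine 1 h).pow (fun y _ => le_max_right _ _) 2
  have e : posSq h = (fun y : ℝ => max (1 * y + h) 0) ^ 2 := by ext y; simp [posSq]
  rw [e]
  exact this

lemma monotoneOn_exp_sub : MonotoneOn (fun s : ℝ => exp s - 1 - s) (Set.Ici 0) := by
  intro a ha b hb hab
  have h1 : exp b = exp a * exp (b - a) := by rw [← exp_add]; ring_nf
  have h2 := add_one_le_exp (b - a)
  have h3 := one_le_exp (Set.mem_Ici.mp ha)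
  change exp a - 1 - a ≤ exp b - 1 - b
  nlinarith

lemma expRem_nonneg (t y : ℝ) : 0 ≤ expRem t y := by
  unfold expRem
  linarith [add_one_le_exp (max (t * y + 1 / 2) 0)]

lemma expRem_le (t y : ℝ) : expRem t y ≤ exp (t * y + 1 / 2) - 1 - (t * y + 1 / 2) := by
  unfold expRem
  rcases le_total (t * y + 1 / 2) 0 with hy | hy
  · rw [max_eq_right hy]; simp only [exp_zero]; linarith [add_one_le_exp (t * y + 1 / 2)]
  · rw [max_eq_left hy]

lemma monotone_expRem {t : ℝ} (ht : 0 ≤ t) : Monotone (expRem t) := fun a b hab => by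
  refine monotoneOn_exp_sub (Set.mem_Ici.mpr (le_max_right _ _))
    (Set.mem_Ici.mpr (le_max_right _ _)) ?_
  gcongr

lemma convexOn_expRem (t : ℝ) : ConvexOn ℝ Set.univ (expRem t) := by
  have hlin : ConvexOn ℝ Set.univ (fun s : ℝ => exp s - 1 - s) :=
    (convexOn_exp.sub (concaveOn_const (1 : ℝ) convex_univ)).sub (concaveOn_id convex_univ)
  refine ⟨convex_univ, fun x _ y _ a b ha hb hab => ?_⟩
  have h1 := (convexOn_max_affine t (1 / 2)).2 (Set.mem_univ x) (Set.mem_univ y) ha hb hab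
  refine (monotoneOn_exp_sub (Set.mem_Ici.mpr (le_max_right _ _)) ?_ h1).trans
    (hlin.2 (Set.mem_univ _) (Set.mem_univ _) ha hb hab)
  have := le_max_right (t * x + 1 / 2) 0
  have := le_max_right (t * y + 1 / 2) 0
  simp only [smul_eq_mul, Set.mem_Ici]
  positivity

lemma lintegral_posSq_convPow_le {μ : Measure ℝ} [IsProbabilityMeasure μ] {b : ℝ}
    (hb : ∀ᵐ y ∂μ, |y| ≤ b) (h0 : ∫ y, y ∂μ = 0) (c h : ℝ) (m : ℕ) :
    ∫⁻ y, ENNReal.ofReal (posSq h (c * y)) ∂convPow μ m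
      ≤ ENNReal.ofReal (c ^ 2 * (m * ∫ y, y ^ 2 ∂μ) + h ^ 2) := by
  have hbm := convPow_ae_abs_le hb m
  have h1 : Integrable (fun y : ℝ => y) (convPow μ m) := integrable_of_ae_abs_le hbm continuous_id
  have h2 : Integrable (fun y : ℝ => y ^ 2) (convPow μ m) :=
    integrable_of_ae_abs_le hbm (by fun_prop)
  have h3 : Integrable (fun y : ℝ => (c * y + h) ^ 2) (convPow μ m) :=
    integrable_of_ae_abs_le hbm (by fun_prop)
  calc _ ≤ ∫⁻ y, ENNReal.ofReal ((c * y + h) ^ 2) ∂convPow μ m :=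
        lintegral_mono fun y => ENNReal.ofReal_le_ofReal (posSq_le _ _)
    _ = ENNReal.ofReal (∫ y, (c * y + h) ^ 2 ∂convPow μ m) :=
        (ofReal_integral_eq_lintegral_ofReal h3 (ae_of_all _ fun y => sq_nonneg _)).symm
    _ = _ := by
        congr 1
        have e : ∀ y : ℝ, (c * y + h) ^ 2 = (c ^ 2 * y ^ 2 + 2 * c * h * y) + h ^ 2 := by
          intro y; ring
        have h4 : Integrable (fun y : ℝ => c ^ 2 * y ^ 2 + 2 * c * h * y) (convPow μ m) :=
          (h2.const_mul _).add (h1.const_mul _)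
        simp_rw [e]
        rw [integral_add h4 (integrable_const _),
          integral_add (h2.const_mul _) (h1.const_mul _), integral_const_mul, integral_const_mul,
          integral_sq_convPow hb h0, integral_id_convPow hb h0]
        simp

lemma lintegral_expRem_convPow_le {μ : Measure ℝ} [IsProbabilityMeasure μ] {b : ℝ}
    (hb : ∀ᵐ y ∂μ, |y| ≤ b) (h0 : ∫ y, y ∂μ = 0) {c t K : ℝ} (m : ℕ)
    (hK : ∫ y, exp (t * c * y) ∂convPow μ m ≤ exp K) :
    ∫⁻ y, ENNReal.ofReal (expRem t (c * y)) ∂convPow μ m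
      ≤ ENNReal.ofReal (exp (1 / 2 + K) - 3 / 2) := by
  have hbm := convPow_ae_abs_le hb m
  have h1 : Integrable (fun y : ℝ => y) (convPow μ m) := integrable_of_ae_abs_le hbm continuous_id
  have h2 : Integrable (fun y : ℝ => exp (t * c * y)) (convPow μ m) :=
    integrable_of_ae_abs_le hbm (by fun_prop)
  have h3 : Integrable (fun y : ℝ => exp (1 / 2) * exp (t * c * y) - 3 / 2 - t * c * y)
    (convPow μ m) := integrable_of_ae_abs_le hbm (by fun_prop)
  have e : ∀ y : ℝ, exp (t * (c * y) + 1 / 2) - 1 - (t * (c * y) + 1 / 2)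
      = exp (1 / 2) * exp (t * c * y) - 3 / 2 - t * c * y := by
    intro y
    rw [← exp_add, ← mul_assoc, add_comm]
    ring
  calc _ ≤ ∫⁻ y, ENNReal.ofReal (exp (1 / 2) * exp (t * c * y) - 3 / 2 - t * c * y)
          ∂convPow μ m := lintegral_mono fun y => ENNReal.ofReal_le_ofReal
            ((expRem_le _ _).trans_eq (e y))
    _ = ENNReal.ofReal (∫ y, (exp (1 / 2) * exp (t * c * y) - 3 / 2 - t * c * y)
          ∂convPow μ m) := by
        refine (ofReal_integral_eq_lintegral_ofReal h3 (ae_of_all _ fun y => ?_)).symm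
        refine le_trans ?_ (e y).le
        exact (expRem_nonneg t (c * y)).trans (expRem_le _ _)
    _ ≤ _ := by
        refine ENNReal.ofReal_le_ofReal ?_
        have h4 : Integrable (fun y : ℝ => exp (1 / 2) * exp (t * c * y) - 3 / 2)
          (convPow μ m) := (h2.const_mul _).sub (integrable_const _)
        rw [integral_sub h4 (h1.const_mul _), integral_sub (h2.const_mul _) (integrable_const _),
          integral_const_mul, integral_const_mul, integral_id_convPow hb h0, exp_add]
        simp
        gcongr

section laws

variable {Ω : Type*} [MeasurableSpace Ω] {P : Measure Ω} [IsProbabilityMeasure P]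
  {𝒳 : Type*} [MeasurableSpace 𝒳] {X : ℕ → Ω → 𝒳} {f : 𝒳 → ℝ}

lemma abs_blockSum_le (hf_bdd : ∀ y, |f y| ≤ 1 / 2) (s l : ℕ) (ω : Ω) :
    |blockSum X f s l ω| ≤ l / 2 := by
  unfold blockSum
  refine (Finset.abs_sum_le_sum_abs _ _).trans ?_
  refine (Finset.sum_le_sum fun i _ => hf_bdd _).trans (le_of_eq ?_)
  simp
  ring

lemma ae_map_blockSum_abs_le (hXmeas : ∀ t, Measurable (X t)) (hf : Measurable f)
    (hf_bdd : ∀ y, |f y| ≤ 1 / 2) (l : ℕ) :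
    ∀ᵐ y ∂(P.map (blockSum X f 0 l)), |y| ≤ (l : ℝ) / 2 := by
  rw [ae_map_iff (measurable_blockSum hXmeas hf 0 l).aemeasurable
    (measurableSet_le (by fun_prop) (by fun_prop))]
  exact ae_of_all _ fun ω => abs_blockSum_le hf_bdd 0 l ω

lemma integral_blockSum (hXmeas : ∀ t, Measurable (X t)) (hf : Measurable f)
    (hf_bdd : ∀ y, |f y| ≤ 1 / 2)
    (hstat : ∀ m k : ℕ,
      Measure.map (fun ω => fun i : Fin m => X (1 + k + i) ω) P
        = Measure.map (fun ω => fun i : Fin m => X (1 + i) ω) P)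
    (hf_mean : ∫ ω, f (X 1 ω) ∂P = 0) (s l : ℕ) : ∫ ω, blockSum X f s l ω ∂P = 0 := by
  unfold blockSum
  have hint : ∀ t, Integrable (fun ω => f (X t ω)) P := fun t =>
    Integrable.of_bound (hf.comp (hXmeas t)).aestronglyMeasurable (1 / 2)
      (ae_of_all _ fun ω => hf_bdd _)
  rw [integral_finsetSum _ fun i _ => hint _]
  refine Finset.sum_eq_zero fun i _ => ?_
  have key : ∀ j : ℕ, ∫ ω, f (X (1 + j) ω) ∂P
      = ∫ v, f (v 0) ∂(Measure.map (fun ω => fun i : Fin 1 => X (1 + j + i) ω) P) := by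
    intro j
    have hm : Measurable fun v : Fin 1 → 𝒳 => f (v 0) := hf.comp (measurable_pi_apply 0)
    rw [integral_map (measurable_pi_lambda _ fun i => hXmeas _).aemeasurable
      hm.aestronglyMeasurable]
    simp
  have h0 := key 0
  rw [add_assoc, key (s + i), hstat 1 (s + i)]
  rw [hstat 1 0] at h0
  rw [← h0]
  simpa using hf_mean

lemma integral_map_blockSum (hXmeas : ∀ t, Measurable (X t)) (hf : Measurable f)
    (hf_bdd : ∀ y, |f y| ≤ 1 / 2)
    (hstat : ∀ m k : ℕ,
      Measure.map (fun ω => fun i : Fin m => X (1 + k + i) ω) P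
        = Measure.map (fun ω => fun i : Fin m => X (1 + i) ω) P)
    (hf_mean : ∫ ω, f (X 1 ω) ∂P = 0) (l : ℕ) : ∫ y, y ∂(P.map (blockSum X f 0 l)) = 0 := by
  rw [integral_map (measurable_blockSum hXmeas hf 0 l).aemeasurable
    (by fun_prop : Measurable fun y : ℝ => y).aestronglyMeasurable]
  exact integral_blockSum hXmeas hf hf_bdd hstat hf_mean 0 l

lemma integral_sq_map_blockSum (hXmeas : ∀ t, Measurable (X t)) (hf : Measurable f)
    (hf_bdd : ∀ y, |f y| ≤ 1 / 2)
    (hstat : ∀ m k : ℕ,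
      Measure.map (fun ω => fun i : Fin m => X (1 + k + i) ω) P
        = Measure.map (fun ω => fun i : Fin m => X (1 + i) ω) P)
    (hf_mean : ∫ ω, f (X 1 ω) ∂P = 0) (l : ℕ) :
    ∫ y, y ^ 2 ∂(P.map (blockSum X f 0 l)) = variance (blockSum X f 0 l) P := by
  rw [integral_map (measurable_blockSum hXmeas hf 0 l).aemeasurable
    (by fun_prop : Measurable fun y : ℝ => y ^ 2).aestronglyMeasurable]
  rw [variance_of_integral_eq_zero (measurable_blockSum hXmeas hf 0 l).aemeasurable
    (integral_blockSum hXmeas hf hf_bdd hstat hf_mean 0 l)]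

lemma integral_sq_le_of_ae_abs_le {μ : Measure ℝ} [IsProbabilityMeasure μ] {b : ℝ}
    (hb : ∀ᵐ y ∂μ, |y| ≤ b) : ∫ y, y ^ 2 ∂μ ≤ b ^ 2 := by
  have h2 : Integrable (fun y : ℝ => y ^ 2) μ := integrable_of_ae_abs_le hb (by fun_prop)
  calc ∫ y, y ^ 2 ∂μ ≤ ∫ _, b ^ 2 ∂μ := by
        refine integral_mono_ae h2 (integrable_const _) ?_
        filter_upwards [hb] with y hy
        exact sq_le_sq.mpr (hy.trans (le_abs_self b))
    _ = b ^ 2 := by simp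

end laws

lemma le_sq_of_forall_div_add_div {A B c : ℝ} (hA : 0 ≤ A) (hB : 0 ≤ B)
    (h : ∀ η : ℝ, 0 < η → η < 1 → c ≤ A ^ 2 / (1 - η) + B ^ 2 / η) : c ≤ (A + B) ^ 2 := by
  have key : ∀ e : ℝ, 0 < e → c ≤ (A + B + 2 * e) ^ 2 := by
    intro e he
    have hs : 0 < A + B + 2 * e := by positivity
    have h1 := h ((B + e) / (A + B + 2 * e)) (by positivity) (by rw [div_lt_one hs]; linarith)
    have e1 : 1 - (B + e) / (A + B + 2 * e) = (A + e) / (A + B + 2 * e) := by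
      field_simp; ring
    rw [e1] at h1
    refine h1.trans ?_
    have e2 : A ^ 2 / ((A + e) / (A + B + 2 * e)) ≤ (A + e) * (A + B + 2 * e) := by
      rw [div_div_eq_mul_div, div_le_iff₀ (by positivity)]
      nlinarith [mul_nonneg hs.le (mul_nonneg hA he.le), mul_nonneg hs.le (mul_nonneg he.le he.le)]
    have e3 : B ^ 2 / ((B + e) / (A + B + 2 * e)) ≤ (B + e) * (A + B + 2 * e) := by
      rw [div_div_eq_mul_div, div_le_iff₀ (by positivity)]
      nlinarith [mul_nonneg hs.le (mul_nonneg hB he.le), mul_nonneg hs.le (mul_nonneg he.le he.le)]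
    nlinarith
  have hlim : Filter.Tendsto (fun e : ℝ => (A + B + 2 * e) ^ 2) (nhdsWithin 0 (Set.Ioi 0))
      (nhds ((A + B + 2 * 0) ^ 2)) :=
    (Continuous.tendsto (by fun_prop) 0).mono_left nhdsWithin_le_nhds
  have := ge_of_tendsto hlim (by filter_upwards [self_mem_nhdsWithin] with e he using key e he)
  simpa using this

lemma half_exp_add_half_exp_le (L d : ℝ) :
    exp (L + d) / 2 + exp (L - d) / 2 ≤ exp (L + d ^ 2 / 2) := by
  have := cosh_le_exp_half_sq d
  rw [cosh_eq] at this
  rw [exp_add, sub_eq_add_neg, exp_add L, exp_add L]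
  nlinarith [exp_pos L]

lemma parity_exp_average_le {q : ℕ} (hq : 1 ≤ q) (L : ℝ) {m m' : ℕ} (hm : m + m' = q)
    (hd : m ≤ m' + 1) (hd' : m' ≤ m + 1) :
    exp (1 / 2 + m * (2 * L / q)) / 2 + exp (1 / 2 + m' * (2 * L / q)) / 2
      ≤ exp (1 / 2 + (L + L ^ 2 / (2 * (q : ℝ) ^ 2))) := by
  have hq0 : (0 : ℝ) < q := by positivity
  have hqm : (q : ℝ) = m + m' := by rw [← hm]; push_cast; ring
  set d : ℝ := ((m : ℝ) - m') * L / q with hdef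
  have e1 : 1 / 2 + m * (2 * L / q) = (1 / 2 + L) + d := by
    rw [hdef]; field_simp; rw [hqm]; ring
  have e2 : 1 / 2 + m' * (2 * L / q) = (1 / 2 + L) - d := by
    rw [hdef]; field_simp; rw [hqm]; ring
  rw [e1, e2]
  refine (half_exp_add_half_exp_le _ _).trans (exp_le_exp.mpr ?_)
  have h1 : ((m : ℝ) - m') ^ 2 ≤ 1 := by
    rw [sq_le_one_iff_abs_le_one, abs_le]
    have : (m : ℝ) ≤ m' + 1 := by exact_mod_cast hd
    have : (m' : ℝ) ≤ m + 1 := by exact_mod_cast hd'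
    constructor <;> linarith
  have h2 : d ^ 2 / 2 ≤ L ^ 2 / (2 * (q : ℝ) ^ 2) := by
    rw [hdef, div_pow, mul_pow, div_div, mul_comm _ (2 : ℝ)]
    gcongr
    nlinarith [sq_nonneg L]
  linarith

lemma le_mul_of_forall_div_add_mul {A B c : ℝ} (hA : 0 ≤ A) (hB : 0 ≤ B)
    (h : ∀ l : ℝ, 0 < l → c ≤ A ^ 2 / (2 * l) + l * B ^ 2 / 2) : c ≤ A * B := by
  have key : ∀ e : ℝ, 0 < e → c ≤ A * (B + e) / 2 + (A + e) * B / 2 := by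
    intro e he
    have h1 := h ((A + e) / (B + e)) (by positivity)
    refine h1.trans (add_le_add ?_ ?_)
    · rw [div_le_div_iff₀ (by positivity) (by norm_num)]
      have : A * (B + e) * (2 * ((A + e) / (B + e))) = A * (2 * (A + e)) := by field_simp
      rw [this]
      nlinarith [mul_nonneg hA he.le]
    · have : (A + e) / (B + e) * B ^ 2 ≤ (A + e) * B := by
        rw [div_mul_eq_mul_div, div_le_iff₀ (by positivity)]
        nlinarith [mul_nonneg (mul_nonneg hA hB) he.le, mul_nonneg (mul_nonneg he.le hB) he.le]
      linarith
  have hlim : Filter.Tendsto (fun e : ℝ => A * (B + e) / 2 + (A + e) * B / 2)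
      (nhdsWithin 0 (Set.Ioi 0)) (nhds (A * (B + 0) / 2 + (A + 0) * B / 2)) :=
    (Continuous.tendsto (by fun_prop) 0).mono_left nhdsWithin_le_nhds
  have := ge_of_tendsto hlim (by filter_upwards [self_mem_nhdsWithin] with e he using key e he)
  linarith

section bounds

variable {Ω : Type*} [MeasurableSpace Ω] {P : Measure Ω} [IsProbabilityMeasure P]
  {𝒳 : Type*} [MeasurableSpace 𝒳] {X : ℕ → Ω → 𝒳} {f : 𝒳 → ℝ}

lemma setIntegral_blockSum_le (hXmeas : ∀ t, Measurable (X t)) (hf : Measurable f)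
    (hf_bdd : ∀ y, |f y| ≤ 1 / 2) {k q r : ℕ} {ε v : ℝ} (hk : 1 ≤ k) (hε : 0 ≤ ε)
    (hdom : HasBlockDomination P X f (q * k + r) k ε)
    (h0 : ∫ y, y ∂(P.map (blockSum X f 0 k)) = 0)
    (hv : ∫ y, y ^ 2 ∂(P.map (blockSum X f 0 k)) = v) (E : Set Ω) :
    ∫ ω in E, blockSum X f 0 (q * k + r) ω ∂P
      ≤ √(2 * q * v) * √(P.real E) + (r / 2 + ((q - 1 : ℕ) : ℝ) * ε) * P.real E := by
  have hm := measurable_blockSum hXmeas hf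
  have : IsProbabilityMeasure (P.map (blockSum X f 0 k)) :=
    Measure.isProbabilityMeasure_map (hm 0 k).aemeasurable
  have hb := ae_map_blockSum_abs_le (P := P) hXmeas hf hf_bdd k
  have hv0 : 0 ≤ v := hv ▸ integral_nonneg fun y => sq_nonneg y
  set D : ℝ := ((q - 1 : ℕ) : ℝ) * ε with hD
  let par : Bool → ℕ := fun b => cond b 1 0
  let c : Bool → ℕ := fun b => cond b (q / 2) ((q + 1) / 2)
  let Z : Bool → Ω → ℝ := fun b ω => ∑ i ∈ Finset.range (c b),
    blockSum X f (blockStart k r 0 (2 * i + par b)) k ω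
  have hZm : ∀ b, Measurable (Z b) := fun b => Finset.measurable_sum _ fun i _ => hm _ _
  have hS : ∀ ω, blockSum X f 0 (q * k + r) ω = ∑ b, 1 * Z b ω + blockSum X f 0 r ω := by
    intro ω
    rw [← sum_blockSum_add_blockSum k r 0 q (Nat.zero_le _) ω,
      sum_range_eq_even_add_odd (fun b => blockSum X f (blockStart k r 0 b) k ω)]
    simp [Z, c, par, add_comm]
  have hsq : ∫⁻ ω, ENNReal.ofReal (posSq 0 (∑ b, 1 * Z b ω - D)) ∂P
      ≤ ENNReal.ofReal (2 * q * v) := by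
    refine (lintegral_convex_sum_le (α := fun _ => 1 / 2) (w := fun _ => 1)
      (ρ := fun b => convPow (P.map (blockSum X f 0 k)) (c b))
      (d := fun b => ((c b - 1 : ℕ) : ℝ) * ε) (fun _ => by norm_num) (by simp)
      (fun _ => zero_le_one) hZm (fun b => ?_) ?_ (convexOn_posSq 0) (monotone_posSq 0)
      (posSq_nonneg 0)).trans ?_
    · refine hdom k hk le_rfl (fun i => blockStart k r 0 (2 * i + par b)) (c b)
        (fun i j hij _ => blockStart_add_le (by omega)) fun i hi => blockStart_add_le_total ?_
      cases b <;> simp only [c, par, cond_true, cond_false] at hi ⊢ <;> omega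
    · simp only [Fintype.sum_bool, one_mul, c, cond_true, cond_false]
      rw [← add_mul, hD, ← Nat.cast_add]
      gcongr
      omega
    · refine (Finset.sum_le_sum fun b _ => mul_le_mul_right
        (lintegral_posSq_convPow_le hb h0 _ 0 (c b)) _).trans ?_
      have hq : (q : ℝ) = (q / 2 : ℕ) + ((q + 1) / 2 : ℕ) := by
        rw [← Nat.cast_add]; congr 1; omega
      simp only [Fintype.sum_bool, hv]
      rw [← ENNReal.ofReal_mul (by norm_num), ← ENNReal.ofReal_mul (by norm_num),
        ← ENNReal.ofReal_add (by positivity) (by positivity)]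
      refine ENNReal.ofReal_le_ofReal (le_of_eq ?_)
      rw [hq]
      simp only [c, cond_true, cond_false]
      ring
  have hTm : Measurable fun ω => posSq 0 (∑ b, 1 * Z b ω - D) := by
    have h1 : Measurable fun ω => ∑ b, 1 * Z b ω :=
      Finset.measurable_sum _ fun b _ => (hZm b).const_mul 1
    exact (monotone_posSq 0).measurable.comp (h1.sub_const D)
  have hTint : Integrable (fun ω => posSq 0 (∑ b, 1 * Z b ω - D)) P := by
    refine ⟨hTm.aestronglyMeasurable, ?_⟩
    rw [hasFiniteIntegral_iff_ofReal (ae_of_all _ fun ω => posSq_nonneg _ _)]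
    exact hsq.trans_lt ENNReal.ofReal_lt_top
  have hTle : ∫ ω, posSq 0 (∑ b, 1 * Z b ω - D) ∂P ≤ 2 * q * v := by
    rw [integral_eq_lintegral_of_nonneg_ae (ae_of_all _ fun ω => posSq_nonneg _ _)
      hTm.aestronglyMeasurable]
    exact ENNReal.toReal_le_of_le_ofReal (by positivity) hsq
  have hSint : Integrable (blockSum X f 0 (q * k + r)) P :=
    Integrable.of_bound (hm _ _).aestronglyMeasurable _
      (ae_of_all _ fun ω => abs_blockSum_le hf_bdd _ _ ω)
  suffices h : ∫ ω in E, blockSum X f 0 (q * k + r) ω ∂P - (r / 2 + D) * P.real E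
      ≤ √(2 * q * v) * √(P.real E) by linarith
  refine le_mul_of_forall_div_add_mul (sqrt_nonneg _) (sqrt_nonneg _) fun l hl => ?_
  rw [sq_sqrt (by positivity), sq_sqrt measureReal_nonneg]
  have h1 : ∫ ω in E, blockSum X f 0 (q * k + r) ω ∂P
      ≤ ∫ ω in E, ((2 * l)⁻¹ * posSq 0 (∑ b, 1 * Z b ω - D) + (r / 2 + D + l / 2)) ∂P := by
    refine setIntegral_mono hSint.integrableOn
      ((hTint.const_mul _).add (integrable_const _)).integrableOn fun ω => ?_
    have h2 := (abs_le.mp (abs_blockSum_le (X := X) hf_bdd 0 r ω)).2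
    have h3 : ∑ b, 1 * Z b ω - D ≤ (2 * l)⁻¹ * posSq 0 (∑ b, 1 * Z b ω - D) + l / 2 := by
      set z := ∑ b, 1 * Z b ω - D
      have h4 : z ≤ max (z + 0) 0 := by simp
      have h5 : posSq 0 z = max (z + 0) 0 ^ 2 := rfl
      rw [h5]
      generalize max (z + 0) 0 = y at *
      have : (2 * l)⁻¹ * y ^ 2 + l / 2 - y = (y - l) ^ 2 / (2 * l) := by field_simp; ring
      have : 0 ≤ (y - l) ^ 2 / (2 * l) := by positivity
      linarith
    rw [hS ω]
    linarith
  have h2 : ∫ ω in E, ((2 * l)⁻¹ * posSq 0 (∑ b, 1 * Z b ω - D) + (r / 2 + D + l / 2)) ∂P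
      ≤ (2 * l)⁻¹ * (2 * q * v) + (r / 2 + D + l / 2) * P.real E := by
    rw [integral_add (hTint.const_mul _).integrableOn (integrable_const _),
      integral_const_mul, integral_const]
    simp only [smul_eq_mul, measureReal_restrict_apply_univ]
    rw [mul_comm (P.real E)]
    gcongr
    exact (setIntegral_le_integral hTint (ae_of_all _ fun ω => posSq_nonneg _ _)).trans hTle
  have h3 : (2 * l)⁻¹ * (2 * q * v) = 2 * q * v / (2 * l) := by ring
  linarith

end bounds

section bounds

variable {Ω : Type*} [MeasurableSpace Ω] {P : Measure Ω} [IsProbabilityMeasure P]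
  {𝒳 : Type*} [MeasurableSpace 𝒳] {X : ℕ → Ω → 𝒳} {f : 𝒳 → ℝ}

lemma measureReal_le_cantelli (hXmeas : ∀ t, Measurable (X t)) (hf : Measurable f)
    (hf_bdd : ∀ y, |f y| ≤ 1 / 2) {k q r : ℕ} {ε v a : ℝ} (hk : 1 ≤ k) (hr : 1 ≤ r)
    (hrk : r ≤ k) (hε : 0 ≤ ε) (hdom : HasBlockDomination P X f (q * k + r) k ε)
    (h0k : ∫ y, y ∂(P.map (blockSum X f 0 k)) = 0)
    (h0r : ∫ y, y ∂(P.map (blockSum X f 0 r)) = 0)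
    (hv : ∫ y, y ^ 2 ∂(P.map (blockSum X f 0 k)) = v)
    (ha : 0 < a - ((q - 1 : ℕ) : ℝ) * ε) :
    P.real {ω | a ≤ blockSum X f 0 (q * k + r) ω}
      ≤ (√(2 * q * v) + r / √(2 * (q + 1))) ^ 2
        / ((√(2 * q * v) + r / √(2 * (q + 1))) ^ 2 + (a - ((q - 1 : ℕ) : ℝ) * ε) ^ 2) := by
  have hm := measurable_blockSum hXmeas hf
  have : IsProbabilityMeasure (P.map (blockSum X f 0 k)) :=
    Measure.isProbabilityMeasure_map (hm 0 k).aemeasurable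
  have : IsProbabilityMeasure (P.map (blockSum X f 0 r)) :=
    Measure.isProbabilityMeasure_map (hm 0 r).aemeasurable
  have hbk := ae_map_blockSum_abs_le (P := P) hXmeas hf hf_bdd k
  have hbr := ae_map_blockSum_abs_le (P := P) hXmeas hf hf_bdd r
  have hvr := integral_sq_le_of_ae_abs_le hbr
  have hv0 : 0 ≤ v := hv ▸ integral_nonneg fun y => sq_nonneg y
  set c := a - ((q - 1 : ℕ) : ℝ) * ε with hc
  set p := P.real {ω | a ≤ blockSum X f 0 (q * k + r) ω}
  have hp : 0 ≤ p := measureReal_nonneg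
  have key : ∀ h : ℝ, 0 ≤ h → p * (c + h) ^ 2 - h ^ 2
      ≤ (√(2 * q * v) + r / √(2 * (q + 1))) ^ 2 := by
    intro h hh
    refine le_sq_of_forall_div_add_div (sqrt_nonneg _) (by positivity) fun η hη0 hη1 => ?_
    have h1η : 0 < 1 - η := by linarith
    have hN : (0 : ℝ) < q + 1 := by positivity
    have hmain := deviation_master hXmeas hf hk hr hrk hε hdom hη0 hη1 (convexOn_posSq h)
      (monotone_posSq h) (posSq_nonneg h)
      (BT := fun m => (2 / (1 - η)) ^ 2 * (m * v) + h ^ 2)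
      (BB := fun m => (2 / ((q + 1) * η)) ^ 2 * (m * ((r : ℝ) / 2) ^ 2) + h ^ 2)
      (fun m => by positivity) (fun m => by positivity)
      (fun m => hv ▸ lintegral_posSq_convPow_le hbk h0k _ h m)
      (fun m => (lintegral_posSq_convPow_le hbr h0r _ h m).trans
        (ENNReal.ofReal_le_ofReal (by gcongr))) a
    have e1 : posSq h c = (c + h) ^ 2 := by
      unfold posSq
      rw [max_eq_left (by linarith)]
    rw [← hc, e1] at hmain
    have hq : (q : ℝ) = (q / 2 : ℕ) + ((q + 1) / 2 : ℕ) := by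
      rw [← Nat.cast_add]; congr 1; omega
    have e2 : √(2 * q * v) ^ 2 = 2 * q * v := sq_sqrt (by positivity)
    have e3 : (r / √(2 * (q + 1)) : ℝ) ^ 2 = r ^ 2 / (2 * (q + 1)) := by
      rw [div_pow, sq_sqrt (by positivity)]
    rw [e2, e3]
    have e4 : (1 - η) / 2 * ((2 / (1 - η)) ^ 2 * (((q + 1) / 2 : ℕ) * v) + h ^ 2
        + ((2 / (1 - η)) ^ 2 * ((q / 2 : ℕ) * v) + h ^ 2))
        = 2 * q * v / (1 - η) + (1 - η) * h ^ 2 := by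
      have : 2 * (q : ℝ) * v = 2 * ((q / 2 : ℕ) + ((q + 1) / 2 : ℕ)) * v := by rw [← hq]
      rw [this]
      field_simp
      ring
    have e5 : η / 2 * ((2 / ((q + 1) * η)) ^ 2 * ((q / 2 + 1 : ℕ) * ((r : ℝ) / 2) ^ 2) + h ^ 2
        + ((2 / ((q + 1) * η)) ^ 2 * (((q + 1) / 2 : ℕ) * ((r : ℝ) / 2) ^ 2) + h ^ 2))
        = r ^ 2 / (2 * (q + 1)) / η + η * h ^ 2 := by
      have e6 : ((q / 2 + 1 : ℕ) : ℝ) = q + 1 - ((q + 1) / 2 : ℕ) := by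
        push_cast; rw [hq]; ring
      rw [e6]
      field_simp
      ring
    rw [e4, e5] at hmain
    linarith
  set s := (√(2 * q * v) + r / √(2 * (q + 1))) ^ 2
  have hs : 0 ≤ s := sq_nonneg _
  have h1 := key (s / c) (by positivity)
  rw [le_div_iff₀ (by positivity)]
  have e1 : p * (c + s / c) ^ 2 - (s / c) ^ 2 = (p * (s + c ^ 2) ^ 2 - s ^ 2) / c ^ 2 := by
    field_simp; ring
  rw [e1, div_le_iff₀ (by positivity)] at h1
  have h2 : (p * (s + c ^ 2)) * (s + c ^ 2) ≤ s * (s + c ^ 2) := by nlinarith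
  exact le_of_mul_le_mul_right h2 (by positivity)

lemma measureReal_mul_le_exp (hXmeas : ∀ t, Measurable (X t)) (hf : Measurable f)
    (hf_bdd : ∀ y, |f y| ≤ 1 / 2) {k q r : ℕ} {ε v a : ℝ} (hk : 1 ≤ k) (hr : 1 ≤ r)
    (hrk : r ≤ k) (hq : 1 ≤ q) (hε : 0 ≤ ε)
    (hdom : HasBlockDomination P X f (q * k + r) k ε)
    (h0k : ∫ y, y ∂(P.map (blockSum X f 0 k)) = 0)
    (h0r : ∫ y, y ∂(P.map (blockSum X f 0 r)) = 0)
    (hv : ∫ y, y ^ 2 ∂(P.map (blockSum X f 0 k)) = v) {y L u : ℝ} (hy : 0 < y) (hL : 0 < L)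
    (hvL : 2 * (q * v / k ^ 2) * (exp y - 1 - y) ≤ L) (hu : 0 < u)
    (huy : 1 / u = 1 / y + r / k / (2 * √((q + 1) * L)))
    (ha : -(1 / 2) ≤ u * ((a - ((q - 1 : ℕ) : ℝ) * ε) / k)) :
    P.real {ω | a ≤ blockSum X f 0 (q * k + r) ω}
        * (exp (1 / 2 + u * ((a - ((q - 1 : ℕ) : ℝ) * ε) / k)) - 3 / 2
          - u * ((a - ((q - 1 : ℕ) : ℝ) * ε) / k))
      ≤ exp (1 / 2 + (L + L ^ 2 / (2 * (q : ℝ) ^ 2))) - 3 / 2 := by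
  have hm := measurable_blockSum hXmeas hf
  have : IsProbabilityMeasure (P.map (blockSum X f 0 k)) :=
    Measure.isProbabilityMeasure_map (hm 0 k).aemeasurable
  have : IsProbabilityMeasure (P.map (blockSum X f 0 r)) :=
    Measure.isProbabilityMeasure_map (hm 0 r).aemeasurable
  have hbk := ae_map_blockSum_abs_le (P := P) hXmeas hf hf_bdd k
  have hbr := ae_map_blockSum_abs_le (P := P) hXmeas hf hf_bdd r
  have hk0 : (0 : ℝ) < k := by positivity
  have hr0 : (0 : ℝ) < r := by positivity
  have hq0 : (0 : ℝ) < q := by positivity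
  have hN : (0 : ℝ) < q + 1 := by positivity
  set w := √((q + 1) * L) with hw
  have hw0 : 0 < w := by positivity
  have hw2 : w ^ 2 = (q + 1) * L := sq_sqrt (by positivity)
  set η := u * (r / k / (2 * w)) with hη
  have hη0 : 0 < η := by positivity
  have h1η : 1 - η = u / y := by
    have : u * (1 / u) = 1 := by field_simp
    rw [huy] at this
    rw [hη]
    linear_combination -this
  have h1η0 : 0 < 1 - η := by rw [h1η]; positivity
  have hη1 : η < 1 := by linarith
  set t := u / k with ht
  have ht0 : 0 < t := by positivity
  have hexp : (3 : ℝ) / 2 ≤ exp (1 / 2) := by linarith [add_one_le_exp (1 / 2 : ℝ)]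
  have hexp' : ∀ z : ℝ, 0 ≤ z → 0 ≤ exp (1 / 2 + z) - 3 / 2 := fun z hz => by
    have := exp_le_exp.mpr (by linarith : (1 / 2 : ℝ) ≤ 1 / 2 + z)
    linarith
  have hTstep : ∫ z, exp (t * (2 / (1 - η)) * z) ∂(P.map (blockSum X f 0 k))
      ≤ exp (2 * L / q) := by
    have e1 : t * (2 / (1 - η)) * ((k : ℝ) / 2) = y := by rw [h1η, ht]; field_simp
    refine (integral_exp_le_bennett (b := (k : ℝ) / 2) (by positivity) (by positivity) hbk
      h0k).trans (exp_le_exp.mpr ?_)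
    rw [e1, hv, le_div_iff₀ hq0]
    refine le_trans (le_of_eq ?_) (mul_le_mul_of_nonneg_left hvL zero_le_two)
    field_simp
  have hBstep : ∫ z, exp (t * (2 / ((q + 1) * η)) * z) ∂(P.map (blockSum X f 0 r))
      ≤ exp (2 * L / (q + 1 : ℕ)) := by
    refine (integral_exp_le_hoeffding (b := (r : ℝ) / 2) (by positivity) hbr h0r).trans
      (exp_le_exp.mpr (le_of_eq ?_))
    have e1 : t * (2 / ((q + 1) * η)) = 4 * w / (r * (q + 1)) := by
      rw [ht, hη]; field_simp; ring
    have e2 : (4 * w / (r * (q + 1)) : ℝ) ^ 2 = 16 * ((q + 1) * L) / (r * (q + 1)) ^ 2 := by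
      rw [← hw2, div_pow, mul_pow 4]; ring
    rw [e1, e2]
    push_cast
    field_simp
    ring
  have hmain := deviation_master hXmeas hf hk hr hrk hε hdom hη0 hη1 (convexOn_expRem t)
    (monotone_expRem ht0.le) (expRem_nonneg t)
    (BT := fun m => exp (1 / 2 + m * (2 * L / q)) - 3 / 2)
    (BB := fun m => exp (1 / 2 + m * (2 * L / (q + 1 : ℕ))) - 3 / 2)
    (fun m => hexp' _ (by positivity)) (fun m => hexp' _ (by positivity))
    (fun m => lintegral_expRem_convPow_le hbk h0k m (integral_exp_convPow_le hbk hTstep m))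
    (fun m => lintegral_expRem_convPow_le hbr h0r m (integral_exp_convPow_le hbr hBstep m)) a
  have e1 : expRem t (a - ((q - 1 : ℕ) : ℝ) * ε)
      = exp (1 / 2 + u * ((a - ((q - 1 : ℕ) : ℝ) * ε) / k)) - 3 / 2
          - u * ((a - ((q - 1 : ℕ) : ℝ) * ε) / k) := by
    have e2 : t * (a - ((q - 1 : ℕ) : ℝ) * ε) = u * ((a - ((q - 1 : ℕ) : ℝ) * ε) / k) := by
      rw [ht]; ring
    unfold expRem
    rw [e2, max_eq_left (by linarith), add_comm (u * _)]
    ring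
  rw [e1] at hmain
  refine hmain.trans ?_
  have hT := parity_exp_average_le hq L (m := (q + 1) / 2) (m' := q / 2) (by omega) (by omega)
    (by omega)
  have hB := parity_exp_average_le (q := q + 1) (by omega) L (m := q / 2 + 1)
    (m' := (q + 1) / 2) (by omega) (by omega) (by omega)
  have hB2 : exp (1 / 2 + (L + L ^ 2 / (2 * ((q + 1 : ℕ) : ℝ) ^ 2)))
      ≤ exp (1 / 2 + (L + L ^ 2 / (2 * (q : ℝ) ^ 2))) := by
    rw [exp_le_exp]
    gcongr
    simp
  nlinarith [mul_le_mul_of_nonneg_left hT h1η0.le,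
    mul_le_mul_of_nonneg_left (hB.trans hB2) hη0.le]

end bounds

lemma exp_neg_ge {a b : ℝ} (m : ℕ) (ha : 0 ≤ a) (hm : a ≤ 3 / 2 * (m + 1))
    (h : b ≤ (1 - a / (m + 1) + (a / (m + 1)) ^ 2 / 2 - (a / (m + 1)) ^ 3 / 6) ^ (m + 1)) :
    b ≤ exp (-a) := by
  have key : ∀ t : ℝ, 0 ≤ t → 1 - t + t ^ 2 / 2 - t ^ 3 / 6 ≤ exp (-t) := by
    intro t ht
    have hd : ∀ s : ℝ, HasDerivAt (fun s => exp s * (1 - s + s ^ 2 / 2 - s ^ 3 / 6))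
        (exp s * (-(s ^ 3 / 6))) s := fun s => by
      have h1 := (((((hasDerivAt_id s).const_sub 1).add (((hasDerivAt_id s).pow 2).div_const 2)).sub
        (((hasDerivAt_id s).pow 3).div_const 6)))
      refine (((Real.hasDerivAt_exp s).mul h1).congr_deriv ?_).congr_of_eventuallyEq (Filter.Eventually.of_forall fun _ => rfl)
      simp only [id, Pi.add_apply, Pi.sub_apply, Pi.pow_apply, pow_one, Nat.cast_ofNat, Nat.add_one_sub_one]
      norm_num
      ring
    have hanti : AntitoneOn (fun s => exp s * (1 - s + s ^ 2 / 2 - s ^ 3 / 6)) (Set.Ici 0) := by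
      refine antitoneOn_of_deriv_nonpos (convex_Ici 0)
        (fun s _ => (hd s).continuousAt.continuousWithinAt)
        (fun s _ => (hd s).differentiableAt.differentiableWithinAt) fun s hs => ?_
      rw [interior_Ici] at hs
      rw [(hd s).deriv]
      have : 0 < s := hs
      have := mul_nonneg (exp_pos s).le (by positivity : 0 ≤ s ^ 3 / 6)
      linarith
    have h1 := hanti (Set.mem_Ici.2 le_rfl) (Set.mem_Ici.2 ht) ht
    simp only [exp_zero] at h1
    norm_num at h1
    rw [exp_neg, ← one_div, le_div_iff₀ (exp_pos t)]
    linarith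
  have hm0 : (0 : ℝ) < m + 1 := by positivity
  set t := a / (m + 1) with ht
  have ht0 : 0 ≤ t := by positivity
  have ht1 : t ≤ 3 / 2 := by rw [ht, div_le_iff₀ hm0]; linarith
  have hnn : 0 ≤ 1 - t + t ^ 2 / 2 - t ^ 3 / 6 := by
    nlinarith [mul_nonneg ht0 (sub_nonneg.2 ht1), sq_nonneg (t - 1),
      mul_nonneg (sq_nonneg t) (sub_nonneg.2 ht1)]
  have e : exp (-a) = exp (-t) ^ (m + 1) := by
    rw [← exp_nat_mul]
    congr 1
    push_cast
    rw [ht]; field_simp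
  rw [e]
  exact h.trans (pow_le_pow_left₀ hnn (key t ht0) _)

lemma exp_le_of_inv_le {a b : ℝ} (m : ℕ) (ha : 0 ≤ a) (hb : 0 < b) (hm : a ≤ 3 / 2 * (m + 1))
    (h : b⁻¹ ≤ (1 - a / (m + 1) + (a / (m + 1)) ^ 2 / 2 - (a / (m + 1)) ^ 3 / 6) ^ (m + 1)) :
    exp a ≤ b := by
  have := exp_neg_ge m ha hm h
  rw [exp_neg] at this
  exact (inv_le_inv₀ hb (exp_pos a)).mp this

lemma exp_sub_one_le_mul {x c b : ℝ} (hx : 0 ≤ x) (hxb : x ≤ b) (hb : 0 < b)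
    (h : exp b ≤ 1 + c * b) : exp x - 1 ≤ c * x := by
  have := convexOn_exp.2 (Set.mem_univ 0) (Set.mem_univ b)
    (sub_nonneg.2 ((div_le_one hb).2 hxb)) (by positivity : 0 ≤ x / b) (by ring)
  simp only [smul_eq_mul, mul_zero, zero_add, exp_zero, mul_one] at this
  rw [div_mul_cancel₀ _ hb.ne'] at this
  have h2 : x / b * exp b ≤ x / b * (1 + c * b) := by gcongr
  have h3 : x / b * (1 + c * b) = x / b + c * x := by field_simp
  linarith

lemma le_exp_neg_of_small {x p W : ℝ} (hx0 : 0 < x) (hx : x ≤ 3 / 8) (hp1 : p ≤ 1)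
    (hW : 0 ≤ W) (h : (2 * √(W * x) + 1.34 * x) * p
      ≤ √(2 * W) * √(1 - p) + (1 / 2 + x) * (1 - p)) : p ≤ exp (-x) := by
  by_contra! hc
  have he : exp x - 1 ≤ 1.22 * x := exp_sub_one_le_mul hx0.le hx (by norm_num)
    (exp_le_of_inv_le 3 (by norm_num) (by norm_num) (by norm_num) (by norm_num))
  have hp : 0 < p := (exp_pos _).trans hc
  have h1 : 1 < p * exp x := by
    have := mul_lt_mul_of_pos_right hc (exp_pos x)
    rwa [← exp_add, neg_add_cancel, exp_zero] at this
  have h2 : 1 - p < 1.22 * x * p := by nlinarith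
  have h3 : 5 / 8 ≤ p := by linarith [add_one_le_exp (-x)]
  have h4 : √(2 * W) * √(1 - p) ≤ 2 * √(W * x) * p := by
    rw [← sqrt_mul (by positivity), ← sqrt_sq hp.le, show (2 : ℝ) = √(2 ^ 2) by simp,
      ← sqrt_mul (by positivity), ← sqrt_mul (by positivity)]
    apply sqrt_le_sqrt
    rw [sqrt_sq hp.le, sqrt_sq zero_le_two]
    have : 1 - p ≤ 2 * x * p ^ 2 := by nlinarith [mul_pos hx0 hp]
    nlinarith
  nlinarith [mul_pos hx0 hp]

lemma threshold_ge {q ρ V x w : ℝ} (hq : 1 ≤ q) (hρ0 : 0 ≤ ρ) (hρ1 : ρ ≤ 1)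
    (hx : 0 ≤ x) (hW : q * V = w ^ 2 * x) :
    x * (2 * w + 0.34 + w * ρ / (q + 1) + (1 - ρ) / q + 2 * ρ / (q + 1))
      ≤ 2 * √((q + ρ) * V * x) + 1.34 * x - (q - 1) * (x / (q + ρ)) := by
  have hq0 : 0 < q := by linarith
  have h1 : x * w * (1 + ρ / (2 * (q + 1))) ≤ √((q + ρ) * V * x) := by
    apply le_sqrt_of_sq_le
    have e : (q + ρ) * V * x = (x * w) ^ 2 * (1 + ρ / q) := by
      have : V = w ^ 2 * x / q := by rw [← hW]; field_simp
      rw [this]; field_simp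
    rw [e, mul_pow]
    apply mul_le_mul_of_nonneg_left _ (sq_nonneg _)
    have h2 : (ρ / (2 * (q + 1))) ^ 2 ≤ ρ / (4 * (q + 1) ^ 2) := by
      rw [div_pow, div_le_div_iff₀ (by positivity) (by positivity)]
      have : ρ ^ 2 ≤ ρ := by nlinarith
      nlinarith [sq_nonneg (q + 1)]
    have h3 : ρ / q - ρ / (q + 1) = ρ / (q * (q + 1)) := by field_simp; ring
    have h4 : ρ / (4 * (q + 1) ^ 2) ≤ ρ / (q * (q + 1)) := by
      apply div_le_div_of_nonneg_left hρ0 (by positivity)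
      nlinarith
    have h5 : ρ / (2 * (q + 1)) * 2 = ρ / (q + 1) := by field_simp
    nlinarith
  have h2 : (1 - ρ) / q + 2 * ρ / (q + 1) ≤ 1 - (q - 1) / (q + ρ) := by
    have : 1 - (q - 1) / (q + ρ) = (1 + ρ) / (q + ρ) := by
      field_simp; ring
    rw [this, div_add_div _ _ (by positivity) (by positivity),
      div_le_div_iff₀ (by positivity) (by positivity)]
    nlinarith [mul_nonneg hρ0 (sub_nonneg.2 hρ1), mul_nonneg (mul_nonneg hρ0 (sub_nonneg.2 hρ1)) hq0.le]
  have e1 : (q - 1) * (x / (q + ρ)) = x * ((q - 1) / (q + ρ)) := by ring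
  have e2 : x * (w * ρ / (q + 1)) = 2 * (x * w * (ρ / (2 * (q + 1)))) := by field_simp
  rw [e1]
  nlinarith [mul_le_mul_of_nonneg_left h2 hx]

lemma sqrt_mul_le_threshold {q ρ x w c A : ℝ} (hq : 1 ≤ q) (hρ0 : 0 ≤ ρ) (hρ1 : ρ ≤ 1)
    (hx : 0 < x) (hw : 0 ≤ w) (hc : 0 ≤ c) (hexp : exp x - 1 ≤ 2 * c ^ 2 * x)
    (hcond : 2 * (c - 1) * x * w + c ^ 2 / 8 ≤ 0.34 * x)
    (hA : x * (2 * w + 0.34 + w * ρ / (q + 1) + (1 - ρ) / q + 2 * ρ / (q + 1)) ≤ A) :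
    √(exp x - 1) * (√(2 * (w ^ 2 * x)) + ρ / √(2 * (q + 1))) ≤ A := by
  have hq0 : 0 < q := by linarith
  have h1 : √(exp x - 1) ≤ c * √(2 * x) := by
    rw [show c * √(2 * x) = √(2 * c ^ 2 * x) by
      rw [show 2 * c ^ 2 * x = c ^ 2 * (2 * x) by ring, sqrt_mul (sq_nonneg c), sqrt_sq hc]]
    exact sqrt_le_sqrt hexp
  refine (mul_le_mul_of_nonneg_right h1 (by positivity)).trans (le_trans ?_ hA)
  have e1 : √(2 * (w ^ 2 * x)) = w * √(2 * x) := by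
    rw [show 2 * (w ^ 2 * x) = w ^ 2 * (2 * x) by ring, sqrt_mul (sq_nonneg w), sqrt_sq hw]
  set z := √(2 * x) * (ρ / √(2 * (q + 1))) with hz
  have hz2 : z ^ 2 = x * (ρ ^ 2 / (q + 1)) := by
    rw [hz, mul_pow, div_pow, sq_sqrt (by positivity), sq_sqrt (by positivity)]
    field_simp
  have h2 : x * (ρ ^ 2 / (q + 1)) ≤ x * (ρ / (q + 1)) := by
    gcongr
    nlinarith
  have h3 : c * z ≤ 2 * z ^ 2 + c ^ 2 / 8 := by nlinarith [sq_nonneg (4 * z - c)]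
  have e2 : c * √(2 * x) * (w * √(2 * x) + ρ / √(2 * (q + 1))) = 2 * c * x * w + c * z := by
    have := sq_sqrt (by positivity : 0 ≤ 2 * x)
    rw [hz]; linear_combination c * w * this
  rw [e1, e2]
  have h4 : 0 ≤ x * (w * ρ / (q + 1) + (1 - ρ) / q) := by
    have := sub_nonneg.2 hρ1
    positivity
  have e3 : x * (2 * ρ / (q + 1)) = 2 * (x * (ρ / (q + 1))) := by ring
  nlinarith

lemma div_add_sq_le_exp_neg {x s A p : ℝ} (hx : 0 ≤ x) (hs : 0 ≤ s) (hA : 0 < A)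
    (h : √(exp x - 1) * s ≤ A) (hp : p ≤ s ^ 2 / (s ^ 2 + A ^ 2)) : p ≤ exp (-x) := by
  refine hp.trans ?_
  have h1 : 0 ≤ exp x - 1 := by linarith [add_one_le_exp x]
  have h2 : (exp x - 1) * s ^ 2 ≤ A ^ 2 := by
    have := pow_le_pow_left₀ (by positivity) h 2
    rwa [mul_pow, sq_sqrt h1] at this
  rw [div_le_iff₀ (by positivity), exp_neg, ← div_eq_inv_mul, le_div_iff₀ (exp_pos x)]
  linarith

/-- The tilting parameters `y`, `L`, `u` make the exponential Markov bound at level `A` at most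
`exp (-x)`. -/
def HasTilt (q ρ w x A : ℝ) : Prop :=
  ∃ y L u : ℝ, 0 < y ∧ 0 < L ∧ 0 < u ∧ 2 * (w ^ 2 * x) * (exp y - 1 - y) ≤ L ∧
    1 / u = 1 / y + ρ / (2 * √((q + 1) * L)) ∧ 0 ≤ u * A ∧
    exp (1 / 2 + (L + L ^ 2 / (2 * q ^ 2))) - 3 / 2
      ≤ exp (-x) * (exp (1 / 2 + u * A) - 3 / 2 - u * A)

lemma sub_le_exp_neg_mul {x θ M E : ℝ} (hE0 : 0 ≤ E) (hθ0 : 0 ≤ M + x - E)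
    (hθ : M + x - E ≤ θ)
    (hE : E * exp (1 / 2 + M) ≤ 3 / 2 - (3 / 2 + M + x) * exp (-x)) :
    exp (1 / 2 + M) - 3 / 2 ≤ exp (-x) * (exp (1 / 2 + θ) - 3 / 2 - θ) := by
  have hmono : exp (1 / 2 + (M + x - E)) - (M + x - E) ≤ exp (1 / 2 + θ) - θ := by
    have h1 : exp (1 / 2 + θ) = exp (1 / 2 + (M + x - E)) * exp (θ - (M + x - E)) := by
      rw [← exp_add]; congr 1; ring
    have h2 := add_one_le_exp (θ - (M + x - E))
    have h3 : 1 ≤ exp (1 / 2 + (M + x - E)) := one_le_exp (by linarith)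
    nlinarith
  have h4 : exp (-x) * exp (1 / 2 + (M + x - E)) = exp (1 / 2 + M) * exp (-E) := by
    rw [← exp_add, ← exp_add]; congr 1; ring
  have h5 : 1 - E ≤ exp (-E) := by linarith [add_one_le_exp (-E)]
  have h6 := mul_le_mul_of_nonneg_left h5 (exp_pos (1 / 2 + M)).le
  have h7 := mul_le_mul_of_nonneg_left hmono (exp_pos (-x)).le
  have h8 := mul_nonneg (exp_pos (-x)).le hE0
  nlinarith

set_option maxHeartbeats 800000 in
lemma hasTilt_of_le {q ρ w x A y l κ E l' : ℝ} (hq : 1 ≤ q) (hρ0 : 0 ≤ ρ) (hρ1 : ρ ≤ 1)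
    (hx : 1 ≤ x) (hw : 0 ≤ w)
    (hA : x * (2 * w + 0.34 + w * ρ / (q + 1) + (1 - ρ) / q + 2 * ρ / (q + 1)) ≤ A)
    (hy : 0 < y) (hl : 0 < l) (hφ : 2 * w ^ 2 * (exp y - 1 - y) ≤ l)
    (hql : 2 ≤ (q + 1) * (l * x))
    (hκ : (q + 1) / q * (x / q) * (l ^ 2 / 2) * (1 / y + 0.355) ≤ κ) (hκ1 : κ ≤ 1)
    (hE0 : 0 ≤ E) (hEx : E ≤ x)
    (hmain : (1 + l) ^ 2 / (16 * l) / (2 - κ + w)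
      ≤ x * (2 * w + 0.34) - ((1 + l) * x - E) / y)
    (hl' : l + l ^ 2 * (x / q ^ 2) / 2 ≤ l')
    (hE : E * exp (1 / 2 + l' * x) ≤ 3 / 2 - (3 / 2 + (1 + l') * x) * exp (-x)) :
    HasTilt q ρ w x A := by
  have hq0 : 0 < q := by linarith
  have hx0 : 0 < x := by linarith
  set s := √((q + 1) * (l * x)) with hs
  have hs0 : 0 < s := by positivity
  have hs2 : s ^ 2 = (q + 1) * (l * x) := sq_sqrt (by positivity)
  have hs1 : 1.409 ≤ s := le_sqrt_of_sq_le (by norm_num; linarith)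
  have hd0 : 0 < 1 / y + ρ / (2 * s) := by positivity
  set d := 1 / y + ρ / (2 * s) with hd
  have hρs : ρ / (2 * s) ≤ 0.355 := by
    rw [div_le_iff₀ (by positivity)]; nlinarith
  set M := l * x + (l * x) ^ 2 / (2 * q ^ 2) with hM
  have hMl : M ≤ l' * x := by
    have : M = (l + l ^ 2 * (x / q ^ 2) / 2) * x := by rw [hM]; field_simp
    rw [this]
    exact mul_le_mul_of_nonneg_right hl' hx0.le
  have hM0 : 0 ≤ M := by positivity
  refine ⟨y, l * x, 1 / d, hy, by positivity, by positivity, ?_, by rw [one_div_one_div], ?_, ?_⟩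
  · nlinarith
  · have := sub_nonneg.2 hρ1
    have : 0 ≤ A := le_trans (by positivity) hA
    positivity
  refine sub_le_exp_neg_mul hE0 (by linarith) ?_ ?_
  · rw [one_div, ← div_eq_inv_mul, le_div_iff₀ hd0]
    refine le_trans ?_ hA
    have hπ : (l * x) ^ 2 / (2 * q ^ 2) * d ≤ κ * x / (q + 1) := by
      have h1 : (q + 1) / q * (x / q) * (l ^ 2 / 2) * d ≤ κ :=
        le_trans (by gcongr; rw [hd]; linarith) hκ
      have e : (l * x) ^ 2 / (2 * q ^ 2) * d
          = (q + 1) / q * (x / q) * (l ^ 2 / 2) * d * x / (q + 1) := by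
        field_simp
      rw [e]
      gcongr
    set m := 2 - κ + w with hm
    have hm0 : 0 < m := by linarith
    have hκρ : κ * (1 - ρ) / (q + 1) ≤ (1 - ρ) / q := by
      have := sub_nonneg.2 hρ1
      apply div_le_div₀ this (by nlinarith) hq0 (by linarith)
    -- the boundary term is absorbed by an arithmetic-geometric mean inequality
    have hag : (1 + l) * x * (ρ / (2 * s))
        ≤ (1 + l) ^ 2 / (16 * l) / m + m * (x * ρ / (q + 1)) := by
      have e1 : (x * (ρ / s)) ^ 2 = x * ρ ^ 2 / ((q + 1) * l) := by
        rw [mul_pow, div_pow, hs2]; field_simp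
      have e2 : x * ρ ^ 2 / ((q + 1) * l) * l ≤ x * ρ / (q + 1) := by
        have : x * ρ ^ 2 / ((q + 1) * l) * l = x * ρ * ρ / (q + 1) := by field_simp
        rw [this]
        gcongr
        exact mul_le_of_le_one_right (by positivity) hρ1
      have e3 : (1 + l) ^ 2 / (16 * l) / m + m * (l * (x * (ρ / s)) ^ 2)
          - (1 + l) * x * (ρ / (2 * s))
          = ((1 + l) / 4 - m * l * (x * (ρ / s))) ^ 2 / (m * l) := by
        field_simp; ring
      have e4 : 0 ≤ ((1 + l) / 4 - m * l * (x * (ρ / s))) ^ 2 / (m * l) := by positivity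
      rw [← e3, e1] at e4
      have e5 := mul_le_mul_of_nonneg_left e2 hm0.le
      have e6 : m * (l * (x * ρ ^ 2 / ((q + 1) * l))) = m * (x * ρ ^ 2 / ((q + 1) * l) * l) := by
        ring
      linarith
    have e1 : (M + x - E) * d = ((1 + l) * x - E) / y + (1 + l) * x * (ρ / (2 * s))
        - E * (ρ / (2 * s)) + (l * x) ^ 2 / (2 * q ^ 2) * d := by
      rw [hM, hd]; ring
    have e2 : 0 ≤ E * (ρ / (2 * s)) := by positivity
    have e3 : x * (w * ρ / (q + 1) + κ * (1 - ρ) / (q + 1) + 2 * ρ / (q + 1))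
        = m * (x * ρ / (q + 1)) + κ * x / (q + 1) := by
      rw [hm]; ring
    have e4 := mul_le_mul_of_nonneg_left hκρ hx0.le
    rw [e1]
    linarith
  · have h1 : exp (1 / 2 + M) ≤ exp (1 / 2 + l' * x) := exp_le_exp.2 (by linarith)
    have h2 := mul_le_mul_of_nonneg_left h1 hE0
    have h3 := mul_le_mul_of_nonneg_right hMl (exp_pos (-x)).le
    nlinarith

/-- A rational lower bound of `exp (-a)`. -/
noncomputable def expNegLow (a : ℝ) : ℝ := (1 - a / 16 + (a / 16) ^ 2 / 2 - (a / 16) ^ 3 / 6) ^ 16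

lemma expNegLow_le {a : ℝ} (ha : 0 ≤ a) (ha' : a ≤ 24) : expNegLow a ≤ exp (-a) := by
  refine exp_neg_ge 15 ha (by norm_num; linarith) (le_of_eq ?_)
  norm_num [expNegLow]

lemma tilt_slack {x l' t₀ t₁ e₀ g : ℝ} (hl0 : 0 ≤ l') (hl1 : l' ≤ 1) (ht : 1 ≤ t₀) (h0 : t₀ ≤ x)
    (h1 : x ≤ t₁) (he : exp (-t₀) ≤ e₀) (he0 : (3 / 2 + 2 * t₀) * e₀ ≤ 3 / 2) (hg0 : 0 ≤ g)
    (hg : g ≤ exp (-(1 / 2 + l' * t₁))) :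
    0 ≤ g * (3 / 2 - (3 / 2 + (1 + l') * t₀) * e₀) ∧
    g * (3 / 2 - (3 / 2 + (1 + l') * t₀) * e₀) ≤ 1 ∧
    g * (3 / 2 - (3 / 2 + (1 + l') * t₀) * e₀) * exp (1 / 2 + l' * x)
      ≤ 3 / 2 - (3 / 2 + (1 + l') * x) * exp (-x) := by
  have he' : 0 < e₀ := (exp_pos _).trans_le he
  have hK : 0 ≤ 3 / 2 - (3 / 2 + (1 + l') * t₀) * e₀ := by
    have : (3 / 2 + (1 + l') * t₀) * e₀ ≤ (3 / 2 + 2 * t₀) * e₀ := by gcongr; linarith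
    linarith
  have hK' : 3 / 2 - (3 / 2 + (1 + l') * t₀) * e₀ ≤ 3 / 2 - (3 / 2 + (1 + l') * x) * exp (-x) := by
    have e1 : exp (-t₀) = exp (-x) * exp (x - t₀) := by rw [← exp_add]; congr 1; ring
    have e2 := add_one_le_exp (x - t₀)
    have e3 : (3 / 2 + (1 + l') * x) ≤ (3 / 2 + (1 + l') * t₀) * exp (x - t₀) := by
      have : (3 / 2 + (1 + l') * t₀) * (x - t₀ + 1) ≤ (3 / 2 + (1 + l') * t₀) * exp (x - t₀) := by
        gcongr
      nlinarith [mul_nonneg hl0 (sub_nonneg.2 ht), mul_nonneg (sub_nonneg.2 h0) (sub_nonneg.2 ht),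
        mul_nonneg (mul_nonneg (sub_nonneg.2 h0) (sub_nonneg.2 ht)) hl0, sub_nonneg.2 h0]
    have e4 : (3 / 2 + (1 + l') * t₀) * exp (-t₀) ≤ (3 / 2 + (1 + l') * t₀) * e₀ := by gcongr
    have e5 := mul_le_mul_of_nonneg_right e3 (exp_pos (-x)).le
    rw [e1] at e4
    nlinarith
  have hg1 : g * exp (1 / 2 + l' * x) ≤ 1 := by
    have e1 : exp (1 / 2 + l' * x) ≤ exp (1 / 2 + l' * t₁) := by gcongr
    calc g * exp (1 / 2 + l' * x) ≤ exp (-(1 / 2 + l' * t₁)) * exp (1 / 2 + l' * t₁) := by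
          gcongr
      _ = 1 := by rw [← exp_add, neg_add_cancel, exp_zero]
  have hg2 : g ≤ 2 / 3 := by
    have h1 := add_one_le_exp (1 / 2 + l' * t₁)
    have h2 : 0 ≤ l' * t₁ := mul_nonneg hl0 (by linarith)
    rw [exp_neg] at hg
    refine hg.trans (inv_le_of_inv_le₀ (by norm_num) (by norm_num; linarith))
  have hK2 : 3 / 2 - (3 / 2 + (1 + l') * t₀) * e₀ ≤ 3 / 2 := by
    have : 0 ≤ (3 / 2 + (1 + l') * t₀) * e₀ := by positivity
    linarith
  refine ⟨by positivity, by nlinarith, ?_⟩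
  nlinarith

/-- The relations between the parameters in the range where exponential tilting is used. -/
structure TiltRange (q ρ w x A : ℝ) : Prop where
  four_le : 4 ≤ q
  nonneg : 0 ≤ ρ
  le_one : ρ ≤ 1
  three_halves_le : 3 / 2 ≤ x
  mul_le : 2.68 * x ≤ q + 1
  threshold : x * (2 * w + 0.34 + w * ρ / (q + 1) + (1 - ρ) / q + 2 * ρ / (q + 1)) ≤ A

lemma TiltRange.hasTilt {q ρ w x A y l l' κ E : ℝ} (h : TiltRange q ρ w x A)
    (hw : 0 ≤ w) (hy : 0 < y) (hl : 0.28 ≤ l) (hφ : 2 * w ^ 2 * (exp y - 1 - y) ≤ l)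
    (hκ : 0.292 * l ^ 2 * (1 / y + 0.355) ≤ κ) (hκ1 : κ ≤ 1) (hE0 : 0 ≤ E) (hE1 : E ≤ 3 / 2)
    (hmain : (1 + l) ^ 2 / (16 * l) ≤ (2 - κ + w) * (x * (2 * w + 0.34) - ((1 + l) * x - E) / y))
    (hl' : l + 0.0584 * l ^ 2 ≤ l')
    (hE : E * exp (1 / 2 + l' * x) ≤ 3 / 2 - (3 / 2 + (1 + l') * x) * exp (-x)) :
    HasTilt q ρ w x A := by
  obtain ⟨hq, hρ0, hρ1, hx, hqx, hA⟩ := h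
  have hq0 : 0 < q := by linarith
  have hx0 : 0 < x := by linarith
  have hl0 : 0 < l := by linarith
  have h1 : x / q ≤ 0.467 := by rw [div_le_iff₀ hq0]; linarith
  have h2 : (q + 1) / q ≤ 1.25 := by rw [div_le_iff₀ hq0]; linarith
  refine hasTilt_of_le (by linarith) hρ0 hρ1 (by linarith) hw hA hy hl0 hφ (by nlinarith [mul_le_mul hl hx (by norm_num) hl0.le])
    (le_trans ?_ hκ) hκ1 hE0 (by linarith) ?_ (le_trans ?_ hl') hE
  · have h3 : (q + 1) / q * (x / q) ≤ 1.25 * 0.467 := by gcongr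
    have h4 : 0 ≤ l ^ 2 / 2 * (1 / y + 0.355) := by positivity
    nlinarith
  · rw [div_le_iff₀ (by linarith)]
    linarith
  · have h3 : x / q ^ 2 ≤ 0.467 / 4 := by
      have : x / q ^ 2 = x / q / q := by field_simp
      rw [this]
      gcongr
    nlinarith [sq_nonneg l]

lemma div_sixteen_le_of_mem_segment {l₀ l₁ s D : ℝ} (h₀ : 0 < l₀) (h₁ : 0 < l₁) (hs0 : 0 ≤ s)
    (hs1 : s ≤ 1) (hD₀ : (1 + l₀) ^ 2 ≤ D * (16 * l₀)) (hD₁ : (1 + l₁) ^ 2 ≤ D * (16 * l₁)) :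
    (1 + ((1 - s) * l₀ + s * l₁)) ^ 2 / (16 * ((1 - s) * l₀ + s * l₁)) ≤ D := by
  have hs1' := sub_nonneg.2 hs1
  have hl : 0 < (1 - s) * l₀ + s * l₁ := by
    rcases hs0.eq_or_lt with rfl | hs
    · simpa using h₀
    · positivity
  rw [div_le_iff₀ (by positivity)]
  nlinarith [mul_le_mul_of_nonneg_left hD₀ hs1', mul_le_mul_of_nonneg_left hD₁ hs0,
    mul_nonneg (mul_nonneg hs0 hs1') (sq_nonneg (l₀ - l₁))]

lemma exp_neg_le_of_inv_le {t e : ℝ} (m : ℕ) (ht : 0 ≤ t) (he : 0 < e)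
    (h : e⁻¹ ≤ (∑ i ∈ Finset.range 6, (t / (m + 1)) ^ i / i.factorial) ^ (m + 1)) :
    exp (-t) ≤ e := by
  rw [exp_neg]
  refine inv_le_of_inv_le₀ he (h.trans ?_)
  have h0 : 0 ≤ t / (m + 1) := by positivity
  have e1 : exp t = exp (t / (m + 1)) ^ (m + 1) := by
    rw [← exp_nat_mul]; congr 1; push_cast; field_simp
  rw [e1]
  exact pow_le_pow_left₀ (by positivity) (sum_le_exp_of_nonneg h0 6) _

/-- A numerical certificate that the tilting exponents `y`, `l'` work for all `x ≥ 3 / 2`. -/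
def TiltCertificate (y l' B C : ℝ) : Prop :=
  C ≤ 1.5 * B + expNegLow (1 / 2 + l' * 1.75) * (3 / 2 - (3 / 2 + (1 + l') * 1.5) * 0.22315) / y ∧
  C ≤ 1.75 * B + expNegLow (1 / 2 + l' * 2.1) * (3 / 2 - (3 / 2 + (1 + l') * 1.75) * 0.17379) / y ∧
  C ≤ 2.1 * B + expNegLow (1 / 2 + l' * 2.6) * (3 / 2 - (3 / 2 + (1 + l') * 2.1) * 0.12247) / y ∧
  C ≤ 2.6 * B + expNegLow (1 / 2 + l' * 3.3) * (3 / 2 - (3 / 2 + (1 + l') * 2.6) * 0.07429) / y ∧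
  C ≤ 3.3 * B + expNegLow (1 / 2 + l' * 4.2) * (3 / 2 - (3 / 2 + (1 + l') * 3.3) * 0.0369) / y ∧
  C ≤ 4.2 * B + expNegLow (1 / 2 + l' * 5.5) * (3 / 2 - (3 / 2 + (1 + l') * 4.2) * 0.01501) / y ∧
  C ≤ 5.5 * B + expNegLow (1 / 2 + l' * 8) * (3 / 2 - (3 / 2 + (1 + l') * 5.5) * 0.0041) / y ∧
  C ≤ 8 * B

lemma TiltCertificate.exists_slack {x y l' B C : ℝ} (h : TiltCertificate y l' B C)
    (hx : 3 / 2 ≤ x) (hl'0 : 0 ≤ l') (hl'1 : l' ≤ 1) (hB : 0 ≤ B) :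
    ∃ E, 0 ≤ E ∧ E ≤ 3 / 2 ∧
      E * exp (1 / 2 + l' * x) ≤ 3 / 2 - (3 / 2 + (1 + l') * x) * exp (-x) ∧
      C ≤ x * B + E / y := by
  obtain ⟨h1, h2, h3, h4, h5, h6, h7, h8⟩ := h
  have key : ∀ t₀ t₁ e₀ : ℝ, 1 ≤ t₀ → t₁ ≤ 8 → exp (-t₀) ≤ e₀ → (3 / 2 + 2 * t₀) * e₀ ≤ 3 / 2 →
      t₀ ≤ x → x ≤ t₁ → C ≤ t₀ * B + expNegLow (1 / 2 + l' * t₁)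
        * (3 / 2 - (3 / 2 + (1 + l') * t₀) * e₀) / y → ∃ E, 0 ≤ E ∧ E ≤ 3 / 2 ∧
      E * exp (1 / 2 + l' * x) ≤ 3 / 2 - (3 / 2 + (1 + l') * x) * exp (-x) ∧
      C ≤ x * B + E / y := by
    intro t₀ t₁ e₀ ht₀ ht₁ he he' h0 h1 hC
    have hg : 0 ≤ expNegLow (1 / 2 + l' * t₁) := by
      unfold expNegLow; exact Even.pow_nonneg (by decide) _
    have ht₁0 : 0 ≤ t₁ := by linarith
    obtain ⟨i1, i2, i3⟩ := tilt_slack hl'0 hl'1 ht₀ h0 h1 he he' hg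
      (expNegLow_le (by positivity) (by nlinarith))
    exact ⟨_, i1, i2.trans (by norm_num), i3, hC.trans (by gcongr)⟩
  have hexp : ∀ t e : ℝ, 0 ≤ t → 0 < e →
      e⁻¹ ≤ (∑ i ∈ Finset.range 6, (t / 8) ^ i / i.factorial) ^ 8 → exp (-t) ≤ e :=
    fun t e ht he h => exp_neg_le_of_inv_le 7 ht he (h.trans_eq (by norm_num))
  rcases le_total x 1.75 with hx1 | hx1
  · exact key _ _ _ (by norm_num) (by norm_num) (hexp 1.5 _ (by norm_num) (by norm_num)
      (by norm_num [Finset.sum_range_succ, Nat.factorial])) (by norm_num) (by linarith) hx1 h1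
  rcases le_total x 2.1 with hx2 | hx2
  · exact key _ _ _ (by norm_num) (by norm_num) (hexp 1.75 _ (by norm_num) (by norm_num)
      (by norm_num [Finset.sum_range_succ, Nat.factorial])) (by norm_num) hx1 hx2 h2
  rcases le_total x 2.6 with hx3 | hx3
  · exact key _ _ _ (by norm_num) (by norm_num) (hexp 2.1 _ (by norm_num) (by norm_num)
      (by norm_num [Finset.sum_range_succ, Nat.factorial])) (by norm_num) hx2 hx3 h3
  rcases le_total x 3.3 with hx4 | hx4
  · exact key _ _ _ (by norm_num) (by norm_num) (hexp 2.6 _ (by norm_num) (by norm_num)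
      (by norm_num [Finset.sum_range_succ, Nat.factorial])) (by norm_num) hx3 hx4 h4
  rcases le_total x 4.2 with hx5 | hx5
  · exact key _ _ _ (by norm_num) (by norm_num) (hexp 3.3 _ (by norm_num) (by norm_num)
      (by norm_num [Finset.sum_range_succ, Nat.factorial])) (by norm_num) hx4 hx5 h5
  rcases le_total x 5.5 with hx6 | hx6
  · exact key _ _ _ (by norm_num) (by norm_num) (hexp 4.2 _ (by norm_num) (by norm_num)
      (by norm_num [Finset.sum_range_succ, Nat.factorial])) (by norm_num) hx5 hx6 h6
  rcases le_total x 8 with hx7 | hx7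
  · exact key _ _ _ (by norm_num) (by norm_num) (hexp 5.5 _ (by norm_num) (by norm_num)
      (by norm_num [Finset.sum_range_succ, Nat.factorial])) (by norm_num) hx6 hx7 h7
  · refine ⟨0, le_rfl, by norm_num, ?_, ?_⟩
    · have h9 : exp (-x) ≤ (1 + x + x ^ 2 / 2)⁻¹ := by
        rw [exp_neg]
        exact inv_anti₀ (by positivity) (quadratic_le_exp_of_nonneg (by linarith))
      have h10 : (3 / 2 + (1 + l') * x) * exp (-x) ≤ (3 / 2 + 2 * x) * (1 + x + x ^ 2 / 2)⁻¹ := by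
        gcongr; linarith
      have h11 : (3 / 2 + 2 * x) * (1 + x + x ^ 2 / 2)⁻¹ ≤ 3 / 2 := by
        rw [← div_eq_mul_inv, div_le_iff₀ (by positivity)]; nlinarith
      linarith
    · rw [zero_div, add_zero]
      exact h8.trans (by gcongr)

lemma TiltRange.hasTilt_of_mem_segment {q ρ w x A y w₀ w₁ φ l₀ l₁ l' B C : ℝ}
    (h : TiltRange q ρ w x A) (hw0 : w₀ ≤ w) (hw1 : w ≤ w₁) (hw₀ : 0 ≤ w₀) (hw₀₁ : w₀ < w₁)
    (hy : 0 < y) (hy' : y ≤ 48) (hφ0 : 0 ≤ φ)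
    (hφ : (1 + y + φ)⁻¹ ≤ (1 - y / 32 + (y / 32) ^ 2 / 2 - (y / 32) ^ 3 / 6) ^ 32)
    (hl₀ : 0.28 ≤ l₀) (hl₀₁ : l₀ ≤ l₁) (hφ₀ : 2 * w₀ ^ 2 * φ ≤ l₀) (hφ₁ : 2 * w₁ ^ 2 * φ ≤ l₁)
    (hκ : 0.292 * l₁ ^ 2 * (1 / y + 0.355) ≤ 1)
    (hC₀ : (1 + l₀) ^ 2 ≤ C * (2 - 0.292 * l₁ ^ 2 * (1 / y + 0.355) + w₀) * (16 * l₀))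
    (hC₁ : (1 + l₁) ^ 2 ≤ C * (2 - 0.292 * l₁ ^ 2 * (1 / y + 0.355) + w₀) * (16 * l₁))
    (hB : 0 ≤ B) (hB₀ : B ≤ 2 * w₀ + 0.34 - (1 + l₀) / y) (hB₁ : B ≤ 2 * w₁ + 0.34 - (1 + l₁) / y)
    (hl' : l₁ + 0.0584 * l₁ ^ 2 ≤ l') (hl'1 : l' ≤ 1)
    (hcert : TiltCertificate y l' B C) : HasTilt q ρ w x A := by
  have hx := h.three_halves_le
  have hl'0 : 0 ≤ l' := by
    have : 0 ≤ l₁ := by linarith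
    exact le_trans (by positivity) hl'
  obtain ⟨E, hE0, hE1, hE, hCE⟩ := hcert.exists_slack hx hl'0 hl'1 hB
  set s := (w - w₀) / (w₁ - w₀) with hs
  have hd : 0 < w₁ - w₀ := sub_pos.2 hw₀₁
  have hs0 : 0 ≤ s := div_nonneg (sub_nonneg.2 hw0) hd.le
  have hs1 : s ≤ 1 := (div_le_one hd).2 (by linarith)
  have hws : w = (1 - s) * w₀ + s * w₁ := by rw [hs]; field_simp; ring
  have hs1' := sub_nonneg.2 hs1
  set l := (1 - s) * l₀ + s * l₁ with hldef
  have hl0 : l₀ ≤ l := by linarith [mul_nonneg hs0 (sub_nonneg.2 hl₀₁)]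
  have hl1 : l ≤ l₁ := by linarith [mul_nonneg hs1' (sub_nonneg.2 hl₀₁)]
  set κ := 0.292 * l₁ ^ 2 * (1 / y + 0.355) with hκdef
  refine h.hasTilt (l := l) (l' := l') (κ := κ) (E := E) (hw₀.trans hw0) hy (by linarith) ?_ ?_ hκ
    hE0 hE1 ?_ (le_trans ?_ hl') hE
  · have h1 : exp y - 1 - y ≤ φ := by
      have := exp_le_of_inv_le (b := 1 + y + φ) 31 hy.le (by positivity) (by norm_num; linarith)
        (hφ.trans_eq (by norm_num))
      linarith
    have h2 : w ^ 2 ≤ (1 - s) * w₀ ^ 2 + s * w₁ ^ 2 := by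
      rw [hws]; linarith [mul_nonneg (mul_nonneg hs0 hs1') (sq_nonneg (w₀ - w₁))]
    have h3 : 2 * w ^ 2 * (exp y - 1 - y) ≤ 2 * w ^ 2 * φ := by gcongr
    linarith [mul_le_mul_of_nonneg_left hφ₀ hs1', mul_le_mul_of_nonneg_left hφ₁ hs0,
      mul_le_mul_of_nonneg_right h2 hφ0]
  · rw [hκdef]
    have : 0 ≤ l := by linarith
    gcongr
  · have hκ2 : 0 < 2 - κ + w₀ := by linarith
    have h1 := div_sixteen_le_of_mem_segment (by linarith) (by linarith) hs0 hs1 hC₀ hC₁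
    have hBw : B ≤ 2 * w + 0.34 - (1 + l) / y := by
      have e1 : 2 * w + 0.34 - (1 + l) / y = (1 - s) * (2 * w₀ + 0.34 - (1 + l₀) / y)
          + s * (2 * w₁ + 0.34 - (1 + l₁) / y) := by rw [hws, hldef]; ring
      rw [e1]
      linarith [mul_le_mul_of_nonneg_left hB₀ hs1', mul_le_mul_of_nonneg_left hB₁ hs0]
    have h2 : C ≤ x * (2 * w + 0.34) - ((1 + l) * x - E) / y := by
      have e1 : x * (2 * w + 0.34) - ((1 + l) * x - E) / y
          = x * (2 * w + 0.34 - (1 + l) / y) + E / y := by ring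
      rw [e1]
      linarith [mul_le_mul_of_nonneg_left hBw (by linarith : 0 ≤ x)]
    have hC : 0 ≤ C := by
      by_contra! hc
      have : (0 : ℝ) ≤ (1 + l₀) ^ 2 := sq_nonneg _
      have : C * (2 - κ + w₀) * (16 * l₀) < 0 :=
        mul_neg_of_neg_of_pos (mul_neg_of_neg_of_pos hc hκ2) (by linarith)
      linarith
    calc _ ≤ C * (2 - κ + w₀) := h1
      _ ≤ C * (2 - κ + w) := by gcongr
      _ ≤ _ := by
        rw [mul_comm]
        exact mul_le_mul_of_nonneg_left h2 (by linarith)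
  · have : 0 ≤ l := by linarith
    gcongr

set_option maxHeartbeats 1000000 in
lemma TiltRange.hasTilt_of_le {q ρ w x A : ℝ} (h : TiltRange q ρ w x A) (hw0 : 0 ≤ w)
    (hw : w ≤ 1.4) : HasTilt q ρ w x A := by
  rcases le_total w 0.0355 with h1 | h1
  · apply h.hasTilt_of_mem_segment (y := 5.65) (w₀ := 0) (w₁ := 0.0355) (φ := 278.10222) (l₀ := 0.32)
      (l₁ := 0.701) (l' := 0.7297) (B := 0.10637) (C := 0.17691) hw0 h1
      <;> norm_num [TiltCertificate, expNegLow]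
  rcases le_total w 0.071 with h2 | h2
  · apply h.hasTilt_of_mem_segment (y := 4.2) (w₀ := 0.0355) (w₁ := 0.071) (φ := 61.51938) (l₀ := 0.32)
      (l₁ := 0.6203) (l' := 0.6428) (B := 0.09621) (C := 0.17285) h1 h2
      <;> norm_num [TiltCertificate, expNegLow]
  rcases le_total w 0.11 with h3 | h3
  · apply h.hasTilt_of_mem_segment (y := 3.275) (w₀ := 0.071) (w₁ := 0.11) (φ := 22.17309) (l₀ := 0.28)
      (l₁ := 0.5366) (l' := 0.5535) (B := 0.0908) (C := 0.18146) h2 h3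
      <;> norm_num [TiltCertificate, expNegLow]
  rcases le_total w 0.1555 with h4 | h4
  · apply h.hasTilt_of_mem_segment (y := 2.675) (w₀ := 0.11) (w₁ := 0.1555) (φ := 10.83855) (l₀ := 0.28)
      (l₁ := 0.5242) (l' := 0.5403) (B := 0.0812) (C := 0.17827) h3 h4
      <;> norm_num [TiltCertificate, expNegLow]
  rcases le_total w 0.212 with h5 | h5
  · apply h.hasTilt_of_mem_segment (y := 2.225) (w₀ := 0.1555) (w₁ := 0.212) (φ := 6.02885) (l₀ := 0.2916)
      (l₁ := 0.542) (l' := 0.5592) (B := 0.0705) (C := 0.17137) h4 h5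
      <;> norm_num [TiltCertificate, expNegLow]
  rcases le_total w 0.2805 with h6 | h6
  · apply h.hasTilt_of_mem_segment (y := 1.925) (w₀ := 0.212) (w₁ := 0.2805) (φ := 3.93031) (l₀ := 0.3533)
      (l₁ := 0.6185) (l' := 0.6409) (B := 0.06022) (C := 0.15324) h5 h6
      <;> norm_num [TiltCertificate, expNegLow]
  rcases le_total w 0.3615 with h7 | h7
  · apply h.hasTilt_of_mem_segment (y := 1.65) (w₀ := 0.2805) (w₁ := 0.3615) (φ := 2.55705) (l₀ := 0.4024)
      (l₁ := 0.6684) (l' := 0.6945) (B := 0.05106) (C := 0.14175) h6 h7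
      <;> norm_num [TiltCertificate, expNegLow]
  rcases le_total w 0.454 with h8 | h8
  · apply h.hasTilt_of_mem_segment (y := 1.425) (w₀ := 0.3615) (w₁ := 0.454) (φ := 1.73289) (l₀ := 0.453)
      (l₁ := 0.7144) (l' := 0.7443) (B := 0.04335) (C := 0.13216) h7 h8
      <;> norm_num [TiltCertificate, expNegLow]
  rcases le_total w 0.5605 with h9 | h9
  · apply h.hasTilt_of_mem_segment (y := 1.225) (w₀ := 0.454) (w₁ := 0.5605) (φ := 1.17918) (l₀ := 0.4861)
      (l₁ := 0.741) (l' := 0.7731) (B := 0.03485) (C := 0.12531) h8 h9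
      <;> norm_num [TiltCertificate, expNegLow]
  rcases le_total w 0.6805 with h10 | h10
  · apply h.hasTilt_of_mem_segment (y := 1.075) (w₀ := 0.5605) (w₁ := 0.6805) (φ := 0.85500) (l₀ := 0.5373)
      (l₁ := 0.7919) (l' := 0.8286) (B := 0.03095) (C := 0.11824) h9 h10
      <;> norm_num [TiltCertificate, expNegLow]
  rcases le_total w 0.8065 with h11 | h11
  · apply h.hasTilt_of_mem_segment (y := 0.95) (w₀ := 0.6805) (w₁ := 0.8065) (φ := 0.63572) (l₀ := 0.5888)
      (l₁ := 0.827) (l' := 0.867) (B := 0.02857) (C := 0.11168) h10 h11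
      <;> norm_num [TiltCertificate, expNegLow]
  rcases le_total w 0.934 with h12 | h12
  · apply h.hasTilt_of_mem_segment (y := 0.85) (w₀ := 0.8065) (w₁ := 0.934) (φ := 0.48965) (l₀ := 0.637)
      (l₁ := 0.8543) (l' := 0.897) (B := 0.02647) (C := 0.10602) h11 h12
      <;> norm_num [TiltCertificate, expNegLow]
  rcases le_total w 1.048 with h13 | h13
  · apply h.hasTilt_of_mem_segment (y := 0.775) (w₀ := 0.934) (w₁ := 1.048) (φ := 0.39560) (l₀ := 0.6903)
      (l₁ := 0.869) (l' := 0.9132) (B := 0.02438) (C := 0.10061) h12 h13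
      <;> norm_num [TiltCertificate, expNegLow]
  rcases le_total w 1.1765 with h14 | h14
  · apply h.hasTilt_of_mem_segment (y := 0.7) (w₀ := 1.048) (w₁ := 1.1765) (φ := 0.31376) (l₀ := 0.6893)
      (l₁ := 0.8686) (l' := 0.9127) (B := 0.02271) (C := 0.09746) h13 h14
      <;> norm_num [TiltCertificate, expNegLow]
  rcases le_total w 1.292 with h15 | h15
  · apply h.hasTilt_of_mem_segment (y := 0.65) (w₀ := 1.1765) (w₁ := 1.292) (φ := 0.26555) (l₀ := 0.7352)
      (l₁ := 0.8866) (l' := 0.9326) (B := 0.02153) (C := 0.09336) h14 h15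
      <;> norm_num [TiltCertificate, expNegLow]
  · apply h.hasTilt_of_mem_segment (y := 0.6) (w₀ := 1.292) (w₁ := 1.4185) (φ := 0.22212) (l₀ := 0.7416)
      (l₁ := 0.8939) (l' := 0.9406) (B := 0.02049) (C := 0.09064) h15 (hw.trans (by norm_num))
      <;> norm_num [TiltCertificate, expNegLow]

lemma nonneg_of_bernstein {p c₀ c₁ c₂ c₃ c₄ c₅ : ℝ} (hp0 : 0 ≤ p) (hp1 : p ≤ 1 / 5)
    (h₀ : 0 ≤ c₀) (h₁ : 0 ≤ c₀ + c₁ / 25)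
    (h₂ : 0 ≤ c₀ + 2 / 25 * c₁ + c₂ / 250)
    (h₃ : 0 ≤ c₀ + 3 / 25 * c₁ + 3 / 250 * c₂ + c₃ / 1250)
    (h₄ : 0 ≤ c₀ + 4 / 25 * c₁ + 6 / 250 * c₂ + 4 / 1250 * c₃ + c₄ / 3125)
    (h₅ : 0 ≤ c₀ + c₁ / 5 + c₂ / 25 + c₃ / 125 + c₄ / 625 + c₅ / 3125) :
    0 ≤ c₀ + c₁ * p + c₂ * p ^ 2 + c₃ * p ^ 3 + c₄ * p ^ 4 + c₅ * p ^ 5 := by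
  obtain ⟨s, hs⟩ : ∃ s, s = 1 - 5 * p := ⟨_, rfl⟩
  have hs0 : 0 ≤ s := by linarith
  have i₀ := mul_nonneg h₀ (pow_nonneg hs0 5)
  have i₁ := mul_nonneg h₁ (mul_nonneg hp0 (pow_nonneg hs0 4))
  have i₂ := mul_nonneg h₂ (mul_nonneg (pow_nonneg hp0 2) (pow_nonneg hs0 3))
  have i₃ := mul_nonneg h₃ (mul_nonneg (pow_nonneg hp0 3) (pow_nonneg hs0 2))
  have i₄ := mul_nonneg h₄ (mul_nonneg (pow_nonneg hp0 4) hs0)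
  have i₅ := mul_nonneg h₅ (pow_nonneg hp0 5)
  rw [hs] at i₀ i₁ i₂ i₃ i₄
  linear_combination i₀ + 25 * i₁ + 250 * i₂ + 1250 * i₃ + 3125 * i₄ + 3125 * i₅

lemma exp_sub_one_sub_le_div {y : ℝ} (hy : 0 ≤ y) (hy1 : y ≤ 1) :
    exp y - 1 - y ≤ y ^ 2 / 2 / (1 - y / 3) - y ^ 4 / 72 := by
  have h := exp_bound' hy hy1 (n := 5) (by norm_num)
  simp [Finset.sum_range_succ, Nat.factorial] at h
  have h3 : 0 < 1 - y / 3 := by linarith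
  have h2 : y ^ 2 / 2 * (1 + y / 3 + y ^ 2 / 9 + y ^ 3 / 27) ≤ y ^ 2 / 2 / (1 - y / 3) := by
    rw [le_div_iff₀ h3]
    have : y ^ 2 / 2 * (1 + y / 3 + y ^ 2 / 9 + y ^ 3 / 27) * (1 - y / 3)
      = y ^ 2 / 2 * (1 - y ^ 4 / 81) := by ring
    rw [this]
    have : 0 ≤ y ^ 4 / 81 := by positivity
    nlinarith [sq_nonneg y]
  have h5 : 0 ≤ y ^ 5 := by positivity
  nlinarith

lemma exists_slack_of_bernstein {p x : ℝ} (hp0 : 0 < p) (hp1 : p ≤ 1 / 5) (hx : 5 / 4 ≤ x) :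
    ∃ E, 0 ≤ E ∧ E ≤ 1 ∧
      E * exp (1 / 2 + (1 - 0.97 * p) * x)
        ≤ 3 / 2 - (3 / 2 + (1 + (1 - 0.97 * p)) * x) * exp (-x) ∧
      9 * p ^ 2 * (1 / 4 + 0.09 * p ^ 2)
        ≤ (1 + 4.67 * p) * (x * (0.02 * p + (1 - p) ^ 2 * p ^ 2 / 4) + E) := by
  have key : ∀ t₀ t₁ e₀ c k : ℝ, 1 ≤ t₀ → 0 < c → t₀ ≤ x → x ≤ t₁ → t₁ ≤ 20 → exp (-t₀) ≤ e₀ →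
      (3 / 2 + 2 * t₀) * e₀ ≤ 3 / 2 → c ≤ expNegLow (1 / 2 + t₁) → 0 ≤ k →
      k ≤ c * (3 / 2 - (3 / 2 + 2 * t₀) * e₀) →
      0 ≤ k + (0.97 * k * t₁ + 4.67 * k + 0.02 * t₀) * p
        + (4.5299 * k * t₁ + 0.3434 * t₀ - 2.25) * p ^ 2 + 0.6675 * t₀ * p ^ 3
        + (-2.085 * t₀ - 0.81) * p ^ 4 + 1.1675 * t₀ * p ^ 5 →
      ∃ E, 0 ≤ E ∧ E ≤ 1 ∧
      E * exp (1 / 2 + (1 - 0.97 * p) * x)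
        ≤ 3 / 2 - (3 / 2 + (1 + (1 - 0.97 * p)) * x) * exp (-x) ∧
      9 * p ^ 2 * (1 / 4 + 0.09 * p ^ 2)
        ≤ (1 + 4.67 * p) * (x * (0.02 * p + (1 - p) ^ 2 * p ^ 2 / 4) + E) := by
    intro t₀ t₁ e₀ c k ht₀ hc h0 h1 ht₁ he he' hc' hk0 hk hp
    have he0 : 0 < e₀ := (exp_pos _).trans_le he
    have hm : 0 ≤ 0.97 * p * t₁ := mul_nonneg (by positivity) (by linarith)
    have hg : c * (1 + 0.97 * p * t₁) ≤ exp (-(1 / 2 + (1 - 0.97 * p) * t₁)) := by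
      have e1 : exp (-(1 / 2 + (1 - 0.97 * p) * t₁))
          = exp (-(1 / 2 + t₁)) * exp (0.97 * p * t₁) := by rw [← exp_add]; congr 1; ring
      rw [e1]
      have e2 := add_one_le_exp (0.97 * p * t₁)
      have e3 := hc'.trans (expNegLow_le (a := 1 / 2 + t₁) (by linarith) (by linarith))
      exact mul_le_mul e3 (by linarith) (by linarith) (exp_pos _).le
    obtain ⟨i1, i2, i3⟩ := tilt_slack (l' := 1 - 0.97 * p) (by linarith) (by linarith) ht₀ h0 h1
      he he' (by positivity) hg
    refine ⟨_, i1, i2, i3, ?_⟩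
    have hE : k * (1 + 0.97 * p * t₁) ≤ c * (1 + 0.97 * p * t₁)
        * (3 / 2 - (3 / 2 + (1 + (1 - 0.97 * p)) * t₀) * e₀) := by
      have e1 : c * (3 / 2 - (3 / 2 + 2 * t₀) * e₀)
          ≤ c * (3 / 2 - (3 / 2 + (1 + (1 - 0.97 * p)) * t₀) * e₀) := by gcongr; linarith
      calc _ ≤ c * (3 / 2 - (3 / 2 + (1 + (1 - 0.97 * p)) * t₀) * e₀) * (1 + 0.97 * p * t₁) := by
            gcongr; exact hk.trans e1
        _ = _ := by ring
    have h2 : (1 + 4.67 * p) * (t₀ * (0.02 * p + (1 - p) ^ 2 * p ^ 2 / 4)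
          + k * (1 + 0.97 * p * t₁))
        ≤ (1 + 4.67 * p) * (x * (0.02 * p + (1 - p) ^ 2 * p ^ 2 / 4)
          + c * (1 + 0.97 * p * t₁) * (3 / 2 - (3 / 2 + (1 + (1 - 0.97 * p)) * t₀) * e₀)) := by
      gcongr
    refine le_trans ?_ h2
    linear_combination hp
  have hexp : ∀ t e : ℝ, 0 ≤ t → 0 < e →
      e⁻¹ ≤ (∑ i ∈ Finset.range 6, (t / 8) ^ i / i.factorial) ^ 8 → exp (-t) ≤ e :=
    fun t e ht he h => exp_neg_le_of_inv_le 7 ht he (h.trans_eq (by norm_num))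
  rcases le_total x 2.14 with hx1 | hx1
  · exact key 1.25 2.14 0.28651 0.0711 0.0251 (by norm_num) (by norm_num) (by linarith) hx1
      (by norm_num)
      (hexp _ _ (by norm_num) (by norm_num) (by norm_num [Finset.sum_range_succ, Nat.factorial]))
      (by norm_num) (by norm_num [expNegLow]) (by norm_num) (by norm_num)
      (nonneg_of_bernstein hp0.le hp1 (by norm_num) (by norm_num) (by norm_num) (by norm_num)
        (by norm_num) (by norm_num))
  rcases le_total x 3.4 with hx2 | hx2
  · exact key 2.14 3.4 0.11766 0.0200 0.0163 (by norm_num) (by norm_num) hx1 hx2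
      (by norm_num)
      (hexp _ _ (by norm_num) (by norm_num) (by norm_num [Finset.sum_range_succ, Nat.factorial]))
      (by norm_num) (by norm_num [expNegLow]) (by norm_num) (by norm_num)
      (nonneg_of_bernstein hp0.le hp1 (by norm_num) (by norm_num) (by norm_num) (by norm_num)
        (by norm_num) (by norm_num))
  rcases le_total x 4.7 with hx3 | hx3
  · exact key 3.4 4.7 0.03338 0.0054 0.0066 (by norm_num) (by norm_num) hx2 hx3
      (by norm_num)
      (hexp _ _ (by norm_num) (by norm_num) (by norm_num [Finset.sum_range_succ, Nat.factorial]))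
      (by norm_num) (by norm_num [expNegLow]) (by norm_num) (by norm_num)
      (nonneg_of_bernstein hp0.le hp1 (by norm_num) (by norm_num) (by norm_num) (by norm_num)
        (by norm_num) (by norm_num))
  · refine ⟨0, le_rfl, by norm_num, ?_, ?_⟩
    · have h9 : exp (-x) ≤ (1 + x + x ^ 2 / 2)⁻¹ := by
        rw [exp_neg]
        exact inv_anti₀ (by positivity) (quadratic_le_exp_of_nonneg (by linarith))
      have h10 : (3 / 2 + (1 + (1 - 0.97 * p)) * x) * exp (-x)
          ≤ (3 / 2 + 2 * x) * (1 + x + x ^ 2 / 2)⁻¹ := by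
        gcongr; linarith
      have h11 : (3 / 2 + 2 * x) * (1 + x + x ^ 2 / 2)⁻¹ ≤ 3 / 2 := by
        rw [← div_eq_mul_inv, div_le_iff₀ (by positivity)]; nlinarith
      linarith
    · have h1 : 0 ≤ 0 + (0.02 * 4.7) * p
        + (0.3434 * 4.7 - 2.25) * p ^ 2 + 0.6675 * 4.7 * p ^ 3
        + (-2.085 * 4.7 - 0.81) * p ^ 4 + 1.1675 * 4.7 * p ^ 5 :=
        nonneg_of_bernstein hp0.le hp1 (by norm_num) (by norm_num) (by norm_num) (by norm_num)
          (by norm_num) (by norm_num)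
      have h2 : (1 + 4.67 * p) * (4.7 * (0.02 * p + (1 - p) ^ 2 * p ^ 2 / 4) + 0)
          ≤ (1 + 4.67 * p) * (x * (0.02 * p + (1 - p) ^ 2 * p ^ 2 / 4) + 0) := by gcongr
      refine le_trans ?_ h2
      linear_combination h1

set_option maxHeartbeats 1000000 in
lemma hasTilt_of_four_thirds_le {q ρ w x A : ℝ} (hρ0 : 0 ≤ ρ) (hρ1 : ρ ≤ 1) (hx : 5 / 4 ≤ x)
    (hw : 4 / 3 ≤ w) (hqw : 4 * (w ^ 2 * x) ≤ q)
    (hA : x * (2 * w + 0.34 + w * ρ / (q + 1) + (1 - ρ) / q + 2 * ρ / (q + 1)) ≤ A) :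
    HasTilt q ρ w x A := by
  obtain ⟨p, hp⟩ : ∃ p, p = 1 / (3 * w + 1) := ⟨_, rfl⟩
  have hw0 : 0 < 3 * w + 1 := by linarith
  have hp0 : 0 < p := by rw [hp]; positivity
  have hp1 : p ≤ 1 / 5 := by rw [hp]; apply one_div_le_one_div_of_le <;> linarith
  have hwp : w = (1 - p) / (3 * p) := by rw [hp]; field_simp; ring
  clear hp
  have h1p : 0 < 1 - p := by linarith
  obtain ⟨δ, hδ⟩ : ∃ δ, δ = (1 - p) ^ 2 * p ^ 2 / 4 := ⟨_, rfl⟩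
  have hδ0 : 0 ≤ δ := by rw [hδ]; positivity
  have hδ1 : δ ≤ 0.05 * p := by
    have : (1 - p) ^ 2 * p ≤ 1 * (1 / 5) := by
      gcongr
      nlinarith
    rw [hδ]; nlinarith
  obtain ⟨l, hl⟩ : ∃ l, l = 1 - p - δ := ⟨_, rfl⟩
  have hl0 : 0.79 ≤ l := by linarith
  have hl1 : l ≤ 1 - p := by linarith
  obtain ⟨E, hE0, hE1, hE, hmain⟩ := exists_slack_of_bernstein hp0 hp1 hx
  have hw2 : 7 / 4 ≤ w ^ 2 := by nlinarith
  have hx0 : 0 < x := by linarith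
  have hq : 8 ≤ q := by nlinarith
  have hq0 : 0 < q := by linarith
  have hxq : x / q ≤ 9 * p ^ 2 / (4 * (1 - p) ^ 2) := by
    have : 9 * p ^ 2 / (4 * (1 - p) ^ 2) = 1 / (4 * w ^ 2) := by rw [hwp]; field_simp; ring
    rw [this, div_le_div_iff₀ hq0 (by positivity)]
    linarith
  have hlxq : l ^ 2 * (x / q) ≤ 9 * p ^ 2 / 4 := by
    calc l ^ 2 * (x / q) ≤ (1 - p) ^ 2 * (9 * p ^ 2 / (4 * (1 - p) ^ 2)) := by gcongr
      _ = _ := by field_simp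
  refine hasTilt_of_le (y := 3 * p) (l := l) (κ := 0.11) (E := E) (l' := 1 - 0.97 * p)
    (by linarith) hρ0 hρ1 (by linarith) (by linarith) hA (by linarith) (by linarith) ?_
    ?_ ?_ (by norm_num) hE0 ?_ ?_ ?_ hE
  · have h1 := exp_sub_one_sub_le_div (y := 3 * p) (by linarith) (by linarith)
    have h2 : 2 * w ^ 2 * (exp (3 * p) - 1 - 3 * p)
        ≤ 2 * w ^ 2 * ((3 * p) ^ 2 / 2 / (1 - 3 * p / 3) - (3 * p) ^ 4 / 72) := by gcongr
    refine h2.trans (le_of_eq ?_)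
    have h3 : 1 - 3 * p / 3 = 1 - p := by ring
    rw [h3, hl, hδ, hwp]
    field_simp
    ring
  · nlinarith [mul_le_mul hl0 hx (by norm_num) (by linarith)]
  · have h1 : (q + 1) / q ≤ 9 / 8 := by rw [div_le_iff₀ hq0]; linarith
    calc (q + 1) / q * (x / q) * (l ^ 2 / 2) * (1 / (3 * p) + 0.355)
        = (q + 1) / q * (l ^ 2 * (x / q)) / 2 * (1 / (3 * p) + 0.355) := by ring
      _ ≤ 9 / 8 * (9 * p ^ 2 / 4) / 2 * (1 / (3 * p) + 0.355) := by gcongr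
      _ = 81 / 64 * (p / 3 + 0.355 * p ^ 2) := by field_simp; ring
      _ ≤ 0.11 := by nlinarith
  · linarith
  · have h1 : (1 + l) ^ 2 / (16 * l) ≤ 1 / 4 + 0.09 * p ^ 2 := by
      rw [div_le_iff₀ (by linarith)]
      have h2 : (1 - l) ^ 2 ≤ (1.05 * p) ^ 2 :=
        pow_le_pow_left₀ (by linarith) (by linarith) 2
      nlinarith [sq_nonneg p]
    have h2 : x * (2 * w + 0.34) - ((1 + l) * x - E) / (3 * p)
        = (x * (0.02 * p + δ) + E) / (3 * p) := by
      rw [hwp, hl]; field_simp; ring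
    have h3 : 2 - 0.11 + w = (1 + 4.67 * p) / (3 * p) := by
      rw [hwp]; field_simp; ring
    have h4 : (1 + l) ^ 2 / (16 * l) / (2 - 0.11 + w)
        ≤ (1 / 4 + 0.09 * p ^ 2) / ((1 + 4.67 * p) / (3 * p)) := by
      rw [h3]; gcongr
    rw [h2]
    refine h4.trans ?_
    rw [div_div_eq_mul_div, div_le_div_iff₀ (by positivity) (by positivity), hδ]
    linear_combination hmain
  · have h1 : x / q ^ 2 = x / q / q := by field_simp
    have h2 : l ^ 2 * (x / q ^ 2) ≤ 9 * p ^ 2 / 4 / 8 := by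
      rw [h1, ← mul_div_assoc]
      gcongr
    nlinarith

lemma cast_pred_mul_le {q : ℕ} {ρ x : ℝ} (hρ : 0 < ρ) (hx : 0 ≤ x) :
    ((q - 1 : ℕ) : ℝ) * (x / (q + ρ)) ≤ x := by
  have h1 : ((q - 1 : ℕ) : ℝ) ≤ q + ρ := by
    have : ((q - 1 : ℕ) : ℝ) ≤ q := by exact_mod_cast Nat.sub_le q 1
    linarith
  have h0 : 0 < (q : ℝ) + ρ := by positivity
  rw [← mul_div_assoc, div_le_iff₀ h0]
  nlinarith

section deviation

variable {Ω : Type*} [MeasurableSpace Ω] {P : Measure Ω} [IsProbabilityMeasure P]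
  {𝒳 : Type*} [MeasurableSpace 𝒳] {X : ℕ → Ω → 𝒳} {f : 𝒳 → ℝ}

lemma measureReal_le_exp_neg_of_small (hXmeas : ∀ t, Measurable (X t)) (hf : Measurable f)
    (hf_bdd : ∀ y, |f y| ≤ 1 / 2) {k q r : ℕ} {v x a : ℝ} (hk : 1 ≤ k) (hr : 1 ≤ r)
    (hrk : r ≤ k) (hx : 0 < x) (hx1 : x ≤ 3 / 8)
    (hdom : HasBlockDomination P X (fun y => -f y) (q * k + r) k (k * (x / (q + r / k))))
    (hmean : ∫ ω, blockSum X f 0 (q * k + r) ω ∂P = 0)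
    (h0k : ∫ y, y ∂(P.map (blockSum X (fun y => -f y) 0 k)) = 0)
    (hv : ∫ y, y ^ 2 ∂(P.map (blockSum X (fun y => -f y) 0 k)) = v) (hv0 : 0 ≤ v)
    (ha : a = k * (2 * √((q + r / k) * (v / k ^ 2) * x) + 1.34 * x)) :
    P.real {ω | a ≤ blockSum X f 0 (q * k + r) ω} ≤ exp (-x) := by
  have hk0 : (0 : ℝ) < k := by exact_mod_cast hk
  have hr0 : (0 : ℝ) < r := by exact_mod_cast hr
  have hρ1 : (r : ℝ) / k ≤ 1 := by rw [div_le_one hk0]; exact_mod_cast hrk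
  have hρ0 : (0 : ℝ) < r / k := by positivity
  have hm := measurable_blockSum hXmeas hf 0 (q * k + r)
  obtain ⟨E, hE⟩ : ∃ E, E = {ω | a ≤ blockSum X f 0 (q * k + r) ω} := ⟨_, rfl⟩
  have hEm : MeasurableSet E := by rw [hE]; exact measurableSet_le measurable_const hm
  have hint : Integrable (blockSum X f 0 (q * k + r)) P :=
    Integrable.of_bound hm.aestronglyMeasurable _
      (ae_of_all _ fun ω => abs_blockSum_le hf_bdd 0 (q * k + r) ω)
  have h1 : a * P.real E ≤ ∫ ω in E, blockSum X f 0 (q * k + r) ω ∂P := by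
    have : ∫ _ in E, a ∂P ≤ ∫ ω in E, blockSum X f 0 (q * k + r) ω ∂P :=
      setIntegral_mono_on (integrable_const a).integrableOn hint.integrableOn hEm
        fun ω hω => by rw [hE] at hω; exact hω
    simpa [mul_comm] using this
  have h2 := integral_add_compl hEm hint
  rw [hmean] at h2
  have h3 := setIntegral_blockSum_le (f := fun y => -f y) hXmeas hf.neg (by simpa using hf_bdd) hk
    (by positivity)
    hdom h0k hv Eᶜ
  have h4 : ∫ ω in Eᶜ, blockSum X (fun y => -f y) 0 (q * k + r) ω ∂P
      = -∫ ω in Eᶜ, blockSum X f 0 (q * k + r) ω ∂P := by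
    rw [← integral_neg]
    simp [blockSum]
  rw [h4, probReal_compl_eq_one_sub hEm] at h3
  rw [← hE]
  have hp1 : P.real E ≤ 1 := measureReal_le_one
  have hp0 : 0 ≤ P.real E := measureReal_nonneg
  refine le_exp_neg_of_small hx hx1 hp1 (W := q * v / k ^ 2) (by positivity) ?_
  refine le_of_mul_le_mul_left ?_ hk0
  have h5 : √(q * v / k ^ 2 * x) ≤ √((q + r / k) * (v / k ^ 2) * x) := by
    apply sqrt_le_sqrt
    rw [mul_div_assoc]
    gcongr
    linarith
  have h6 : √(2 * (q * v / k ^ 2)) = √(2 * q * v) / k := by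
    rw [← mul_div_assoc, sqrt_div (by positivity), sqrt_sq hk0.le, mul_assoc]
  have h7 : (r : ℝ) / 2 + ((q - 1 : ℕ) : ℝ) * (k * (x / (q + r / k))) ≤ k * (1 / 2 + x) := by
    have h8 := mul_le_mul_of_nonneg_left (cast_pred_mul_le (q := q) hρ0 hx.le) hk0.le
    have h9 : (r : ℝ) ≤ k := by exact_mod_cast hrk
    linarith
  calc (k : ℝ) * ((2 * √(q * v / k ^ 2 * x) + 1.34 * x) * P.real E)
      ≤ k * ((2 * √((q + r / k) * (v / k ^ 2) * x) + 1.34 * x) * P.real E) := by gcongr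
    _ = a * P.real E := by rw [ha]; ring
    _ ≤ -∫ ω in Eᶜ, blockSum X f 0 (q * k + r) ω ∂P := by linarith
    _ ≤ √(2 * q * v) * √(1 - P.real E) + k * (1 / 2 + x) * (1 - P.real E) := by
        refine h3.trans ?_
        gcongr
    _ = _ := by rw [h6]; field_simp

lemma measureReal_le_exp_neg_of_cantelli (hXmeas : ∀ t, Measurable (X t)) (hf : Measurable f)
    (hf_bdd : ∀ y, |f y| ≤ 1 / 2) {k q r : ℕ} {ε v a x w c A : ℝ} (hk : 1 ≤ k) (hr : 1 ≤ r)
    (hrk : r ≤ k) (hq : 1 ≤ q) (hε : 0 ≤ ε) (hdom : HasBlockDomination P X f (q * k + r) k ε)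
    (h0k : ∫ y, y ∂(P.map (blockSum X f 0 k)) = 0)
    (h0r : ∫ y, y ∂(P.map (blockSum X f 0 r)) = 0)
    (hv : ∫ y, y ^ 2 ∂(P.map (blockSum X f 0 k)) = v)
    (hx : 0 < x) (hw : 0 ≤ w) (hc : 0 ≤ c) (hqw : q * v / k ^ 2 = w ^ 2 * x)
    (hexp : exp x - 1 ≤ 2 * c ^ 2 * x) (hcond : 2 * (c - 1) * x * w + c ^ 2 / 8 ≤ 0.34 * x)
    (hA0 : 0 < A) (haA : a - ((q - 1 : ℕ) : ℝ) * ε = k * A)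
    (hA : x * (2 * w + 0.34 + w * (r / k) / (q + 1) + (1 - r / k) / q + 2 * (r / k) / (q + 1))
      ≤ A) :
    P.real {ω | a ≤ blockSum X f 0 (q * k + r) ω} ≤ exp (-x) := by
  have hk0 : (0 : ℝ) < k := by exact_mod_cast hk
  have hρ1 : (r : ℝ) / k ≤ 1 := by rw [div_le_one hk0]; exact_mod_cast hrk
  have hq1 : (1 : ℝ) ≤ q := by exact_mod_cast hq
  have h1 := measureReal_le_cantelli hXmeas hf hf_bdd hk hr hrk hε hdom h0k h0r hv
    (a := a) (by rw [haA]; positivity)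
  have h2 : √(2 * q * v) + r / √(2 * (q + 1))
      = k * (√(2 * (w ^ 2 * x)) + r / k / √(2 * (q + 1))) := by
    rw [← hqw, ← mul_div_assoc, sqrt_div' _ (by positivity), sqrt_sq hk0.le, mul_assoc]
    field_simp
  have h3 := sqrt_mul_le_threshold hq1 (by positivity) hρ1 hx hw hc hexp hcond hA
  refine div_add_sq_le_exp_neg hx.le (by positivity) hA0 h3 (h1.trans (le_of_eq ?_))
  rw [h2, haA, mul_pow, mul_pow, ← mul_add, mul_div_mul_left _ _ (by positivity)]

lemma measureReal_le_exp_neg_of_hasTilt (hXmeas : ∀ t, Measurable (X t)) (hf : Measurable f)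
    (hf_bdd : ∀ y, |f y| ≤ 1 / 2) {k q r : ℕ} {ε v a x w A : ℝ} (hk : 1 ≤ k) (hr : 1 ≤ r)
    (hrk : r ≤ k) (hq : 1 ≤ q) (hε : 0 ≤ ε) (hdom : HasBlockDomination P X f (q * k + r) k ε)
    (h0k : ∫ y, y ∂(P.map (blockSum X f 0 k)) = 0)
    (h0r : ∫ y, y ∂(P.map (blockSum X f 0 r)) = 0)
    (hv : ∫ y, y ^ 2 ∂(P.map (blockSum X f 0 k)) = v)
    (hqw : q * v / k ^ 2 = w ^ 2 * x) (haA : a - ((q - 1 : ℕ) : ℝ) * ε = k * A) (hA0 : 0 < A)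
    (h : HasTilt q (r / k) w x A) :
    P.real {ω | a ≤ blockSum X f 0 (q * k + r) ω} ≤ exp (-x) := by
  have hk0 : (0 : ℝ) < k := by exact_mod_cast hk
  obtain ⟨y, L, u, hy, hL, hu, h1, h2, h3, h4⟩ := h
  have h5 : (a - ((q - 1 : ℕ) : ℝ) * ε) / k = A := by rw [haA]; field_simp
  have h6 := measureReal_mul_le_exp hXmeas hf hf_bdd hk hr hrk hq hε hdom h0k h0r hv hy hL
    (a := a) (by rwa [hqw]) hu h2 (by rw [h5]; linarith)
  rw [h5] at h6
  have h7 : 0 < exp (1 / 2 + u * A) - 3 / 2 - u * A := by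
    have := add_one_lt_exp (x := 1 / 2 + u * A) (by positivity)
    linarith
  exact le_of_mul_le_mul_right (h6.trans h4) h7

lemma measureReal_le_exp_neg (hXmeas : ∀ t, Measurable (X t)) (hf : Measurable f)
    (hf_bdd : ∀ y, |f y| ≤ 1 / 2) {k q r : ℕ} {v x a : ℝ} (hk : 1 ≤ k) (hr : 1 ≤ r)
    (hrk : r ≤ k) (hx : 3 / 8 ≤ x)
    (hdom : HasBlockDomination P X f (q * k + r) k (k * (x / (q + r / k))))
    (h0k : ∫ y, y ∂(P.map (blockSum X f 0 k)) = 0)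
    (h0r : ∫ y, y ∂(P.map (blockSum X f 0 r)) = 0)
    (hv : ∫ y, y ^ 2 ∂(P.map (blockSum X f 0 k)) = v) (hv0 : 0 ≤ v) (hvk : v ≤ k ^ 2 / 4)
    (ha : a = k * (2 * √((q + r / k) * (v / k ^ 2) * x) + 1.34 * x)) :
    P.real {ω | a ≤ blockSum X f 0 (q * k + r) ω} ≤ exp (-x) := by
  have hk0 : (0 : ℝ) < k := by exact_mod_cast hk
  have hr0 : (0 : ℝ) < r := by exact_mod_cast hr
  have hx0 : 0 < x := by linarith
  have hρ1 : (r : ℝ) / k ≤ 1 := by rw [div_le_one hk0]; exact_mod_cast hrk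
  have hρ0 : (0 : ℝ) < r / k := by positivity
  rcases lt_or_ge ((q + r / k : ℝ) / 2) (1.34 * x) with hlarge | hsmall
  · have : {ω | a ≤ blockSum X f 0 (q * k + r) ω} = ∅ := by
      refine Set.eq_empty_of_forall_notMem fun ω (hω : a ≤ _) => ?_
      have h1 := (abs_le.1 (abs_blockSum_le (X := X) hf_bdd 0 (q * k + r) ω)).2
      have h2 : ((q * k + r : ℕ) : ℝ) / 2 < k * (1.34 * x) := by
        refine lt_of_eq_of_lt ?_ (mul_lt_mul_of_pos_left hlarge hk0)
        push_cast; field_simp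
      have h3 : k * (1.34 * x) ≤ a := by
        rw [ha]; gcongr; linarith [sqrt_nonneg (((q : ℝ) + r / k) * (v / k ^ 2) * x)]
      linarith
    rw [this, measureReal_empty]
    exact (exp_pos _).le
  have hqx : 2.68 * x ≤ (q : ℝ) + 1 := by linarith
  have hq : 1 ≤ q := by
    have : (0 : ℝ) < q := by linarith
    exact_mod_cast this
  have hq1 : (1 : ℝ) ≤ q := by exact_mod_cast hq
  obtain ⟨w, hw⟩ : ∃ w, w = √(q * v / k ^ 2 / x) := ⟨_, rfl⟩
  have hw0 : 0 ≤ w := hw ▸ sqrt_nonneg _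
  have hqw : q * v / k ^ 2 = w ^ 2 * x := by
    rw [hw, sq_sqrt (by positivity)]; field_simp
  have hqw4 : 4 * (w ^ 2 * x) ≤ q := by
    rw [← hqw, ← mul_div_assoc, div_le_iff₀ (by positivity)]
    nlinarith
  obtain ⟨A, hA'⟩ : ∃ A, A = 2 * √((q + r / k) * (v / k ^ 2) * x) + 1.34 * x
    - (q - 1) * (x / (q + r / k)) := ⟨_, rfl⟩
  have hA : x * (2 * w + 0.34 + w * (r / k) / (q + 1) + (1 - r / k) / q + 2 * (r / k) / (q + 1))
      ≤ A := by
    rw [hA']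
    exact threshold_ge hq1 hρ0.le hρ1 hx0.le (by rw [← hqw, mul_div_assoc])
  have hA0 : 0 < A := by
    refine lt_of_lt_of_le ?_ hA
    have : 0 ≤ 1 - (r : ℝ) / k := by linarith
    positivity
  have hε : 0 ≤ (k : ℝ) * (x / (q + r / k)) := by positivity
  have haA : a - ((q - 1 : ℕ) : ℝ) * (k * (x / (q + r / k))) = k * A := by
    rw [ha, hA', Nat.cast_sub hq]; push_cast; ring
  have cantelli : ∀ c : ℝ, 0 ≤ c → exp x - 1 ≤ 2 * c ^ 2 * x →
      2 * (c - 1) * x * w + c ^ 2 / 8 ≤ 0.34 * x →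
      P.real {ω | a ≤ blockSum X f 0 (q * k + r) ω} ≤ exp (-x) := fun c hc hexp hcond =>
    measureReal_le_exp_neg_of_cantelli hXmeas hf hf_bdd hk hr hrk hq hε hdom h0k h0r hv hx0 hw0 hc
      hqw hexp hcond hA0 haA hA
  have tilt : HasTilt q (r / k) w x A →
      P.real {ω | a ≤ blockSum X f 0 (q * k + r) ω} ≤ exp (-x) :=
    measureReal_le_exp_neg_of_hasTilt hXmeas hf hf_bdd hk hr hrk hq hε hdom h0k h0r hv hqw haA hA0
  rcases le_total x (5 / 4) with hx1 | hx1
  · refine cantelli 1 zero_le_one ?_ (by linarith)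
    refine exp_sub_one_le_mul hx0.le hx1 (by norm_num) ?_
    refine exp_le_of_inv_le 19 (by norm_num) (by norm_num) (by norm_num) ?_
    norm_num
  rcases le_total (4 / 3) w with hw1 | hw1
  · exact tilt (hasTilt_of_four_thirds_le hρ0.le hρ1 hx1 hw1 hqw4 hA)
  rcases le_total x (3 / 2) with hx2 | hx2
  · refine cantelli 1.0775 (by norm_num) ?_ (by nlinarith)
    refine exp_sub_one_le_mul hx0.le hx2 (by norm_num) ?_
    refine exp_le_of_inv_le 19 (by norm_num) (by norm_num) (by norm_num) ?_
    norm_num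
  · have hq4 : (4 : ℝ) ≤ q := by
      have : (3 : ℝ) < q := by linarith
      exact_mod_cast this
    exact tilt (TiltRange.hasTilt_of_le ⟨hq4, hρ0.le, hρ1, hx2, hqx, hA⟩ hw0 (by linarith))

end deviation

lemma blockSum_neg {Ω 𝒳 : Type*} (X : ℕ → Ω → 𝒳) (f : 𝒳 → ℝ) (s l : ℕ) :
    blockSum X (fun y => -f y) s l = -blockSum X f s l := by
  ext ω
  simp [blockSum]

lemma sum_Icc_eq_blockSum {Ω 𝒳 : Type*} (X : ℕ → Ω → 𝒳) (f : 𝒳 → ℝ) (l : ℕ) :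
    (fun ω => ∑ i ∈ Finset.Icc 1 l, f (X i ω)) = blockSum X f 0 l := by
  ext ω
  rw [blockSum, ← Finset.Ico_succ_right_eq_Icc, Finset.sum_Ico_eq_sum_range]
  simp

lemma exists_eq_mul_add {n k : ℕ} (hk : 1 ≤ k) (hn : 1 ≤ n) :
    ∃ q r : ℕ, 1 ≤ r ∧ r ≤ k ∧ n = q * k + r := by
  refine ⟨(n - 1) / k, (n - 1) % k + 1, by omega, Nat.mod_lt _ hk, ?_⟩
  have := Nat.div_add_mod' (n - 1) k
  omega

/-- **Theorem 5.1, second part (Bernstein-type inequality under an L^∞ coupling scheme).**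
Under condition (cl), for `f ∈ 𝓕` centered and `x ≥ 0`, with `k*'` the minimum of the
(nonempty) set `{1 ≤ k ≤ n : n δ'_k ≤ k x}`,
`ℙ(S(f) ≥ 2 √(n σ_{k*'}²(f) x) + 1.34 k*' x) ≤ e^{−x}`. -/
theorem bernstein_deviation_coupling
    {Ω : Type*} [MeasurableSpace Ω] (P : Measure Ω) [IsProbabilityMeasure P]
    -- case (A): 𝒳 Polish with diameter at most 1
    {𝒳 : Type*} [MetricSpace 𝒳] [PolishSpace 𝒳] [MeasurableSpace 𝒳] [BorelSpace 𝒳]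
    (hdiam : ∀ y z : 𝒳, dist y z ≤ 1)
    (X : ℕ → Ω → 𝒳) (hXmeas : ∀ t, Measurable (X t))
    -- strict stationarity: the law of (X_{1+k},…,X_{m+k}) equals the law of (X_1,…,X_m)
    (hstat : ∀ m k : ℕ,
      Measure.map (fun ω => fun i : Fin m => X (1 + k + i) ω) P
        = Measure.map (fun ω => fun i : Fin m => X (1 + i) ω) P)
    (n : ℕ) (hn : 1 ≤ n)
    -- condition (cl): an L^∞ coupling scheme with rates (δ'_r)
    (δ' : ℕ → ℝ)
    (hcl : ∀ r j : ℕ, 1 ≤ r → 1 ≤ j → 2 * r + j ≤ n + 1 →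
      ∃ Xstar : Fin r → Ω → 𝒳,
        Measure.map (fun ω => fun i : Fin r => Xstar i ω) P
          = Measure.map (fun ω => fun i : Fin r => X (r + j + i) ω) P ∧
        Indep (MeasurableSpace.comap (fun ω => fun i : Fin r => Xstar i ω) inferInstance)
          (⨆ t ∈ Set.Icc 1 j, MeasurableSpace.comap (X t) inferInstance) P ∧
        (∀ᵐ ω ∂P, ∑ i : Fin r, dist (X (r + j + i) ω) (Xstar i ω) ≤ (r : ℝ) * δ' r))
    -- f ∈ 𝓕, centered
    (f : 𝒳 → ℝ) (hf_lip : LipschitzWith 1 f) (hf_bdd : ∀ y, |f y| ≤ 1 / 2)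
    (hf_mean : ∫ ω, f (X 1 ω) ∂P = 0)
    (σ2 : ℕ → ℝ)
    (hσ2 : ∀ m, σ2 m = (m : ℝ)⁻¹ * variance (fun ω => ∑ i ∈ Finset.Icc 1 m, f (X i ω)) P)
    (x : ℝ) (hx : 0 ≤ x)
    (hne : {k : ℕ | k ∈ Set.Icc 1 n ∧ (n : ℝ) * δ' k ≤ (k : ℝ) * x}.Nonempty)
    (kstar' : ℕ)
    (hkstar' : kstar' = sInf {k : ℕ | k ∈ Set.Icc 1 n ∧ (n : ℝ) * δ' k ≤ (k : ℝ) * x}) :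
    P {ω | 2 * Real.sqrt ((n : ℝ) * σ2 kstar' * x) + 1.34 * (kstar' : ℝ) * x
        ≤ ∑ i ∈ Finset.Icc 1 n, f (X i ω)}
      ≤ ENNReal.ofReal (Real.exp (-x)) := by
  have hf := hf_lip.continuous.measurable
  have hmem : kstar' ∈ {k : ℕ | k ∈ Set.Icc 1 n ∧ (n : ℝ) * δ' k ≤ (k : ℝ) * x} :=
    hkstar' ▸ Nat.sInf_mem hne
  clear hkstar' hne
  obtain ⟨⟨hk, -⟩, hδ⟩ := hmem
  rw [show {ω | 2 * √((n : ℝ) * σ2 kstar' * x) + 1.34 * (kstar' : ℝ) * x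
    ≤ ∑ i ∈ Finset.Icc 1 n, f (X i ω)} = {ω | 2 * √((n : ℝ) * σ2 kstar' * x)
      + 1.34 * (kstar' : ℝ) * x ≤ blockSum X f 0 n ω} by rw [← sum_Icc_eq_blockSum],
    ENNReal.le_ofReal_iff_toReal_le (measure_ne_top _ _) (exp_pos _).le]
  change P.real _ ≤ _
  rw [hσ2, sum_Icc_eq_blockSum]
  obtain ⟨q, r, hr, hrk, rfl⟩ := exists_eq_mul_add hk hn
  obtain ⟨v, hv⟩ : ∃ v, v = variance (blockSum X f 0 kstar') P := ⟨_, rfl⟩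
  have hk0 : (0 : ℝ) < kstar' := by exact_mod_cast hk
  have hr0 : (0 : ℝ) < r := by exact_mod_cast hr
  have hv0 : 0 ≤ v := hv ▸ variance_nonneg _ _
  have hvk : v ≤ (kstar' : ℝ) ^ 2 / 4 := by
    have := variance_le_sq_of_bounded (μ := P) (X := blockSum X f 0 kstar')
      (a := -((kstar' : ℝ) / 2)) (b := kstar' / 2)
      (ae_of_all _ fun ω => abs_le.1 (abs_blockSum_le hf_bdd 0 kstar' ω))
      (measurable_blockSum hXmeas hf 0 kstar').aemeasurable
    rw [hv]
    refine this.trans (le_of_eq ?_)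
    ring
  have hε : (kstar' : ℝ) * δ' kstar' ≤ kstar' * (x / (q + r / kstar')) := by
    gcongr
    rw [le_div_iff₀ (by positivity)]
    refine le_of_mul_le_mul_left (le_of_eq_of_le ?_ hδ) hk0
    push_cast
    field_simp
  rw [← hv, show 2 * √(((q * kstar' + r : ℕ) : ℝ) * ((kstar' : ℝ)⁻¹ * v) * x) + 1.34 * kstar' * x
    = kstar' * (2 * √((q + r / kstar') * (v / kstar' ^ 2) * x) + 1.34 * x) by
      have : ((q * kstar' + r : ℕ) : ℝ) * ((kstar' : ℝ)⁻¹ * v) * x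
          = kstar' ^ 2 * ((q + r / kstar') * (v / kstar' ^ 2) * x) := by
        push_cast
        field_simp
      rw [this, sqrt_mul (by positivity), sqrt_sq hk0.le]
      ring]
  have h0 := integral_map_blockSum hXmeas hf hf_bdd hstat hf_mean
  have hsq := integral_sq_map_blockSum hXmeas hf hf_bdd hstat hf_mean kstar'
  have hf_bdd' : ∀ y, |-f y| ≤ 1 / 2 := by simpa using hf_bdd
  have hf_mean' : ∫ ω, -f (X 1 ω) ∂P = 0 := by rw [integral_neg, hf_mean, neg_zero]
  rcases hx.eq_or_lt with rfl | hx0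
  · simp
  rcases le_total x (3 / 8) with hx1 | hx1
  · refine measureReal_le_exp_neg_of_small hXmeas hf hf_bdd hk hr hrk hx0 hx1
      (fun l hl hlk s m hs hsn g hg => lintegral_chain_le hXmeas hf_lip.neg hstat hcl hk hl hlk hε
        s m hs hsn g hg) ?_
      (integral_map_blockSum hXmeas hf.neg hf_bdd' hstat hf_mean' _) ?_ hv0 rfl
    · exact (integral_map (f := fun y : ℝ => y) (measurable_blockSum hXmeas hf _ _).aemeasurable
        aestronglyMeasurable_id).symm.trans (h0 _)
    · refine (integral_sq_map_blockSum hXmeas hf.neg hf_bdd' hstat hf_mean' _).trans ?_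
      rw [hv]
      exact (congrArg (fun Y => variance Y P) (blockSum_neg X f 0 kstar')).trans
        (variance_neg ..)
  · exact measureReal_le_exp_neg hXmeas hf hf_bdd hk hr hrk hx1
      (fun l hl hlk s m hs hsn g hg => lintegral_chain_le hXmeas hf_lip hstat hcl hk hl hlk hε
        s m hs hsn g hg) (h0 _) (h0 _) (hsq.trans hv.symm) hv0 hvk rfl
end

section
/- Let g : 𝒳^n → ℝ satisfy |g(x_1,…,x_n) − g(y_1,…,y_n)| ≤ Σ_{i=1}^n d(x_i, y_i) for all x, y ∈ 𝒳^n and 𝔼 g(X_1,…,X_n) = 0, and suppose the coefficients φ_j = φ(𝓜_j, (X_{j+1},…,X_n)) are finite for 1 ≤ j ≤ n − 1. Then for all x ≥ 0, ℙ( g(X_1,…,X_n) ≥ √( (1/2) Σ_{j=1}^n (1 + 2(n−j) φ_j)² · x ) ) ≤ e^{−x}, where the j = n summand is taken equal to 1. -/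
open MeasureTheory ProbabilityTheory Real
open scoped ENNReal

/-- Hoeffding's lemma for the centered distribution on the two points `a ≤ 0 ≤ b`. -/
lemma two_point_mgf_le {a b : ℝ} (s : ℝ) (ha : a ≤ 0) (hb : 0 ≤ b) (hab : a < b) :
    (b * exp (s * a) - a * exp (s * b)) / (b - a) ≤ exp (s ^ 2 * (b - a) ^ 2 / 8) := by
  have hd : 0 < b - a := sub_pos.2 hab
  have hp : 0 ≤ b / (b - a) := by positivity
  have hq : 0 ≤ -a / (b - a) := div_nonneg (by linarith) hd.le
  let μ : Measure ℝ := ENNReal.ofReal (b / (b - a)) • Measure.dirac a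
    + ENNReal.ofReal (-a / (b - a)) • Measure.dirac b
  have hμ : IsProbabilityMeasure μ := ⟨by
    simp only [μ, Measure.add_apply, Measure.smul_apply, measure_univ, smul_eq_mul, mul_one]
    rw [← ENNReal.ofReal_add hp hq, ← ENNReal.ofReal_one]
    congr 1
    field_simp
    ring⟩
  have hint (f : ℝ → ℝ) : ∫ y, f y ∂μ = b / (b - a) * f a + -a / (b - a) * f b := by
    have h (z r : ℝ) : Integrable f (ENNReal.ofReal r • Measure.dirac z) :=
      (integrable_dirac (by simp)).smul_measure ENNReal.ofReal_ne_top
    rw [integral_add_measure (h _ _) (h _ _)]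
    simp [ENNReal.toReal_ofReal hp, ENNReal.toReal_ofReal hq]
  have hbd : ∀ᵐ y ∂μ, id y ∈ Set.Icc a b := by
    refine ae_add_measure_iff.2 ⟨?_, ?_⟩ <;> refine Measure.ae_smul_measure ?_ _ <;>
      simp [ae_dirac_eq, hab.le]
  have h0 : ∫ y, id y ∂μ = 0 := by
    rw [hint]
    simp only [id]
    field_simp
    ring
  have key := (hasSubgaussianMGF_of_mem_Icc_of_integral_eq_zero
    aemeasurable_id hbd h0).mgf_le s
  rw [mgf, hint] at key
  calc _ = b / (b - a) * exp (s * a) + -a / (b - a) * exp (s * b) := by ring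
    _ ≤ _ := key
    _ = _ := by
      congr 1
      simp only [NNReal.coe_pow, NNReal.coe_div, coe_nnnorm, Real.norm_eq_abs, abs_of_pos hd,
        NNReal.coe_ofNat]
      ring

/-- Conditional Hoeffding lemma for a random variable with conditional mean zero which lies between
an `m`-measurable variable `A` and `A + c`. -/
lemma integral_mul_exp_le_of_condExp_eq_zero {Ω : Type*} {m m₀ : MeasurableSpace Ω} (hm : m ≤ m₀)
    {μ : Measure Ω} [IsProbabilityMeasure μ] {Z Y A : Ω → ℝ} {c R : ℝ} (s : ℝ)
    (hZ : StronglyMeasurable[m] Z) (hZ0 : ∀ ω, 0 ≤ Z ω) (hZR : ∀ᵐ ω ∂μ, Z ω ≤ R)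
    (hY : Integrable Y μ) (hYm : μ[Y | m] =ᵐ[μ] 0)
    (hA : StronglyMeasurable[m] A) (hc : 0 < c)
    (hAY : ∀ᵐ ω ∂μ, A ω ≤ Y ω ∧ Y ω ≤ A ω + c) :
    ∫ ω, Z ω * exp (s * Y ω) ∂μ ≤ exp (s ^ 2 * c ^ 2 / 8) * ∫ ω, Z ω ∂μ := by
  have hAi : Integrable A μ := by
    refine (hY.abs.add (integrable_const c)).mono' (hA.mono hm).aestronglyMeasurable ?_
    filter_upwards [hAY] with ω h
    simp only [Pi.add_apply, Real.norm_eq_abs]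
    exact abs_le.2 ⟨by linarith [neg_abs_le (Y ω)], by linarith [le_abs_self (Y ω)]⟩
  have hA0 : ∀ᵐ ω ∂μ, A ω ≤ 0 := by
    have h := condExp_mono (m := m) hAi hY (hAY.mono fun _ h => h.1)
    rw [condExp_of_stronglyMeasurable hm hA hAi] at h
    filter_upwards [h, hYm] with ω h1 h2
    simpa [h2] using h1
  have hAc : ∀ᵐ ω ∂μ, 0 ≤ A ω + c := by
    have hi : Integrable (fun ω => A ω + c) μ := hAi.add (integrable_const c)
    have h := condExp_mono (m := m) hY hi (hAY.mono fun _ h => h.2)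
    rw [condExp_of_stronglyMeasurable hm
      (show StronglyMeasurable[m] fun ω => A ω + c from hA.add stronglyMeasurable_const) hi] at h
    filter_upwards [h, hYm] with ω h1 h2
    simpa [h2] using h1
  let β : Ω → ℝ := fun ω => (exp (s * (A ω + c)) - exp (s * A ω)) / c
  have hβ : StronglyMeasurable[m] β := by
    have h1 : StronglyMeasurable[m] fun ω => exp (s * (A ω + c)) :=
      continuous_exp.comp_stronglyMeasurable
        ((hA.add stronglyMeasurable_const).const_mul s)
    have h2 : StronglyMeasurable[m] fun ω => exp (s * A ω) :=
      continuous_exp.comp_stronglyMeasurable (hA.const_mul s)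
    simpa only [β, div_eq_inv_mul] using! (h1.sub h2).const_mul c⁻¹
  have hexp {u : ℝ} (hu : |u| ≤ c) : |exp (s * u)| ≤ exp (|s| * c) := by
    rw [abs_of_pos (exp_pos _), exp_le_exp]
    calc s * u ≤ |s * u| := le_abs_self _
      _ = |s| * |u| := abs_mul _ _
      _ ≤ |s| * c := by gcongr
  have hZβ : StronglyMeasurable[m] fun ω => Z ω * β ω := hZ.mul hβ
  have hZβi : Integrable ((fun ω => Z ω * β ω) * Y) μ := by
    refine hY.bdd_mul (c := R * ((exp (|s| * c) + exp (|s| * c)) / c))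
      (hZβ.mono hm).aestronglyMeasurable ?_
    filter_upwards [hZR, hA0, hAc] with ω h1 h2 h3
    rw [norm_mul, Real.norm_of_nonneg (hZ0 ω)]
    have hb : ‖β ω‖ ≤ (exp (|s| * c) + exp (|s| * c)) / c := by
      simp only [β, norm_div, Real.norm_eq_abs, abs_of_pos hc]
      gcongr
      refine (abs_sub _ _).trans (add_le_add (hexp ?_) (hexp ?_)) <;> rw [abs_le] <;>
        constructor <;> linarith
    exact mul_le_mul h1 hb (norm_nonneg _) ((hZ0 ω).trans h1)
  have hzero : ∫ ω, ((fun ω => Z ω * β ω) * Y) ω ∂μ = 0 := by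
    rw [← integral_condExp hm]
    refine integral_eq_zero_of_ae ?_
    filter_upwards [condExp_mul_of_stronglyMeasurable_left hZβ hZβi hY, hYm] with ω h1 h2
    rw [h1]
    simp [h2]
  have hZi : Integrable Z μ := by
    refine .of_bound (hZ.mono hm).aestronglyMeasurable R (hZR.mono fun ω h => ?_)
    rwa [Real.norm_of_nonneg (hZ0 ω)]
  calc ∫ ω, Z ω * exp (s * Y ω) ∂μ
      ≤ ∫ ω, exp (s ^ 2 * c ^ 2 / 8) * Z ω + ((fun ω => Z ω * β ω) * Y) ω ∂μ := by
        refine integral_mono_of_nonneg (.of_forall fun ω => mul_nonneg (hZ0 ω) (exp_pos _).le)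
          ((hZi.const_mul _).add hZβi) ?_
        filter_upwards [hAY, hA0, hAc] with ω h h0 hc0
        have hchord : exp (s * Y ω) ≤
            ((A ω + c) * exp (s * A ω) - A ω * exp (s * (A ω + c))) / c + β ω * Y ω := by
          have := convexOn_exp.2 (Set.mem_univ (s * A ω)) (Set.mem_univ (s * (A ω + c)))
            (show 0 ≤ (A ω + c - Y ω) / c from div_nonneg (by linarith) hc.le)
            (show 0 ≤ (Y ω - A ω) / c from div_nonneg (by linarith) hc.le)
            (by field_simp; ring)
          simp only [smul_eq_mul] at this
          have e : (A ω + c - Y ω) / c * (s * A ω) + (Y ω - A ω) / c * (s * (A ω + c))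
              = s * Y ω := by field_simp; ring
          rw [e] at this
          refine this.trans_eq ?_
          simp only [β]
          field_simp
          ring
        have h2 := two_point_mgf_le s h0 hc0 (by linarith)
        rw [add_sub_cancel_left] at h2
        simp only [Pi.mul_apply]
        calc Z ω * exp (s * Y ω) ≤ Z ω * (exp (s ^ 2 * c ^ 2 / 8) + β ω * Y ω) :=
              mul_le_mul_of_nonneg_left (hchord.trans (by gcongr)) (hZ0 ω)
          _ = _ := by ring
    _ = exp (s ^ 2 * c ^ 2 / 8) * ∫ ω, Z ω ∂μ := by
        rw [integral_add (hZi.const_mul _) hZβi, hzero, add_zero, integral_const_mul]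

/-- Azuma–Hoeffding bound for the Laplace transform of a Doob martingale whose increments have
conditional range at most `c k`. -/
lemma integral_exp_condExp_le {Ω : Type*} {m₀ : MeasurableSpace Ω} {μ : Measure Ω}
    [IsProbabilityMeasure μ] {M : ℕ → MeasurableSpace Ω} (hM : Monotone M) (hM₀ : ∀ k, M k ≤ m₀)
    {f : Ω → ℝ} {R : ℝ} (hfR : ∀ ω, |f ω| ≤ R)
    (h0 : μ[f | M 0] =ᵐ[μ] 0) {n : ℕ} {c : ℕ → ℝ} (hc : ∀ k < n, 0 < c k)
    (hrange : ∀ k < n, ∃ A : Ω → ℝ, StronglyMeasurable[M k] A ∧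
      ∀ᵐ ω ∂μ, A ω ≤ (μ[f | M (k + 1)]) ω ∧ (μ[f | M (k + 1)]) ω ≤ A ω + c k) (s : ℝ) :
    ∫ ω, exp (s * (μ[f | M n]) ω) ∂μ ≤ exp (s ^ 2 * (∑ k ∈ Finset.range n, c k ^ 2) / 8) := by
  induction n with
  | zero =>
    have : ∫ ω, exp (s * (μ[f | M 0]) ω) ∂μ = ∫ _, 1 ∂μ :=
      integral_congr_ae (h0.mono fun ω h => by simp [h])
    simp [this]
  | succ n ih =>
    obtain ⟨A, hA, hAS⟩ := hrange n n.lt_succ_self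
    have hSn : StronglyMeasurable[M n] (μ[f | M n]) := stronglyMeasurable_condExp
    have hstep := integral_mul_exp_le_of_condExp_eq_zero (hM₀ n) (μ := μ)
      (Z := fun ω => exp (s * (μ[f | M n]) ω))
      (Y := μ[f | M (n + 1)] - μ[f | M n]) (A := A - μ[f | M n]) (c := c n)
      (R := exp (|s| * R)) s
      (continuous_exp.comp_stronglyMeasurable (hSn.const_mul s))
      (fun ω => (exp_pos _).le) ?_ (integrable_condExp.sub integrable_condExp) ?_ (hA.sub hSn)
      (hc n n.lt_succ_self) ?_
    · calc ∫ ω, exp (s * (μ[f | M (n + 1)]) ω) ∂μ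
          = ∫ ω, exp (s * (μ[f | M n]) ω) *
              exp (s * (μ[f | M (n + 1)] - μ[f | M n]) ω) ∂μ := by
            refine integral_congr_ae (.of_forall fun ω => ?_)
            simp only [← exp_add, Pi.sub_apply]
            ring_nf
        _ ≤ _ := hstep
        _ ≤ exp (s ^ 2 * c n ^ 2 / 8) *
              exp (s ^ 2 * (∑ k ∈ Finset.range n, c k ^ 2) / 8) := by
            gcongr
            exact ih (fun k hk => hc k (hk.trans n.lt_succ_self))
              fun k hk => hrange k (hk.trans n.lt_succ_self)
        _ = _ := by
            rw [← exp_add, Finset.sum_range_succ]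
            ring_nf
    · filter_upwards [ae_bdd_abs_condExp_of_ae_bdd_abs (m := M n) (.of_forall hfR)] with ω h
      rw [exp_le_exp]
      calc _ ≤ |s * (μ[f | M n]) ω| := le_abs_self _
        _ = |s| * |(μ[f | M n]) ω| := abs_mul _ _
        _ ≤ _ := by gcongr
    · have h1 : μ[μ[f | M (n + 1)] | M n] =ᵐ[μ] μ[f | M n] :=
        condExp_condExp_of_le (hM n.le_succ) (hM₀ _)
      filter_upwards [h1, condExp_sub (μ := μ) (integrable_condExp (f := f) (m := M (n + 1)))
        (integrable_condExp (f := f) (m := M n)) (M n)] with ω h1 h2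
      rw [h2, condExp_of_stronglyMeasurable (hM₀ n) hSn integrable_condExp]
      simp [h1]
    · filter_upwards [hAS] with ω h
      simp only [Pi.sub_apply]
      exact ⟨by linarith [h.1], by linarith [h.2]⟩

/-- Azuma–Hoeffding deviation inequality for a Doob martingale whose increments have
conditional range at most `c k`. -/
lemma measure_ge_le_of_condExp_range {Ω : Type*} {m₀ : MeasurableSpace Ω} {μ : Measure Ω}
    [IsProbabilityMeasure μ] {M : ℕ → MeasurableSpace Ω} (hM : Monotone M) (hM₀ : ∀ k, M k ≤ m₀)
    {f : Ω → ℝ} {R : ℝ} (hfR : ∀ ω, |f ω| ≤ R)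
    (h0 : μ[f | M 0] =ᵐ[μ] 0) {n : ℕ} (hf : StronglyMeasurable[M n] f) {c : ℕ → ℝ}
    (hc : ∀ k < n, 0 < c k) (hn : n ≠ 0)
    (hrange : ∀ k < n, ∃ A : Ω → ℝ, StronglyMeasurable[M k] A ∧
      ∀ᵐ ω ∂μ, A ω ≤ (μ[f | M (k + 1)]) ω ∧ (μ[f | M (k + 1)]) ω ≤ A ω + c k)
    {x : ℝ} (hx : 0 ≤ x) :
    μ {ω | √(2⁻¹ * (∑ k ∈ Finset.range n, c k ^ 2) * x) ≤ f ω} ≤ ENNReal.ofReal (exp (-x)) := by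
  set V := ∑ k ∈ Finset.range n, c k ^ 2 with hV
  have hV0 : 0 < V := Finset.sum_pos (fun k hk => pow_pos (hc k (Finset.mem_range.1 hk)) 2)
    (Finset.nonempty_range_iff.2 hn)
  set t := √(2⁻¹ * V * x) with ht
  have ht2 : t ^ 2 = 2⁻¹ * V * x := Real.sq_sqrt (by positivity)
  have ht0 : 0 ≤ t := Real.sqrt_nonneg _
  have hfm : AEStronglyMeasurable f μ := (hf.mono (hM₀ n)).aestronglyMeasurable
  have hfi : Integrable f μ := .of_bound hfm R (.of_forall hfR)
  have hmgf := integral_exp_condExp_le hM hM₀ hfR h0 hc hrange (4 * t / V)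
  rw [condExp_of_stronglyMeasurable (hM₀ n) hf hfi] at hmgf
  have hei : Integrable (fun ω => exp (4 * t / V * f ω)) μ := by
    refine .of_bound (continuous_exp.comp_aestronglyMeasurable (hfm.const_mul _))
      (exp (4 * t / V * R)) (.of_forall fun ω => ?_)
    rw [Real.norm_of_nonneg (exp_pos _).le, exp_le_exp]
    have := (abs_le.1 (hfR ω)).2
    gcongr
  have h := measure_ge_le_exp_mul_mgf (X := f) t (by positivity : 0 ≤ 4 * t / V) hei
  rw [← ofReal_measureReal]
  refine ENNReal.ofReal_le_ofReal (h.trans ?_)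
  calc _ ≤ exp (-(4 * t / V) * t) * exp ((4 * t / V) ^ 2 * V / 8) := by
        gcongr
        exact hmgf
    _ = exp (-x) := by
        rw [← exp_add]
        congr 1
        field_simp
        linear_combination (-16 : ℝ) * ht2

/-- If every section `F a` has conditional expectation within `ε` of its mean, then so does `F`
evaluated at an `m`-measurable point `ξ`, the mean being taken with `ξ` frozen. -/
lemma abs_condExp_sub_integral_frozen_le {Ω E : Type*} {m m₀ : MeasurableSpace Ω} (hm : m ≤ m₀)
    {μ : Measure Ω} [IsProbabilityMeasure μ] [PseudoMetricSpace E] [SecondCountableTopology E]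
    [MeasurableSpace E] [OpensMeasurableSpace E] {D K ε : ℝ} (hK : 0 ≤ K)
    (hD : ∀ a b : E, dist a b ≤ D) {F : E → Ω → ℝ}
    (hFlip : ∀ a b ω, |F a ω - F b ω| ≤ K * dist a b) (hF : ∀ a, Integrable (F a) μ)
    {ξ : Ω → E} (hξ : Measurable[m] ξ) (hFξ : Integrable (fun ω => F (ξ ω) ω) μ)
    (hε : ∀ a, ∀ᵐ ω ∂μ, |(μ[F a | m]) ω - ∫ ω', F a ω' ∂μ| ≤ ε) :
    ∀ᵐ ω ∂μ, |(μ[fun ω' => F (ξ ω') ω' | m]) ω - ∫ ω', F (ξ ω) ω' ∂μ| ≤ ε := by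
  have hint (a b : E) : |∫ ω, F a ω ∂μ - ∫ ω, F b ω ∂μ| ≤ K * dist a b := by
    rw [← integral_sub (hF a) (hF b)]
    simpa using norm_integral_le_of_norm_le_const (μ := μ)
      (.of_forall fun ω => (Real.norm_eq_abs _).trans_le (hFlip a b ω))
  have hcond (a : E) : ∀ᵐ ω ∂μ,
      |(μ[fun ω' => F (ξ ω') ω' | m]) ω - (μ[F a | m]) ω| ≤ K * dist (ξ ω) a := by
    have hdm : StronglyMeasurable[m] fun ω => K * dist (ξ ω) a :=
      ((continuous_const.mul (continuous_id.dist continuous_const)).measurable.comp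
        hξ).stronglyMeasurable
    have hdi : Integrable (fun ω => K * dist (ξ ω) a) μ := by
      refine .of_bound (hdm.mono hm).aestronglyMeasurable (K * D) (.of_forall fun ω => ?_)
      rw [Real.norm_of_nonneg (by positivity)]
      gcongr
      exact hD _ _
    have h1 := condExp_mono (m := m) (hFξ.sub (hF a)) hdi
      (.of_forall fun ω => (abs_le.1 (hFlip (ξ ω) a ω)).2)
    have h2 := condExp_mono (m := m) hdi.neg (hFξ.sub (hF a))
      (.of_forall fun ω => (abs_le.1 (hFlip (ξ ω) a ω)).1)
    have hn : StronglyMeasurable[m] (-fun ω => K * dist (ξ ω) a) := hdm.neg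
    rw [condExp_of_stronglyMeasurable hm hdm hdi] at h1
    rw [condExp_of_stronglyMeasurable hm hn hdi.neg] at h2
    filter_upwards [h1, h2, condExp_sub hFξ (hF a) m] with ω h1 h2 h3
    rw [h3] at h1 h2
    exact abs_le.2 ⟨h2, h1⟩
  rcases isEmpty_or_nonempty E with hE | hE
  · exact .of_forall fun ω => hE.elim (ξ ω)
  have hall : ∀ᵐ ω ∂μ, ∀ i : ℕ,
      |(μ[fun ω' => F (ξ ω') ω' | m]) ω - ∫ ω', F (ξ ω) ω' ∂μ|
        ≤ ε + 2 * K * dist (ξ ω) (TopologicalSpace.denseSeq E i) := by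
    rw [ae_all_iff]
    intro i
    filter_upwards [hcond (TopologicalSpace.denseSeq E i), hε (TopologicalSpace.denseSeq E i)]
      with ω h1 h2
    have h3 := hint (ξ ω) (TopologicalSpace.denseSeq E i)
    rw [abs_le] at *
    constructor <;> linarith [h1.1, h1.2, h2.1, h2.2, h3.1, h3.2]
  filter_upwards [hall] with ω h
  refine le_of_forall_pos_le_add fun δ hδ => ?_
  obtain ⟨i, hi⟩ := (TopologicalSpace.denseRange_denseSeq E).exists_dist_lt (ξ ω)
    (by positivity : 0 < δ / (2 * K + 1))
  refine (h i).trans (add_le_add_right ?_ ε)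
  calc _ ≤ (2 * K + 1) * (δ / (2 * K + 1)) := by
        gcongr
        linarith
    _ = δ := by field_simp

/-- The `φ`-mixing coefficient controls the conditional expectations of all functions which are
separately 1-Lipschitz. -/
lemma abs_condExp_sub_integral_le_mul_sSup {Ω : Type*} {m m₀ : MeasurableSpace Ω} (hm : m ≤ m₀)
    {μ : Measure Ω} [IsProbabilityMeasure μ] {𝒳 : Type*} [PseudoMetricSpace 𝒳]
    (hdiam : ∀ y z : 𝒳, dist y z ≤ 1) {q : ℕ} {r : ℝ} (hr : r = q) (hq : 0 < q)
    (Y : Fin q → Ω → 𝒳) {f : (Fin q → 𝒳) → ℝ}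
    (hf : ∀ x y : Fin q → 𝒳, |f x - f y| ≤ ∑ i, dist (x i) (y i))
    (hfi : Integrable (fun ω => f (fun i => Y i ω)) μ) :
    ∀ᵐ ω ∂μ, |(μ[fun ω' => f (fun i => Y i ω') | m]) ω - ∫ ω', f (fun i => Y i ω') ∂μ| ≤
      r * sSup {c : ℝ | ∃ g : (Fin q → 𝒳) → ℝ,
        (∀ x y : Fin q → 𝒳, |g x - g y| ≤ r⁻¹ * ∑ i, dist (x i) (y i)) ∧
        (∀ x : Fin q → 𝒳, |g x| ≤ 1 / 2) ∧
        c = (eLpNorm (fun ω => (μ[(fun ω' => g (fun i => Y i ω')) | m]) ω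
              - ∫ ω', g (fun i => Y i ω') ∂μ) ⊤ μ).toReal} := by
  have hr0 : 0 < r := by rw [hr]; exact_mod_cast hq
  have hosc (x y : Fin q → 𝒳) : f x ≤ f y + r := by
    have h := (abs_le.1 ((hf x y).trans (Finset.sum_le_sum fun i _ => hdiam (x i) (y i)))).2
    simp only [Finset.sum_const, Finset.card_univ, Fintype.card_fin, nsmul_eq_mul, mul_one,
      ← hr] at h
    linarith
  have hbound {g : (Fin q → 𝒳) → ℝ} (hg : ∀ x, |g x| ≤ 1 / 2) :
      eLpNorm (fun ω => (μ[(fun ω' => g (fun i => Y i ω')) | m]) ω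
              - ∫ ω', g (fun i => Y i ω') ∂μ) ⊤ μ ≤ ENNReal.ofReal 1 := by
    rw [eLpNorm_exponent_top]
    refine eLpNormEssSup_le_of_ae_bound ?_
    filter_upwards [ae_bdd_abs_condExp_of_ae_bdd_abs (m := m) (μ := μ)
      (.of_forall fun ω => hg fun i => Y i ω)] with ω h1
    have h2 : |∫ ω', g (fun i => Y i ω') ∂μ| ≤ 1 / 2 := by
      simpa using norm_integral_le_of_norm_le_const (μ := μ)
        (.of_forall fun ω => (Real.norm_eq_abs _).trans_le (hg fun i => Y i ω))
    exact (norm_sub_le _ _).trans (by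
      simpa only [Real.norm_eq_abs, add_halves] using add_le_add h1 h2)
  obtain ⟨ω₀⟩ : Nonempty Ω := nonempty_of_isProbabilityMeasure μ
  have hne : Nonempty (Fin q → 𝒳) := ⟨fun i => Y i ω₀⟩
  have hbb : BddBelow (Set.range f) :=
    ⟨f hne.some - r, by rintro _ ⟨y, rfl⟩; linarith [hosc hne.some y]⟩
  set I := ⨅ y, f y
  have hI (y) : I ≤ f y := ciInf_le hbb y
  have hIr (y) : f y ≤ I + r := by
    have : f y - r ≤ I := le_ciInf fun z => by linarith [hosc y z]
    linarith
  let g : (Fin q → 𝒳) → ℝ := fun y => r⁻¹ * (f y - (I + r / 2))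
  have hg2 (y) : |g y| ≤ 1 / 2 := by
    simp only [g, abs_mul, abs_inv, abs_of_pos hr0]
    rw [inv_mul_le_iff₀ hr0, abs_le]
    constructor <;> linarith [hI y, hIr y]
  have hg1 (x y : Fin q → 𝒳) : |g x - g y| ≤ r⁻¹ * ∑ i, dist (x i) (y i) := by
    simp only [g, ← mul_sub, abs_mul, abs_inv, abs_of_pos hr0, sub_sub_sub_cancel_right]
    gcongr
    exact hf x y
  have hgc : μ[fun ω' => g (fun i => Y i ω') | m] =ᵐ[μ]
      fun ω => r⁻¹ * ((μ[fun ω' => f (fun i => Y i ω') | m]) ω - (I + r / 2)) := by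
    have h1 := condExp_smul (μ := μ) r⁻¹ (fun ω => f (fun i => Y i ω) - (I + r / 2)) m
    filter_upwards [h1, condExp_sub hfi (integrable_const (I + r / 2)) m] with ω h1 h2
    refine h1.trans ?_
    simp only [Pi.smul_apply, smul_eq_mul]
    congr 1
    refine h2.trans ?_
    simp [condExp_const hm]
  have hgi : ∫ ω', g (fun i => Y i ω') ∂μ
      = r⁻¹ * (∫ ω', f (fun i => Y i ω') ∂μ - (I + r / 2)) := by
    simp only [g]
    rw [integral_const_mul, integral_sub hfi (integrable_const _)]
    simp
  have hle := le_csSup (s := {c : ℝ | ∃ g : (Fin q → 𝒳) → ℝ,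
        (∀ x y : Fin q → 𝒳, |g x - g y| ≤ r⁻¹ * ∑ i, dist (x i) (y i)) ∧
        (∀ x : Fin q → 𝒳, |g x| ≤ 1 / 2) ∧
        c = (eLpNorm (fun ω => (μ[(fun ω' => g (fun i => Y i ω')) | m]) ω
              - ∫ ω', g (fun i => Y i ω') ∂μ) ⊤ μ).toReal})
    ⟨1, by
      rintro _ ⟨g, -, hg, rfl⟩
      exact ENNReal.toReal_le_of_le_ofReal zero_le_one (hbound hg)⟩ ⟨g, hg1, hg2, rfl⟩
  filter_upwards [hgc, ae_le_eLpNormEssSup (μ := μ)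
    (f := fun ω => (μ[(fun ω' => g (fun i => Y i ω')) | m]) ω
              - ∫ ω', g (fun i => Y i ω') ∂μ)] with ω h1 h2
  rw [← eLpNorm_exponent_top] at h2
  have h3 := ENNReal.toReal_mono ((hbound hg2).trans_lt ENNReal.ofReal_lt_top).ne h2
  rw [toReal_enorm] at h3
  have h4 := h3.trans hle
  rw [h1, hgi, ← mul_sub, sub_sub_sub_cancel_right, norm_mul,
    Real.norm_of_nonneg (inv_nonneg.2 hr0.le), inv_mul_le_iff₀ hr0] at h4
  exact h4

/-- A sum over `Fin n` whose first `j` terms are nonpositive is at most the sum of upper bounds for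
the remaining terms. -/
lemma sum_le_sum_tail {n j q : ℕ} (h : n = j + q) {u : Fin n → ℝ} {v : Fin q → ℝ}
    (hu : ∀ i : Fin n, (i : ℕ) < j → u i ≤ 0)
    (huv : ∀ (i : Fin n) (l : Fin q), (i : ℕ) = j + l → u i ≤ v l) :
    ∑ i, u i ≤ ∑ l, v l := by
  subst h
  rw [Fin.sum_univ_add]
  have h1 : ∑ i : Fin j, u (Fin.castAdd q i) ≤ 0 := Finset.sum_nonpos fun i _ => hu _ (by simp)
  have h2 : ∑ l : Fin q, u (Fin.natAdd j l) ≤ ∑ l, v l :=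
    Finset.sum_le_sum fun l _ => huv _ l (by simp)
  linarith

/-- The point with coordinates those of `a` below `k` and those of `b` from `k` on. -/
def mixAt {n : ℕ} {𝒳 : Type*} (k : ℕ) (a b : Fin n → 𝒳) : Fin n → 𝒳 :=
  fun i => if (i : ℕ) < k then a i else b i

lemma sum_dist_mixAt_le {n : ℕ} {𝒳 : Type*} [PseudoMetricSpace 𝒳] (k : ℕ) (a a' b : Fin n → 𝒳) :
    ∑ i, dist (mixAt k a b i) (mixAt k a' b i) ≤ n * dist a a' := by
  refine (Finset.sum_le_card_nsmul _ _ (dist a a') fun i _ => ?_).trans_eq (by simp)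
  unfold mixAt
  split_ifs
  · exact dist_le_pi_dist _ _ i
  · simp

/-- **Section 2.4 (deviation inequality of Hoeffding type).**
In case (A), for `g` separately 1-Lipschitz with `𝔼 g(X_1,…,X_n) = 0`, and with
`φ_j = φ(𝓜_j, (X_{j+1},…,X_n))`, for all `x ≥ 0`,
`ℙ(g(X_1,…,X_n) ≥ √((1/2) Σ_{j=1}^n (1 + 2(n−j)φ_j)² x)) ≤ e^{−x}`
(the `j = n` summand being `(1 + 2·0·φ_n)² = 1`). -/
theorem hoeffding_deviation_weakly_dependent
    {Ω : Type*} [MeasurableSpace Ω] (P : Measure Ω) [IsProbabilityMeasure P]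
    -- case (A): 𝒳 Polish with diameter at most 1
    {𝒳 : Type*} [MetricSpace 𝒳] [PolishSpace 𝒳] [MeasurableSpace 𝒳] [BorelSpace 𝒳]
    (hdiam : ∀ y z : 𝒳, dist y z ≤ 1)
    (n : ℕ) (hn : 1 ≤ n)
    (X : ℕ → Ω → 𝒳) (hXmeas : ∀ t, Measurable (X t))
    -- the probability space is rich enough
    (hrich : ∃ U : Ω → ℝ, Measurable U ∧
      Measure.map U P = volume.restrict (Set.Icc (0 : ℝ) 1) ∧
      Indep (MeasurableSpace.comap U inferInstance)
        (⨆ t ∈ Set.Icc 1 n, MeasurableSpace.comap (X t) inferInstance) P)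
    -- the coefficients φ_j = φ(𝓜_j, (X_{j+1},…,X_n)), 1 ≤ j ≤ n − 1
    (φ : ℕ → ℝ)
    (hφ : ∀ j : ℕ, 1 ≤ j → j ≤ n - 1 →
      φ j = sSup {c : ℝ | ∃ g : (Fin (n - j) → 𝒳) → ℝ,
        (∀ x y : Fin (n - j) → 𝒳,
          |g x - g y| ≤ ((n : ℝ) - j)⁻¹ * ∑ i, dist (x i) (y i)) ∧
        (∀ x : Fin (n - j) → 𝒳, |g x| ≤ 1 / 2) ∧
        c = (eLpNorm (fun ω =>
              (P[(fun ω' => g (fun i => X (j + 1 + i) ω')) |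
                ⨆ t ∈ Set.Icc 1 j, MeasurableSpace.comap (X t) inferInstance]) ω
              - ∫ ω', g (fun i => X (j + 1 + i) ω') ∂P) ⊤ P).toReal})
    -- g is separately 1-Lipschitz and centered
    (g : (Fin n → 𝒳) → ℝ)
    (hg_lip : ∀ x y : Fin n → 𝒳, |g x - g y| ≤ ∑ i, dist (x i) (y i))
    (hg_mean : ∫ ω, g (fun i => X (i + 1) ω) ∂P = 0)
    (x : ℝ) (hx : 0 ≤ x) :
    P {ω | Real.sqrt (2⁻¹ * (∑ j ∈ Finset.Icc 1 n, (1 + 2 * ((n : ℝ) - j) * φ j) ^ 2) * x)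
        ≤ g (fun i => X (i + 1) ω)}
      ≤ ENNReal.ofReal (Real.exp (-x)) := by
  obtain ⟨ω₀⟩ : Nonempty Ω := nonempty_of_isProbabilityMeasure P
  set M : ℕ → MeasurableSpace Ω := fun j =>
    ⨆ t ∈ Set.Icc 1 j, MeasurableSpace.comap (X t) inferInstance with hMdef
  have hM : Monotone M := fun j k hjk =>
    biSup_mono fun t ht => Set.Icc_subset_Icc_right hjk ht
  have hM₀ (k) : M k ≤ ‹MeasurableSpace Ω› := iSup₂_le fun t _ => (hXmeas t).comap_le
  have hXM {t k : ℕ} (h1 : 1 ≤ t) (h2 : t ≤ k) : Measurable[M k] (X t) :=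
    Measurable.mono (comap_measurable (X t))
      (le_biSup (fun t => MeasurableSpace.comap (X t) inferInstance) ⟨h1, h2⟩) le_rfl
  let W : Ω → Fin n → 𝒳 := fun ω i => X (i + 1) ω
  have hW : Measurable W := measurable_pi_lambda _ fun i => hXmeas _
  have hWM : Measurable[M n] W :=
    @measurable_pi_lambda _ _ _ (M n) _ W fun i => hXM (by omega) (by omega)
  have hgc : Continuous g := by
    refine (LipschitzWith.of_dist_le_mul (K := n) fun a b => ?_).continuous
    rw [Real.dist_eq]
    refine (hg_lip a b).trans ((Finset.sum_le_card_nsmul _ _ (dist a b) fun i _ =>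
      dist_le_pi_dist _ _ i).trans_eq (by simp))
  have hgR (a : Fin n → 𝒳) : |g a| ≤ |g (W ω₀)| + n := by
    have h := (hg_lip a (W ω₀)).trans (Finset.sum_le_sum fun i _ => hdiam _ _)
    simp only [Finset.sum_const, Finset.card_univ, Fintype.card_fin, nsmul_eq_mul, mul_one] at h
    linarith [abs_sub_abs_le_abs_sub (g a) (g (W ω₀))]
  have hgi {V : Ω → Fin n → 𝒳} (hV : Measurable V) : Integrable (fun ω => g (V ω)) P :=
    .of_bound (hgc.measurable.comp hV).aestronglyMeasurable _ (.of_forall fun ω => hgR _)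
  have hmixmeas {m : MeasurableSpace Ω} {k : ℕ} {a b : Ω → Fin n → 𝒳}
      (ha : ∀ i : Fin n, (i : ℕ) < k → Measurable[m] fun ω => a ω i)
      (hb : ∀ i : Fin n, k ≤ (i : ℕ) → Measurable[m] fun ω => b ω i) :
      Measurable[m] fun ω => mixAt k (a ω) (b ω) := by
    refine measurable_pi_lambda _ fun i => ?_
    by_cases h : (i : ℕ) < k
    · simpa only [mixAt, h, if_true] using ha i h
    · simpa only [mixAt, h, if_false] using hb i (not_lt.1 h)
  have hW_i (i : Fin n) : Measurable fun ω => W ω i := hXmeas _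
  let F : ℕ → (Fin n → 𝒳) → Ω → ℝ := fun j a ω => g (mixAt j a (W ω))
  have hFi (j a) : Integrable (F j a) P :=
    hgi (hmixmeas (fun i _ => measurable_const) fun i _ => hW_i i)
  let G : ℕ → (Fin n → 𝒳) → ℝ := fun j a => ∫ ω, F j a ω ∂P
  have hFG {j : ℕ} {a b : Fin n → 𝒳} {C : ℝ} (h : ∀ ω, |F j a ω - F j b ω| ≤ C) :
      |G j a - G j b| ≤ C := by
    simp only [G]
    rw [← integral_sub (hFi j a) (hFi j b)]
    simpa using norm_integral_le_of_norm_le_const (μ := P)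
      (.of_forall fun ω => (Real.norm_eq_abs _).trans_le (h ω))
  have hFlip (j a b ω) : |F j a ω - F j b ω| ≤ n * dist a b :=
    (hg_lip _ _).trans (sum_dist_mixAt_le j a b (W ω))
  have hφF (j : ℕ) (hj1 : 1 ≤ j) (hjn : j ≤ n) (a : Fin n → 𝒳) :
      ∀ᵐ ω ∂P, |(P[F j a | M j]) ω - G j a| ≤ ((n : ℝ) - j) * φ j := by
    rcases hjn.eq_or_lt with rfl | hlt
    · have : F j a = fun _ => g a := by
        funext ω
        simp only [F]
        congr 1
        funext i
        simp [mixAt]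
      simp [G, this, condExp_const (hM₀ j)]
    · rw [hφ j hj1 (by omega)]
      let f : (Fin (n - j) → 𝒳) → ℝ := fun y => g fun i =>
        if h : (i : ℕ) < j then a i else y ⟨i - j, by omega⟩
      have hfF : (fun ω => f fun i => X (j + 1 + i) ω) = F j a := by
        funext ω
        simp only [f, F]
        congr 1
        funext i
        simp only [mixAt, W]
        split_ifs with h
        · rfl
        · rw [show j + 1 + ((i : ℕ) - j) = i + 1 by omega]
      have hf (y z : Fin (n - j) → 𝒳) : |f y - f z| ≤ ∑ i, dist (y i) (z i) := by
        refine (hg_lip _ _).trans (sum_le_sum_tail (j := j) (by omega) (fun i hi => ?_)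
          fun i l hil => ?_)
        · simp [hi]
        · have h1 : ¬ (i : ℕ) < j := by omega
          have h2 : (⟨i - j, by omega⟩ : Fin (n - j)) = l := Fin.ext (by simp; omega)
          simp only [h1, dif_neg, not_false_iff, h2, le_refl]
      have key := abs_condExp_sub_integral_le_mul_sSup (hM₀ j) (μ := P) hdiam
        (r := (n : ℝ) - j) (by rw [Nat.cast_sub hjn]) (by omega)
        (fun i => X (j + 1 + i)) hf (by rw [hfF]; exact hFi j a)
      rw [hfF] at key
      exact key
  let ξ : ℕ → Ω → Fin n → 𝒳 := fun k ω => mixAt k (W ω) (W ω₀)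
  have hξ (k) : Measurable[M k] (ξ k) :=
    hmixmeas (fun i hi => hXM (by omega) (by omega)) fun i _ => measurable_const
  have hdec (j : ℕ) (hj1 : 1 ≤ j) (hjn : j ≤ n) :
      ∀ᵐ ω ∂P, |(P[fun ω' => g (W ω') | M j]) ω - G j (ξ j ω)| ≤ ((n : ℝ) - j) * φ j := by
    have hFξ : (fun ω => F j (ξ j ω) ω) = fun ω => g (W ω) := by
      funext ω
      simp only [F, ξ]
      congr 1
      funext i
      simp only [mixAt]
      split_ifs <;> rfl
    have key := abs_condExp_sub_integral_frozen_le (hM₀ j) (μ := P) (Nat.cast_nonneg n)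
      (fun a b => (dist_pi_le_iff zero_le_one).2 fun i => hdiam (a i) (b i)) (hFlip j)
      (hFi j) (hξ j) (by rw [hFξ]; exact hgi hW) (hφF j hj1 hjn)
    rw [hFξ] at key
    exact key
  let H : ℕ → (Fin n → 𝒳) → 𝒳 → ℝ := fun k a z => G (k + 1) (mixAt k a fun _ => z)
  have hne : Nonempty 𝒳 := ⟨X 0 ω₀⟩
  have hHz (k a z z') : |H k a z - H k a z'| ≤ 1 := by
    refine hFG fun ω => (hg_lip _ _).trans ?_
    by_cases hk : k < n
    · rw [Finset.sum_eq_single (⟨k, hk⟩ : Fin n)]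
      · exact hdiam _ _
      · intro i _ hi
        have : (i : ℕ) ≠ k := fun h => hi (Fin.ext h)
        simp only [mixAt]
        split_ifs <;> first | exact dist_self _ | omega
      · simp
    · refine (Finset.sum_nonpos fun i _ => ?_).trans zero_le_one
      have : (i : ℕ) < k := by omega
      simp [mixAt, this]
  have hHa (k a b z) : |H k a z - H k b z| ≤ n * dist a b := by
    refine hFG fun ω => (hFlip _ _ _ ω).trans ?_
    gcongr
    refine (dist_pi_le_iff dist_nonneg).2 fun i => ?_
    simp only [mixAt]
    split_ifs
    · exact dist_le_pi_dist _ _ i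
    · simp
  have hHbdd (k a) : BddBelow (Set.range (H k a)) := by
    refine ⟨H k a hne.some - 1, ?_⟩
    rintro _ ⟨z, rfl⟩
    linarith [(abs_le.1 (hHz k a hne.some z)).2]
  let B : ℕ → (Fin n → 𝒳) → ℝ := fun k a => ⨅ z, H k a z
  have hBc (k) : Continuous (B k) := by
    refine (LipschitzWith.of_le_add_mul n fun a b => ?_).continuous
    rw [← sub_le_iff_le_add]
    refine le_ciInf fun z => ?_
    have h1 := ciInf_le (hHbdd k a) z
    have h2 := (abs_le.1 (hHa k a b z)).2
    simp only [NNReal.coe_natCast, B]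
    linarith
  have hGH (k ω) : G (k + 1) (ξ (k + 1) ω) = H k (ξ k ω) (X (k + 1) ω) := by
    simp only [G, H, F]
    congr 1
    funext ω'
    congr 1
    funext i
    simp only [mixAt, ξ, W]
    split_ifs <;> first | rfl | omega | skip
    congr 2
    omega
  let c : ℕ → ℝ := fun k => 1 + 2 * ((n : ℝ) - (k + 1 : ℕ)) * φ (k + 1)
  have hφ0 (k : ℕ) (hk : k < n) : 0 ≤ ((n : ℝ) - (k + 1 : ℕ)) * φ (k + 1) := by
    rcases (show k + 1 ≤ n from hk).eq_or_lt with h | h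
    · simp [← h]
    · refine mul_nonneg (sub_nonneg.2 (by exact_mod_cast hk)) ?_
      rw [hφ (k + 1) (by omega) (by omega)]
      refine Real.sSup_nonneg ?_
      rintro _ ⟨g', -, -, rfl⟩
      exact ENNReal.toReal_nonneg
  have hrange : ∀ k < n, ∃ A : Ω → ℝ, StronglyMeasurable[M k] A ∧
      ∀ᵐ ω ∂P, A ω ≤ (P[fun ω => g (W ω) | M (k + 1)]) ω ∧
        (P[fun ω => g (W ω) | M (k + 1)]) ω ≤ A ω + c k := by
    intro k hk
    refine ⟨fun ω => B k (ξ k ω) - ((n : ℝ) - (k + 1 : ℕ)) * φ (k + 1),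
      (((hBc k).sub continuous_const).measurable.comp (hξ k)).stronglyMeasurable, ?_⟩
    filter_upwards [hdec (k + 1) (by omega) hk] with ω h
    rw [hGH, abs_le] at h
    have h1 : B k (ξ k ω) ≤ H k (ξ k ω) (X (k + 1) ω) := ciInf_le (hHbdd _ _) _
    have h2 : H k (ξ k ω) (X (k + 1) ω) - 1 ≤ B k (ξ k ω) :=
      le_ciInf fun z => by linarith [(abs_le.1 (hHz k (ξ k ω) (X (k + 1) ω) z)).2]
    simp only [c]
    constructor <;> linarith [h.1, h.2]
  have h0 : P[fun ω => g (W ω) | M 0] =ᵐ[P] 0 := by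
    have : M 0 = ⊥ := by
      simp only [hMdef, Set.Icc_eq_empty_of_lt zero_lt_one, Set.mem_empty_iff_false, iSup_false,
        iSup_bot]
    rw [this, condExp_bot]
    exact .of_forall fun ω => hg_mean
  have hsum : ∑ j ∈ Finset.Icc 1 n, (1 + 2 * ((n : ℝ) - j) * φ j) ^ 2
      = ∑ k ∈ Finset.range n, c k ^ 2 := by
    rw [Finset.range_eq_Ico,
      Finset.sum_Ico_add' (fun j : ℕ => (1 + 2 * ((n : ℝ) - j) * φ j) ^ 2) 0 n 1]
    rfl
  rw [hsum]
  exact measure_ge_le_of_condExp_range hM hM₀ (fun ω => hgR (W ω)) h0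
    (hgc.measurable.comp hWM).stronglyMeasurable
    (fun k hk => by simp only [c]; linarith [hφ0 k hk]) (by omega) hrange hx
end
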